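/- Let $d \ge 2$, $s \in \left(\frac{d}{2d-1}, 1\right)$, and let $(q,r) \in [2,\infty]^2$ satisfy $\frac{2s}{q} = d\left(\frac{1}{2} - \frac{1}{r}\right)$. There is a constant $C$ (depending on $d, s, q, r$) such that for every radial Schwartz function $u_0$ on $\mathbb{R}^d$: $\|e^{-it(-\Delta)^s} u_0\|_{L^q_t L^r_x(\mathbb{R} \times \mathbb{R}^d)} \le C\, \|u_0\|_{L^2(\mathbb{R}^d)}$. -/

import Mathlib

open MeasureTheory Complex
open scoped ENNReal BigOperators RealInnerProductSpace

noncomputable section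

abbrev Ed (d : ℕ) := EuclideanSpace ℝ (Fin d)

/-- Fourier transform with convention `(𝓕 f) ξ = ∫ e^{-i x·ξ} f x dx`. -/
def FT {d : ℕ} (f : Ed d → ℂ) (ξ : Ed d) : ℂ :=
  ∫ x : Ed d, Complex.exp (-Complex.I * ((⟪x, ξ⟫ : ℝ) : ℂ)) * f x

/-- Inverse Fourier transform `(2π)^{-d} ∫ e^{i x·ξ} g ξ dξ`. -/
def FTinv {d : ℕ} (g : Ed d → ℂ) (x : Ed d) : ℂ :=
  (((2 * Real.pi) ^ (-(d : ℝ)) : ℝ) : ℂ) *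
    ∫ ξ : Ed d, Complex.exp (Complex.I * ((⟪x, ξ⟫ : ℝ) : ℂ)) * g ξ

/-- Fractional Schrödinger propagator `e^{-it(-Δ)^s}`. -/
def fprop {d : ℕ} (s t : ℝ) (f : Ed d → ℂ) : Ed d → ℂ :=
  FTinv (fun ξ => Complex.exp (-Complex.I * (t : ℂ) * ((‖ξ‖ ^ (2 * s) : ℝ) : ℂ)) * FT f ξ)

/-- Fractional derivative `D^σ = (-Δ)^{σ/2}`, the Fourier multiplier `|ξ|^σ`. -/
def fracD {d : ℕ} (σ : ℝ) (f : Ed d → ℂ) : Ed d → ℂ :=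
  FTinv (fun ξ => ((‖ξ‖ ^ σ : ℝ) : ℂ) * FT f ξ)

/-- `(-Δ)^{β/2} e^{-it(-Δ)^s}`. -/
def fracDProp {d : ℕ} (β s t : ℝ) (f : Ed d → ℂ) : Ed d → ℂ :=
  FTinv (fun ξ => ((‖ξ‖ ^ β : ℝ) : ℂ) *
    Complex.exp (-Complex.I * (t : ℂ) * ((‖ξ‖ ^ (2 * s) : ℝ) : ℂ)) * FT f ξ)

/-- Resolvent `(-Δ + λ)⁻¹`. -/
def resolv {d : ℕ} (lam : ℝ) (f : Ed d → ℂ) : Ed d → ℂ :=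
  FTinv (fun ξ => FT f ξ / ((‖ξ‖ ^ 2 + lam : ℝ) : ℂ))

/-- Resolvent-regularization `u_λ = √(sin(πs)/π) (-Δ+λ)⁻¹ u`. -/
def reg {d : ℕ} (s lam : ℝ) (f : Ed d → ℂ) : Ed d → ℂ :=
  fun x => ((Real.sqrt (Real.sin (Real.pi * s) / Real.pi) : ℝ) : ℂ) * resolv lam f x

/-- A function is radial if its value depends only on `|x|`. -/
def IsRadial {d : ℕ} (f : Ed d → ℂ) : Prop :=
  ∀ x y : Ed d, ‖x‖ = ‖y‖ → f x = f y

/-- Homogeneous Sobolev norm `‖f‖_{Ḣ^s} = (2π)^{-d/2} ‖ |ξ|^s 𝓕f ‖_{L²}`. -/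
def HdotNorm {d : ℕ} (s : ℝ) (f : Ed d → ℂ) : ℝ :=
  (2 * Real.pi) ^ (-(d : ℝ) / 2) *
    (eLpNorm (fun ξ : Ed d => ((‖ξ‖ ^ s : ℝ) : ℂ) * FT f ξ) 2 volume).toReal

/-- Inhomogeneous Sobolev norm `‖f‖_{H^s}² = ‖f‖_{L²}² + ‖f‖_{Ḣ^s}²`. -/
def HNorm {d : ℕ} (s : ℝ) (f : Ed d → ℂ) : ℝ :=
  Real.sqrt ((eLpNorm f 2 volume).toReal ^ 2 + HdotNorm s f ^ 2)

/-- Mixed space-time norm `L^q_t L^r_x (ℝ × ℝ^d)`. -/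
def mixedNorm {d : ℕ} (q r : ℝ≥0∞) (F : ℝ → Ed d → ℂ) : ℝ≥0∞ :=
  eLpNorm (fun t => (eLpNorm (F t) r volume).toReal) q volume

/-- Partial derivative `∂_j` of a complex-valued function. -/
def pd {d : ℕ} (j : Fin d) (f : Ed d → ℂ) (x : Ed d) : ℂ :=
  fderiv ℝ f x (EuclideanSpace.single j 1)

/-- Partial derivative `∂_j` of a real-valued function. -/
def pdR {d : ℕ} (j : Fin d) (f : Ed d → ℝ) (x : Ed d) : ℝ :=
  fderiv ℝ f x (EuclideanSpace.single j 1)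

/-- Laplacian of a real-valued function. -/
def lapR {d : ℕ} (f : Ed d → ℝ) : Ed d → ℝ :=
  fun x => ∑ j : Fin d, pdR j (pdR j f) x

/-- Rescaling `χ_R(x) = χ(x/R)`. -/
def chiR {d : ℕ} (χ : Ed d → ℝ) (R : ℝ) : Ed d → ℝ :=
  fun x => χ (R⁻¹ • x)


/-- Squared `H^{1/2}` norm `(2π)^{-d} ∫ (1+|ξ|²)^{1/2} |𝓕u(ξ)|² dξ`. -/
def H12sq {d : ℕ} (f : Ed d → ℂ) : ℝ :=
  (2 * Real.pi) ^ (-(d : ℝ)) * ∫ ξ : Ed d, (1 + ‖ξ‖ ^ 2) ^ ((1 : ℝ)/2) * ‖FT f ξ‖ ^ 2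

namespace RadialStrichartz

open scoped ComplexConjugate

/-- Schur test for `T f = ∫ e(·, y) f(y) dy`, in terms of the kernel of `T* T`. -/
theorem lintegral_enorm_sq_le_of_kernel_bound {α β : Type*} [MeasurableSpace α]
    [MeasurableSpace β] {μ : Measure α} [IsFiniteMeasure μ] {ν : Measure β} [SFinite ν]
    {e : α → β → ℂ} (he : Measurable (Function.uncurry e)) {M : ℝ} (heM : ∀ x y, ‖e x y‖ ≤ M)
    {f : β → ℂ} (hf : Integrable f ν) {k : β → β → ℝ≥0∞} (hk : Measurable (Function.uncurry k))
    {K : ℝ≥0∞} (hK : ∀ y, ∫⁻ y', k y y' ∂ν ≤ K) (hK' : ∀ y', ∫⁻ y, k y y' ∂ν ≤ K)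
    (hek : ∀ y y', ‖∫ x, e x y * conj (e x y') ∂μ‖ₑ ≤ k y y') :
    ∫⁻ x, ‖∫ y, e x y * f y ∂ν‖ₑ ^ 2 ∂μ ≤ K * ∫⁻ y, ‖f y‖ₑ ^ 2 ∂ν := by
  set V : α → ℂ := fun x => ∫ y, e x y * f y ∂ν with hV
  have hef : ∀ x, Integrable (fun y => e x y * f y) ν := fun x =>
    hf.bdd_mul (he.of_uncurry_left.aestronglyMeasurable) (ae_of_all _ (heM x))
  have hVm : AEStronglyMeasurable V μ := by
    have : AEStronglyMeasurable (fun p : α × β => e p.1 p.2 * f p.2) (μ.prod ν) :=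
      he.aestronglyMeasurable.mul hf.aestronglyMeasurable.comp_snd
    exact this.integral_prod_right'
  have hVb : ∀ x, ‖V x‖ ≤ M * ∫ y, ‖f y‖ ∂ν := by
    intro x
    rw [← integral_const_mul]
    refine norm_integral_le_of_norm_le (hf.norm.const_mul M) (ae_of_all _ fun y => ?_)
    rw [norm_mul]
    gcongr
    exact heM x y
  have hVint : Integrable (fun x => ‖V x‖ ^ 2) μ := by
    refine Integrable.of_bound (hVm.norm.pow 2) ((M * ∫ y, ‖f y‖ ∂ν) ^ 2) (ae_of_all _ fun x => ?_)
    rw [Real.norm_of_nonneg (by positivity)]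
    gcongr
    exact hVb x
  have key : ((∫ x, ‖V x‖ ^ 2 ∂μ : ℝ) : ℂ)
      = ∫ p : β × β, (∫ x, e x p.1 * conj (e x p.2) ∂μ) * (f p.1 * conj (f p.2)) ∂(ν.prod ν) := by
    have h1 : ∀ x, ((‖V x‖ ^ 2 : ℝ) : ℂ)
        = ∫ p : β × β, (e x p.1 * conj (e x p.2)) * (f p.1 * conj (f p.2)) ∂(ν.prod ν) := by
      intro x
      have : ((‖V x‖ ^ 2 : ℝ) : ℂ) = V x * conj (V x) := by
        rw [Complex.mul_conj, Complex.normSq_eq_norm_sq]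
      rw [this, hV]
      simp only
      rw [← integral_conj, ← integral_prod_mul]
      congr 1
      ext p
      simp only [map_mul]
      ring
    have h0 : ((∫ x, ‖V x‖ ^ 2 ∂μ : ℝ) : ℂ) = ∫ x, ((‖V x‖ ^ 2 : ℝ) : ℂ) ∂μ :=
      (_root_.integral_ofReal (𝕜 := ℂ)).symm
    rw [h0]
    simp only [h1]
    rw [integral_integral_swap]
    · simp only [integral_mul_const]
    · have h2 : Integrable (fun q : α × (β × β) => (f q.2.1 * conj (f q.2.2)))
          (μ.prod (ν.prod ν)) :=
        (hf.mul_prod ((Complex.conjLIE : ℂ ≃ₗᵢ[ℝ] ℂ).integrable_comp_iff.2 hf)).comp_snd μ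
      refine h2.bdd_mul (c := M * M) ?_ (ae_of_all _ fun q => ?_)
      · refine Measurable.aestronglyMeasurable ?_
        refine Measurable.mul ?_ ?_
        · exact he.comp (measurable_fst.prodMk (measurable_fst.comp measurable_snd))
        · exact Complex.continuous_conj.measurable.comp
            (he.comp (measurable_fst.prodMk (measurable_snd.comp measurable_snd)))
      · simp only [norm_mul, RCLike.norm_conj]
        have := heM q.1 q.2.1
        have := heM q.1 q.2.2
        gcongr
        exact (norm_nonneg _).trans (heM q.1 q.2.1)
  have hfm : AEMeasurable (fun y => ‖f y‖ₑ ^ 2) ν := hf.aestronglyMeasurable.enorm.pow_const 2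
  have m1 : AEMeasurable (fun p : β × β => k p.1 p.2 * ‖f p.1‖ₑ ^ 2) (ν.prod ν) :=
    hk.aemeasurable.mul hfm.comp_fst
  have m2 : AEMeasurable (fun p : β × β => k p.1 p.2 * ‖f p.2‖ₑ ^ 2) (ν.prod ν) :=
    hk.aemeasurable.mul hfm.comp_snd
  calc ∫⁻ x, ‖V x‖ₑ ^ 2 ∂μ = ‖((∫ x, ‖V x‖ ^ 2 ∂μ : ℝ) : ℂ)‖ₑ := by
        rw [← ofReal_norm, Complex.norm_real,
          Real.norm_of_nonneg (integral_nonneg fun x => by positivity),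
          ofReal_integral_eq_lintegral_ofReal hVint (ae_of_all _ fun x => by positivity)]
        refine lintegral_congr fun x => ?_
        rw [ENNReal.ofReal_pow (norm_nonneg _), ofReal_norm]
    _ ≤ ∫⁻ p : β × β, ‖(∫ x, e x p.1 * conj (e x p.2) ∂μ) * (f p.1 * conj (f p.2))‖ₑ ∂(ν.prod ν) := by
        rw [key]; exact enorm_integral_le_lintegral_enorm _
    _ ≤ ∫⁻ p : β × β, 2⁻¹ * (k p.1 p.2 * ‖f p.1‖ₑ ^ 2) + 2⁻¹ * (k p.1 p.2 * ‖f p.2‖ₑ ^ 2)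
          ∂(ν.prod ν) := by
        refine lintegral_mono fun p => ?_
        have h3 : ‖f p.1‖ₑ * ‖f p.2‖ₑ ≤ 2⁻¹ * ‖f p.1‖ₑ ^ 2 + 2⁻¹ * ‖f p.2‖ₑ ^ 2 := by
          rw [← mul_add, ← ofReal_norm, ← ofReal_norm,
            ← ENNReal.ofReal_mul (norm_nonneg _), ← ENNReal.ofReal_pow (norm_nonneg _),
            ← ENNReal.ofReal_pow (norm_nonneg _), ← ENNReal.ofReal_add (by positivity)
              (by positivity), show (2 : ℝ≥0∞)⁻¹ = ENNReal.ofReal (2⁻¹) by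
                rw [ENNReal.ofReal_inv_of_pos two_pos]; simp,
            ← ENNReal.ofReal_mul (by positivity)]
          refine ENNReal.ofReal_le_ofReal ?_
          nlinarith [sq_nonneg (‖f p.1‖ - ‖f p.2‖)]
        have h4 : ‖conj (f p.2)‖ₑ = ‖f p.2‖ₑ := by
          rw [← ofReal_norm, RCLike.norm_conj, ofReal_norm]
        calc _ ≤ k p.1 p.2 * (‖f p.1‖ₑ * ‖f p.2‖ₑ) := by
              rw [enorm_mul, enorm_mul, h4]; gcongr; exact hek _ _
          _ ≤ k p.1 p.2 * (2⁻¹ * ‖f p.1‖ₑ ^ 2 + 2⁻¹ * ‖f p.2‖ₑ ^ 2) := by gcongr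
          _ = _ := by ring
    _ = 2⁻¹ * (∫⁻ p : β × β, k p.1 p.2 * ‖f p.1‖ₑ ^ 2 ∂(ν.prod ν))
        + 2⁻¹ * (∫⁻ p : β × β, k p.1 p.2 * ‖f p.2‖ₑ ^ 2 ∂(ν.prod ν)) := by
        rw [lintegral_add_left' (m1.const_mul _), lintegral_const_mul'' _ m1,
          lintegral_const_mul'' _ m2]
    _ ≤ 2⁻¹ * (K * ∫⁻ y, ‖f y‖ₑ ^ 2 ∂ν) + 2⁻¹ * (K * ∫⁻ y, ‖f y‖ₑ ^ 2 ∂ν) := by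
        gcongr
        · rw [lintegral_prod _ m1, ← lintegral_const_mul'' _ hfm]
          refine lintegral_mono fun y => ?_
          simp only
          rw [lintegral_mul_const _ (hk.of_uncurry_left)]
          gcongr
          exact hK y
        · rw [lintegral_prod_symm _ m2,
            ← lintegral_const_mul'' _ hfm]
          refine lintegral_mono fun y => ?_
          simp only
          rw [lintegral_mul_const _ (hk.of_uncurry_right)]
          gcongr
          exact hK' y
    _ = K * ∫⁻ y, ‖f y‖ₑ ^ 2 ∂ν := by
        rw [← add_mul, ENNReal.inv_two_add_inv_two, one_mul]

/-- The `T T*` principle: a Schur bound on the kernel of `T T*` bounds `T` on `L²`. -/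
theorem lintegral_enorm_sq_le_of_dual_kernel_bound {α β : Type*} [MeasurableSpace α]
    [MeasurableSpace β] {μ : Measure α} [IsFiniteMeasure μ] {ν : Measure β} [IsFiniteMeasure ν]
    {e : α → β → ℂ} (he : Measurable (Function.uncurry e)) {M : ℝ} (heM : ∀ x y, ‖e x y‖ ≤ M)
    {f : β → ℂ} (hf : Integrable f ν) {k : α → α → ℝ≥0∞} (hk : Measurable (Function.uncurry k))
    {K : ℝ≥0∞} (hK : ∀ x, ∫⁻ x', k x x' ∂μ ≤ K) (hK' : ∀ x', ∫⁻ x, k x x' ∂μ ≤ K)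
    (hek : ∀ x x', ‖∫ y, e x y * conj (e x' y) ∂ν‖ₑ ≤ k x x') :
    ∫⁻ x, ‖∫ y, e x y * f y ∂ν‖ₑ ^ 2 ∂μ ≤ K * ∫⁻ y, ‖f y‖ₑ ^ 2 ∂ν := by
  set V : α → ℂ := fun x => ∫ y, e x y * f y ∂ν with hV
  have hVm : AEStronglyMeasurable V μ := by
    have : AEStronglyMeasurable (fun p : α × β => e p.1 p.2 * f p.2) (μ.prod ν) :=
      he.aestronglyMeasurable.mul hf.aestronglyMeasurable.comp_snd
    exact this.integral_prod_right'
  have hVb : ∀ x, ‖V x‖ ≤ M * ∫ y, ‖f y‖ ∂ν := by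
    intro x
    rw [← integral_const_mul]
    refine norm_integral_le_of_norm_le (hf.norm.const_mul M) (ae_of_all _ fun y => ?_)
    rw [norm_mul]
    gcongr
    exact heM x y
  have hVint : Integrable (fun x => ‖V x‖ ^ 2) μ := by
    refine Integrable.of_bound (hVm.norm.pow 2) ((M * ∫ y, ‖f y‖ ∂ν) ^ 2) (ae_of_all _ fun x => ?_)
    rw [Real.norm_of_nonneg (by positivity)]
    gcongr
    exact hVb x
  have hVc : Integrable (fun x => conj (V x)) μ :=
    (Complex.conjLIE : ℂ ≃ₗᵢ[ℝ] ℂ).integrable_comp_iff.2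
      (Integrable.of_bound hVm _ (ae_of_all _ hVb))
  set D : β → ℂ := fun y => ∫ x, e x y * conj (V x) ∂μ with hD
  have hDm : AEStronglyMeasurable D ν := by
    have : AEStronglyMeasurable (fun p : β × α => e p.2 p.1 * conj (V p.2)) (ν.prod μ) :=
      (he.comp measurable_swap).aestronglyMeasurable.mul hVc.aestronglyMeasurable.comp_snd
    exact this.integral_prod_right'
  have hQeq : ∫⁻ x, ‖V x‖ₑ ^ 2 ∂μ = ENNReal.ofReal (∫ x, ‖V x‖ ^ 2 ∂μ) := by
    rw [ofReal_integral_eq_lintegral_ofReal hVint (ae_of_all _ fun x => by positivity)]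
    refine lintegral_congr fun x => ?_
    rw [ENNReal.ofReal_pow (norm_nonneg _), ofReal_norm]
  have hQtop : ∫⁻ x, ‖V x‖ₑ ^ 2 ∂μ ≠ ∞ := by rw [hQeq]; exact ENNReal.ofReal_ne_top
  set Q := ∫⁻ x, ‖V x‖ₑ ^ 2 ∂μ with hQ
  have hDle : ∫⁻ y, ‖D y‖ₑ ^ 2 ∂ν ≤ K * Q := by
    have := lintegral_enorm_sq_le_of_kernel_bound (μ := ν) (ν := μ) (e := fun y x => e x y)
      (he.comp measurable_swap) (fun y x => heM x y) hVc hk hK hK' hek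
    refine this.trans (le_of_eq ?_)
    congr 1
    refine lintegral_congr fun x => ?_
    rw [← ofReal_norm, RCLike.norm_conj, ofReal_norm]
  have key : ((∫ x, ‖V x‖ ^ 2 ∂μ : ℝ) : ℂ) = ∫ y, f y * D y ∂ν := by
    have h0 : ((∫ x, ‖V x‖ ^ 2 ∂μ : ℝ) : ℂ) = ∫ x, ((‖V x‖ ^ 2 : ℝ) : ℂ) ∂μ :=
      (_root_.integral_ofReal (𝕜 := ℂ)).symm
    have h1 : ∀ x, ((‖V x‖ ^ 2 : ℝ) : ℂ) = ∫ y, e x y * (conj (V x) * f y) ∂ν := by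
      intro x
      have : ((‖V x‖ ^ 2 : ℝ) : ℂ) = conj (V x) * V x := by
        rw [mul_comm, Complex.mul_conj, Complex.normSq_eq_norm_sq]
      rw [this]
      nth_rewrite 2 [hV]
      simp only
      rw [← integral_const_mul]
      congr 1
      ext y
      ring
    rw [h0]
    simp only [h1]
    rw [integral_integral_swap]
    · congr 1
      ext y
      rw [hD]
      simp only
      rw [← integral_const_mul]
      congr 1
      ext x
      ring
    · exact (hVc.mul_prod hf).bdd_mul (c := M) he.aestronglyMeasurable
        (ae_of_all _ fun p => heM p.1 p.2)
  have hQle : Q ≤ (∫⁻ y, ‖f y‖ₑ ^ 2 ∂ν) ^ (1 / 2 : ℝ) * (K * Q) ^ (1 / 2 : ℝ) := by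
    calc Q = ‖((∫ x, ‖V x‖ ^ 2 ∂μ : ℝ) : ℂ)‖ₑ := by
          rw [hQeq, ← ofReal_norm, Complex.norm_real,
            Real.norm_of_nonneg (integral_nonneg fun x => by positivity)]
      _ ≤ ∫⁻ y, ‖f y * D y‖ₑ ∂ν := by rw [key]; exact enorm_integral_le_lintegral_enorm _
      _ = ∫⁻ y, ((fun y => ‖f y‖ₑ) * (fun y => ‖D y‖ₑ)) y ∂ν := by simp [enorm_mul]
      _ ≤ (∫⁻ y, ‖f y‖ₑ ^ (2 : ℝ) ∂ν) ^ (1 / 2 : ℝ) * (∫⁻ y, ‖D y‖ₑ ^ (2 : ℝ) ∂ν) ^ (1 / 2 : ℝ) :=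
          ENNReal.lintegral_mul_le_Lp_mul_Lq ν Real.HolderConjugate.two_two
            hf.aestronglyMeasurable.enorm hDm.enorm
      _ ≤ _ := by
          simp only [ENNReal.rpow_two]
          gcongr
  have hsq : Q * Q ≤ (K * ∫⁻ y, ‖f y‖ₑ ^ 2 ∂ν) * Q := by
    calc Q * Q ≤ ((∫⁻ y, ‖f y‖ₑ ^ 2 ∂ν) ^ (1 / 2 : ℝ) * (K * Q) ^ (1 / 2 : ℝ))
          * ((∫⁻ y, ‖f y‖ₑ ^ 2 ∂ν) ^ (1 / 2 : ℝ) * (K * Q) ^ (1 / 2 : ℝ)) := by gcongr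
      _ = ((∫⁻ y, ‖f y‖ₑ ^ 2 ∂ν) ^ (1 / 2 : ℝ) * (∫⁻ y, ‖f y‖ₑ ^ 2 ∂ν) ^ (1 / 2 : ℝ))
          * ((K * Q) ^ (1 / 2 : ℝ) * (K * Q) ^ (1 / 2 : ℝ)) := by ring
      _ = (∫⁻ y, ‖f y‖ₑ ^ 2 ∂ν) * (K * Q) := by
          rw [← ENNReal.rpow_add_of_nonneg _ _ (by norm_num) (by norm_num),
            ← ENNReal.rpow_add_of_nonneg _ _ (by norm_num) (by norm_num)]
          norm_num
      _ = _ := by ring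
  rcases eq_or_ne Q 0 with h | h
  · rw [h]; exact zero_le
  · exact (ENNReal.mul_le_mul_iff_left h hQtop).1 hsq

/-- Van der Corput second derivative test for amplitudes vanishing at the endpoints. -/
theorem norm_integral_mul_cexp_le_of_deriv_two_ge {α β : ℝ} (hαβ : α ≤ β) {φ N N₁ : ℝ → ℝ}
    {ψ ψ₁ : ℝ → ℂ} {B c μ ε : ℝ} (hε : |ε| = 1) (hc : 0 < c) (hμ : 0 < μ)
    (hφ : ∀ x ∈ Set.Icc α β, HasDerivAt φ (N x) x)
    (hN : ∀ x ∈ Set.Icc α β, HasDerivAt N (N₁ x) x)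
    (hN₁ : ContinuousOn N₁ (Set.Icc α β)) (hNc : ∀ x ∈ Set.Icc α β, c * μ ≤ ε * N₁ x)
    (hψ : ∀ x ∈ Set.Icc α β, HasDerivAt ψ (ψ₁ x) x) (hψ₁ : ContinuousOn ψ₁ (Set.Icc α β))
    (hψB : ∀ x ∈ Set.Icc α β, ‖ψ x‖ ≤ B) (hψ₁B : ∀ x ∈ Set.Icc α β, ‖ψ₁ x‖ ≤ B)
    (hα : ψ α = 0) (hβ : ψ β = 0) :
    ‖∫ x in α..β, ψ x * cexp (I * φ x)‖ ≤ B * ((β - α) / 2 + (1 + 1 / c) * Real.pi) / √μ := by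
  have hB : 0 ≤ B := (norm_nonneg _).trans (hψB α ⟨le_rfl, hαβ⟩)
  have hNcont : ContinuousOn N (Set.Icc α β) := fun x hx => (hN x hx).continuousAt.continuousWithinAt
  have hφcont : ContinuousOn φ (Set.Icc α β) := fun x hx => (hφ x hx).continuousAt.continuousWithinAt
  have hψcont : ContinuousOn ψ (Set.Icc α β) := fun x hx => (hψ x hx).continuousAt.continuousWithinAt
  have hpos : ∀ x, 0 < μ + N x ^ 2 := fun x => by positivity
  set g : ℝ → ℝ := fun x => N x / (μ + N x ^ 2) with hg
  set g₁ : ℝ → ℝ := fun x =>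
    (N₁ x * (μ + N x ^ 2) - N x * (2 * N x * N₁ x)) / (μ + N x ^ 2) ^ 2 with hg₁
  have hgd : ∀ x ∈ Set.Icc α β, HasDerivAt g (g₁ x) x := by
    intro x hx
    have h1 : HasDerivAt (fun x => μ + N x ^ 2) (2 * N x * N₁ x) x := by
      simpa using ((hN x hx).pow 2).const_add μ
    exact (hN x hx).div h1 (hpos x).ne'
  have hgcont : ContinuousOn g (Set.Icc α β) := fun x hx => (hgd x hx).continuousAt.continuousWithinAt
  have hg₁cont : ContinuousOn g₁ (Set.Icc α β) := by
    refine ContinuousOn.div (by fun_prop) (by fun_prop) fun x _ => ?_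
    exact (pow_pos (hpos x) 2).ne'
  set r : ℝ → ℂ := fun x =>
    (ψ₁ x * g x + ψ x * g₁ x - I * ψ x * ((μ / (μ + N x ^ 2) : ℝ) : ℂ)) * cexp (I * φ x) with hr
  have hrcont : ContinuousOn r (Set.Icc α β) := by
    have : ContinuousOn (fun x => μ / (μ + N x ^ 2)) (Set.Icc α β) :=
      ContinuousOn.div (by fun_prop) (by fun_prop) fun x _ => (hpos x).ne'
    fun_prop
  have hmain : ∫ x in α..β, (r x + I * (ψ x * cexp (I * φ x))) = 0 := by
    have hd : ∀ x ∈ Set.uIcc α β, HasDerivAt (fun x => ψ x * g x * cexp (I * φ x))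
        (r x + I * (ψ x * cexp (I * φ x))) x := by
      intro x hx
      rw [Set.uIcc_of_le hαβ] at hx
      have h1 := ((hψ x hx).mul (hgd x hx).ofReal_comp).mul
        (((hφ x hx).ofReal_comp.const_mul I).cexp)
      refine HasDerivAt.congr_deriv h1 ?_
      simp only [hr, hg, hg₁, Pi.mul_apply]
      have h2 : ((μ : ℂ) + (N x : ℂ) ^ 2) ≠ 0 := by exact_mod_cast (hpos x).ne'
      push_cast
      field_simp
      ring
    rw [intervalIntegral.integral_eq_sub_of_hasDerivAt hd, hα, hβ]
    · simp
    · refine ContinuousOn.intervalIntegrable ?_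
      rw [Set.uIcc_of_le hαβ]
      fun_prop
  have hri : IntervalIntegrable r volume α β := by
    refine ContinuousOn.intervalIntegrable ?_
    rwa [Set.uIcc_of_le hαβ]
  have heq : I * ∫ x in α..β, ψ x * cexp (I * φ x) = - ∫ x in α..β, r x := by
    rw [intervalIntegral.integral_add hri, intervalIntegral.integral_const_mul] at hmain
    · linear_combination hmain
    · refine ContinuousOn.intervalIntegrable ?_
      rw [Set.uIcc_of_le hαβ]
      fun_prop
  have hnorm : ‖∫ x in α..β, ψ x * cexp (I * φ x)‖ = ‖∫ x in α..β, r x‖ := by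
    rw [← norm_neg (∫ x in α..β, r x), ← heq, norm_mul, norm_I, one_mul]
  set b : ℝ → ℝ := fun x => B * (1 / (2 * √μ)) + B * (1 + 1 / c) * (ε * N₁ x / (μ + N x ^ 2)) with hb
  have hbcont : ContinuousOn b (Set.Icc α β) := by
    have : ContinuousOn (fun x => ε * N₁ x / (μ + N x ^ 2)) (Set.Icc α β) :=
      ContinuousOn.div (by fun_prop) (by fun_prop) fun x _ => (hpos x).ne'
    fun_prop
  have hsq : √μ ^ 2 = μ := Real.sq_sqrt hμ.le
  have hsp : 0 < √μ := Real.sqrt_pos.2 hμ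
  have hrb : ∀ x ∈ Set.Icc α β, ‖r x‖ ≤ b x := by
    intro x hx
    have hN₁0 : 0 ≤ ε * N₁ x := le_trans (by positivity) (hNc x hx)
    have hN₁abs : |N₁ x| = ε * N₁ x := by
      rw [← abs_of_nonneg hN₁0, abs_mul, hε, one_mul]
    have he : ‖cexp (I * φ x)‖ = 1 := by
      rw [mul_comm]; exact Complex.norm_exp_ofReal_mul_I _
    have hg' : |g x| ≤ 1 / (2 * √μ) := by
      rw [hg, abs_div, abs_of_pos (hpos x), div_le_div_iff₀ (hpos x) (by positivity)]
      nlinarith [sq_nonneg (|N x| - √μ), sq_abs (N x)]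
    have hg₁' : |g₁ x| ≤ ε * N₁ x / (μ + N x ^ 2) := by
      rw [hg₁, abs_div, abs_of_pos (pow_pos (hpos x) 2),
        div_le_div_iff₀ (pow_pos (hpos x) 2) (hpos x)]
      have : |N₁ x * (μ + N x ^ 2) - N x * (2 * N x * N₁ x)| ≤ ε * N₁ x * (μ + N x ^ 2) := by
        rw [show N₁ x * (μ + N x ^ 2) - N x * (2 * N x * N₁ x) = N₁ x * (μ - N x ^ 2) by ring,
          abs_mul, hN₁abs]
        refine mul_le_mul_of_nonneg_left ?_ hN₁0
        rw [abs_le]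
        constructor <;> nlinarith [sq_nonneg (N x)]
      nlinarith [hpos x]
    have hm' : |μ / (μ + N x ^ 2)| ≤ 1 / c * (ε * N₁ x / (μ + N x ^ 2)) := by
      rw [abs_of_pos (div_pos hμ (hpos x)), ← mul_div_assoc]
      refine div_le_div_of_nonneg_right ?_ (hpos x).le
      rw [one_div, inv_mul_eq_div, le_div_iff₀ hc]
      linarith [hNc x hx]
    rw [hr]
    simp only
    rw [norm_mul, he, mul_one]
    calc _ ≤ ‖ψ₁ x * g x‖ + ‖ψ x * g₁ x‖ + ‖I * ψ x * ((μ / (μ + N x ^ 2) : ℝ) : ℂ)‖ :=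
          (norm_sub_le _ _).trans (add_le_add_left (norm_add_le _ _) _)
      _ = ‖ψ₁ x‖ * |g x| + ‖ψ x‖ * |g₁ x| + ‖ψ x‖ * |μ / (μ + N x ^ 2)| := by
          simp only [norm_mul, norm_I, one_mul, Complex.norm_real, Real.norm_eq_abs]
      _ ≤ B * (1 / (2 * √μ)) + B * (ε * N₁ x / (μ + N x ^ 2))
            + B * (1 / c * (ε * N₁ x / (μ + N x ^ 2))) := by
          have := hψB x hx
          have := hψ₁B x hx
          gcongr
      _ = b x := by rw [hb]; ring
  rw [hnorm]
  have hbint : IntervalIntegrable b volume α β := by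
    refine ContinuousOn.intervalIntegrable ?_
    rwa [Set.uIcc_of_le hαβ]
  refine (intervalIntegral.norm_integral_le_of_norm_le hαβ
    (ae_of_all _ fun x hx => hrb x (Set.Ioc_subset_Icc_self hx)) hbint).trans ?_
  have hH : ∀ x ∈ Set.uIcc α β, HasDerivAt
      (fun x => B * (1 / (2 * √μ)) * x + B * (1 + 1 / c) * (ε * (Real.arctan (N x / √μ) / √μ))) (b x) x := by
    intro x hx
    rw [Set.uIcc_of_le hαβ] at hx
    have h1 := ((hasDerivAt_id x).const_mul (B * (1 / (2 * √μ)))).add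
      ((((((hN x hx).div_const √μ).arctan).div_const √μ).const_mul ε).const_mul (B * (1 + 1 / c)))
    refine HasDerivAt.congr_deriv h1 ?_
    rw [hb]
    simp only
    have h2 : 1 + (N x / √μ) ^ 2 = (μ + N x ^ 2) / μ := by
      rw [div_pow, hsq]; field_simp
    rw [h2, one_div_div, show ε * N₁ x / (μ + N x ^ 2) = ε * (μ / (μ + N x ^ 2) * (N₁ x / √μ) / √μ) by
      have := (hpos x).ne'
      field_simp
      rw [hsq]]
    ring
  rw [intervalIntegral.integral_eq_sub_of_hasDerivAt hH hbint]
  have h3 : ε * (Real.arctan (N β / √μ) - Real.arctan (N α / √μ)) ≤ Real.pi := by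
    refine (le_abs_self _).trans ?_
    rw [abs_mul, hε, one_mul, abs_le]
    have h1 := Real.arctan_lt_pi_div_two (N β / √μ)
    have h2 := Real.neg_pi_div_two_lt_arctan (N α / √μ)
    have h3 := Real.arctan_lt_pi_div_two (N α / √μ)
    have h4 := Real.neg_pi_div_two_lt_arctan (N β / √μ)
    constructor <;> linarith
  calc _ = B * ((β - α) / 2 + (1 + 1 / c) *
        (ε * (Real.arctan (N β / √μ) - Real.arctan (N α / √μ)))) / √μ := by field_simp; ring
    _ ≤ _ := by gcongr

/-- Decay of an oscillatory integral without stationary points, after two integrations by parts. -/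
theorem norm_integral_mul_cexp_le_of_deriv_ge {α β : ℝ} (hαβ : α ≤ β) {φ N N₁ N₂ : ℝ → ℝ}
    {ψ ψ₁ ψ₂ : ℝ → ℂ} {B L m : ℝ} (hm : 0 < m) (hL : 0 ≤ L)
    (hφ : ∀ x ∈ Set.Icc α β, HasDerivAt φ (N x) x)
    (hN : ∀ x ∈ Set.Icc α β, HasDerivAt N (N₁ x) x)
    (hN₁ : ∀ x ∈ Set.Icc α β, HasDerivAt N₁ (N₂ x) x)
    (hN₂ : ContinuousOn N₂ (Set.Icc α β)) (hNm : ∀ x ∈ Set.Icc α β, m ≤ |N x|)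
    (hN₁L : ∀ x ∈ Set.Icc α β, |N₁ x| ≤ L * m) (hN₂L : ∀ x ∈ Set.Icc α β, |N₂ x| ≤ L * m)
    (hψ : ∀ x ∈ Set.Icc α β, HasDerivAt ψ (ψ₁ x) x)
    (hψ₁ : ∀ x ∈ Set.Icc α β, HasDerivAt ψ₁ (ψ₂ x) x) (hψ₂ : ContinuousOn ψ₂ (Set.Icc α β))
    (hψB : ∀ x ∈ Set.Icc α β, ‖ψ x‖ ≤ B) (hψ₁B : ∀ x ∈ Set.Icc α β, ‖ψ₁ x‖ ≤ B)
    (hψ₂B : ∀ x ∈ Set.Icc α β, ‖ψ₂ x‖ ≤ B)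
    (hα : ψ α = 0) (hβ : ψ β = 0) (hα₁ : ψ₁ α = 0) (hβ₁ : ψ₁ β = 0) :
    ‖∫ x in α..β, ψ x * cexp (I * φ x)‖ ≤ B * (1 + 4 * L + 3 * L ^ 2) / m ^ 2 * (β - α) := by
  have hB : 0 ≤ B := (norm_nonneg _).trans (hψB α ⟨le_rfl, hαβ⟩)
  have hNcont : ContinuousOn N (Set.Icc α β) := fun x hx => (hN x hx).continuousAt.continuousWithinAt
  have hN₁cont : ContinuousOn N₁ (Set.Icc α β) :=
    fun x hx => (hN₁ x hx).continuousAt.continuousWithinAt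
  have hφcont : ContinuousOn φ (Set.Icc α β) := fun x hx => (hφ x hx).continuousAt.continuousWithinAt
  have hψcont : ContinuousOn ψ (Set.Icc α β) := fun x hx => (hψ x hx).continuousAt.continuousWithinAt
  have hψ₁cont : ContinuousOn ψ₁ (Set.Icc α β) :=
    fun x hx => (hψ₁ x hx).continuousAt.continuousWithinAt
  have hN0 : ∀ x ∈ Set.Icc α β, (N x : ℂ) ≠ 0 := by
    intro x hx h
    have h0 : N x = 0 := by exact_mod_cast h
    have := hNm x hx
    rw [h0, abs_zero] at this
    linarith
  set r : ℝ → ℂ := fun x => (ψ₂ x / N x ^ 2 - 3 * ψ₁ x * N₁ x / N x ^ 3 - ψ x * N₂ x / N x ^ 3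
    + 3 * ψ x * N₁ x ^ 2 / N x ^ 4) * cexp (I * φ x) with hr
  have hcont : ContinuousOn r (Set.Icc α β) := by
    have h2 : ∀ n : ℕ, ∀ x ∈ Set.Icc α β, (N x : ℂ) ^ n ≠ 0 := fun n x hx => pow_ne_zero n (hN0 x hx)
    have hNc : ContinuousOn (fun x => (N x : ℂ)) (Set.Icc α β) := by fun_prop
    refine ContinuousOn.mul (ContinuousOn.add (ContinuousOn.sub (ContinuousOn.sub ?_ ?_) ?_) ?_)
      (by fun_prop)
    · exact hψ₂.div (hNc.pow 2) (h2 2)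
    · exact ContinuousOn.div (by fun_prop) (hNc.pow 3) (h2 3)
    · exact ContinuousOn.div (by fun_prop) (hNc.pow 3) (h2 3)
    · exact ContinuousOn.div (by fun_prop) (hNc.pow 4) (h2 4)
  have hri : IntervalIntegrable r volume α β := by
    refine ContinuousOn.intervalIntegrable ?_
    rwa [Set.uIcc_of_le hαβ]
  have hpi : IntervalIntegrable (fun x => ψ x * cexp (I * φ x)) volume α β := by
    refine ContinuousOn.intervalIntegrable ?_
    rw [Set.uIcc_of_le hαβ]
    fun_prop
  have hmain : ∫ x in α..β, (r x + ψ x * cexp (I * φ x)) = 0 := by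
    have hd : ∀ x ∈ Set.uIcc α β, HasDerivAt (fun x => (ψ₁ x / N x ^ 2 - ψ x * N₁ x / N x ^ 3
        - I * (ψ x / N x)) * cexp (I * φ x)) (r x + ψ x * cexp (I * φ x)) x := by
      intro x hx
      rw [Set.uIcc_of_le hαβ] at hx
      have h0 := hN0 x hx
      have hNd := (hN x hx).ofReal_comp
      have h1 := ((((hψ₁ x hx).div (hNd.pow 2) (pow_ne_zero 2 h0)).sub
        (((hψ x hx).mul (hN₁ x hx).ofReal_comp).div (hNd.pow 3) (pow_ne_zero 3 h0))).sub
        (((hψ x hx).div hNd h0).const_mul I)).mul (((hφ x hx).ofReal_comp.const_mul I).cexp)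
      refine HasDerivAt.congr_deriv h1 ?_
      simp only [hr, Pi.pow_apply, Pi.mul_apply, Pi.sub_apply, Pi.div_apply]
      have hI : I ^ 2 = -1 := I_sq
      push_cast
      field_simp
      ring_nf
      rw [hI]
      ring
    rw [intervalIntegral.integral_eq_sub_of_hasDerivAt hd (hri.add hpi), hα, hβ, hα₁, hβ₁]
    simp
  have hnorm : ‖∫ x in α..β, ψ x * cexp (I * φ x)‖ = ‖∫ x in α..β, r x‖ := by
    rw [intervalIntegral.integral_add hri hpi] at hmain
    rw [eq_neg_of_add_eq_zero_right hmain, norm_neg]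
  rw [hnorm]
  have hrb : ∀ x ∈ Set.uIoc α β, ‖r x‖ ≤ B * (1 + 4 * L + 3 * L ^ 2) / m ^ 2 := by
    intro x hx
    rw [Set.uIoc_of_le hαβ] at hx
    replace hx := Set.Ioc_subset_Icc_self hx
    have he : ‖cexp (I * φ x)‖ = 1 := by
      rw [mul_comm]; exact Complex.norm_exp_ofReal_mul_I _
    have e0 := hNm x hx
    have e1 := hN₁L x hx
    have e2 := hN₂L x hx
    have e3 := hψB x hx
    have e4 := hψ₁B x hx
    have e5 := hψ₂B x hx
    rw [hr]
    simp only
    rw [norm_mul, he, mul_one]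
    calc _ ≤ ‖ψ₂ x / N x ^ 2‖ + ‖3 * ψ₁ x * N₁ x / N x ^ 3‖ + ‖ψ x * N₂ x / N x ^ 3‖
          + ‖3 * ψ x * N₁ x ^ 2 / N x ^ 4‖ := by
          refine (norm_add_le _ _).trans (add_le_add_left ?_ _)
          refine (norm_sub_le _ _).trans (add_le_add_left ?_ _)
          exact norm_sub_le _ _
      _ = ‖ψ₂ x‖ / |N x| ^ 2 + 3 * ‖ψ₁ x‖ * |N₁ x| / |N x| ^ 3 + ‖ψ x‖ * |N₂ x| / |N x| ^ 3
          + 3 * ‖ψ x‖ * |N₁ x| ^ 2 / |N x| ^ 4 := by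
          simp only [norm_mul, norm_div, norm_pow, Complex.norm_real, Real.norm_eq_abs,
            RCLike.norm_ofNat]
      _ ≤ B / m ^ 2 + 3 * B * (L * m) / m ^ 3 + B * (L * m) / m ^ 3
          + 3 * B * (L * m) ^ 2 / m ^ 4 := by gcongr
      _ = _ := by field_simp; ring
  refine (intervalIntegral.norm_integral_le_of_norm_le_const hrb).trans (le_of_eq ?_)
  rw [abs_of_nonneg (by linarith)]

/-- `P` is twice continuously differentiable on `[1/2, 4]`, with derivatives bounded by `B`. -/
def BoundedC2 (P : ℝ → ℂ) (B : ℝ) : Prop :=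
  ∃ P₁ P₂ : ℝ → ℂ, (∀ x ∈ Set.Icc (1 / 2 : ℝ) 4, HasDerivAt P (P₁ x) x) ∧
    (∀ x ∈ Set.Icc (1 / 2 : ℝ) 4, HasDerivAt P₁ (P₂ x) x) ∧
    ContinuousOn P₂ (Set.Icc (1 / 2 : ℝ) 4) ∧
    ∀ x ∈ Set.Icc (1 / 2 : ℝ) 4, ‖P x‖ ≤ B ∧ ‖P₁ x‖ ≤ B ∧ ‖P₂ x‖ ≤ B

theorem BoundedC2.nonneg {P : ℝ → ℂ} {B : ℝ} (h : BoundedC2 P B) : 0 ≤ B := by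
  obtain ⟨P₁, P₂, -, -, -, h⟩ := h
  exact (norm_nonneg _).trans (h 1 (by norm_num)).1

theorem BoundedC2.continuousOn {P : ℝ → ℂ} {B : ℝ} (h : BoundedC2 P B) :
    ContinuousOn P (Set.Icc (1 / 2 : ℝ) 4) := by
  obtain ⟨P₁, P₂, h, -⟩ := h
  exact fun x hx => (h x hx).continuousAt.continuousWithinAt

theorem BoundedC2.norm_le {P : ℝ → ℂ} {B : ℝ} (h : BoundedC2 P B) {x : ℝ}
    (hx : x ∈ Set.Icc (1 / 2 : ℝ) 4) : ‖P x‖ ≤ B := by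
  obtain ⟨P₁, P₂, -, -, -, h⟩ := h
  exact (h x hx).1

theorem BoundedC2.mul {P Q : ℝ → ℂ} {B B' : ℝ} (hP : BoundedC2 P B) (hQ : BoundedC2 Q B') :
    BoundedC2 (fun x => P x * Q x) (4 * (B * B')) := by
  have hB := hP.nonneg
  have hB' := hQ.nonneg
  have hPc := hP.continuousOn
  have hQc := hQ.continuousOn
  obtain ⟨P₁, P₂, hP1, hP2, hP3, hP4⟩ := hP
  obtain ⟨Q₁, Q₂, hQ1, hQ2, hQ3, hQ4⟩ := hQ
  have hP₁c : ContinuousOn P₁ (Set.Icc (1 / 2 : ℝ) 4) :=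
    fun x hx => (hP2 x hx).continuousAt.continuousWithinAt
  have hQ₁c : ContinuousOn Q₁ (Set.Icc (1 / 2 : ℝ) 4) :=
    fun x hx => (hQ2 x hx).continuousAt.continuousWithinAt
  refine ⟨fun x => P₁ x * Q x + P x * Q₁ x,
    fun x => (P₂ x * Q x + P₁ x * Q₁ x) + (P₁ x * Q₁ x + P x * Q₂ x),
    fun x hx => (hP1 x hx).mul (hQ1 x hx),
    fun x hx => ((hP2 x hx).mul (hQ1 x hx)).add ((hP1 x hx).mul (hQ2 x hx)), by fun_prop, ?_⟩
  intro x hx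
  obtain ⟨a0, a1, a2⟩ := hP4 x hx
  obtain ⟨b0, b1, b2⟩ := hQ4 x hx
  have hBB : 0 ≤ B * B' := by positivity
  have hm : ∀ u v : ℂ, ‖u‖ ≤ B → ‖v‖ ≤ B' → ‖u * v‖ ≤ B * B' := fun u v hu hv => by
    rw [norm_mul]; gcongr
  refine ⟨?_, ?_, ?_⟩
  · linarith [hm _ _ a0 b0]
  · linarith [norm_add_le (P₁ x * Q x) (P x * Q₁ x), hm _ _ a1 b0, hm _ _ a0 b1]
  · linarith [norm_add_le (P₂ x * Q x + P₁ x * Q₁ x) (P₁ x * Q₁ x + P x * Q₂ x),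
      norm_add_le (P₂ x * Q x) (P₁ x * Q₁ x), norm_add_le (P₁ x * Q₁ x) (P x * Q₂ x),
      hm _ _ a2 b0, hm _ _ a1 b1, hm _ _ a0 b2]

theorem BoundedC2.conj {P : ℝ → ℂ} {B : ℝ} (hP : BoundedC2 P B) :
    BoundedC2 (fun x => conj (P x)) B := by
  obtain ⟨P₁, P₂, hP1, hP2, hP3, hP4⟩ := hP
  refine ⟨fun x => conj (P₁ x), fun x => conj (P₂ x), fun x hx => (hP1 x hx).star,
    fun x hx => (hP2 x hx).star, Complex.continuous_conj.comp_continuousOn hP3, ?_⟩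
  simpa only [RCLike.norm_conj] using hP4

set_option maxHeartbeats 1000000 in
/-- Decay of the kernel with phase `τ x ^ a + σ x`. -/
theorem exists_kernel_bound {a γ : ℝ} (ha : 1 < a) (ha2 : a < 2) (hγ : 1 / 2 ≤ γ) (hγ1 : γ ≤ 1) :
    ∃ C : ℝ, 0 ≤ C ∧ ∀ (R σ τ B : ℝ) (P : ℝ → ℂ), 1 ≤ R → |σ| ≤ R → BoundedC2 P B →
      P =ᶠ[nhds (1 / 2)] 0 → P =ᶠ[nhds 4] 0 →
      ‖∫ x in (1 / 2 : ℝ)..4, P x * cexp (I * ((τ * x ^ a + σ * x : ℝ) : ℂ))‖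
        ≤ C * B * R ^ γ * (1 + |τ|) ^ (-(γ + 1 / 2)) := by
  set c : ℝ := a * (a - 1) / 4 with hc
  have hcpos : 0 < c := by rw [hc]; nlinarith
  set C₁ : ℝ := (4 - 1 / 2) / 2 + (1 + 1 / c) * Real.pi with hC₁
  have hC₁pos : 0 < C₁ := by
    have := Real.pi_pos
    rw [hC₁]; positivity
  set C₂ : ℝ := (1 + 4 * 32 + 3 * 32 ^ 2) * 16 * (4 - 1 / 2) with hC₂
  refine ⟨14 + 10 * C₁ + 4 * C₂, by positivity, ?_⟩
  intro R σ τ B P hR hσ hP h0 h4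
  have hB := hP.nonneg
  have hPB : ∀ x ∈ Set.Icc (1 / 2 : ℝ) 4, ‖P x‖ ≤ B := fun x hx => hP.norm_le hx
  obtain ⟨P₁, P₂, hP1, hP2, hP3, hP4⟩ := hP
  have e0 : P (1 / 2) = 0 := h0.eq_of_nhds
  have e4 : P 4 = 0 := h4.eq_of_nhds
  have e0' : P₁ (1 / 2) = 0 := (hP1 (1 / 2) (by norm_num)).unique
    ((hasDerivAt_const (1 / 2 : ℝ) (0 : ℂ)).congr_of_eventuallyEq h0)
  have e4' : P₁ 4 = 0 := (hP1 4 (by norm_num)).unique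
    ((hasDerivAt_const (4 : ℝ) (0 : ℂ)).congr_of_eventuallyEq h4)
  have hP₁c : ContinuousOn P₁ (Set.Icc (1 / 2 : ℝ) 4) :=
    fun x hx => (hP2 x hx).continuousAt.continuousWithinAt
  set φ : ℝ → ℝ := fun x => τ * x ^ a + σ * x with hφ
  set N : ℝ → ℝ := fun x => τ * (a * x ^ (a - 1)) + σ with hN
  set N₁ : ℝ → ℝ := fun x => τ * (a * ((a - 1) * x ^ (a - 2))) with hN₁
  set N₂ : ℝ → ℝ := fun x => τ * (a * ((a - 1) * ((a - 2) * x ^ (a - 3)))) with hN₂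
  have hxpos : ∀ x ∈ Set.Icc (1 / 2 : ℝ) 4, x ≠ 0 := by
    rintro x ⟨hx, -⟩ rfl
    norm_num at hx
  have dφ : ∀ x ∈ Set.Icc (1 / 2 : ℝ) 4, HasDerivAt φ (N x) x := by
    intro x hx
    refine HasDerivAt.congr_deriv (((Real.hasDerivAt_rpow_const (p := a)
      (Or.inl (hxpos x hx))).const_mul τ).add ((hasDerivAt_id x).const_mul σ)) ?_
    simp [hN]
  have dN : ∀ x ∈ Set.Icc (1 / 2 : ℝ) 4, HasDerivAt N (N₁ x) x := by
    intro x hx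
    refine HasDerivAt.congr_deriv ((((Real.hasDerivAt_rpow_const (p := a - 1)
      (Or.inl (hxpos x hx))).const_mul a).const_mul τ).add_const σ) ?_
    rw [hN₁, show a - 1 - 1 = a - 2 by ring]
  have dN₁ : ∀ x ∈ Set.Icc (1 / 2 : ℝ) 4, HasDerivAt N₁ (N₂ x) x := by
    intro x hx
    refine HasDerivAt.congr_deriv ((((Real.hasDerivAt_rpow_const (p := a - 2)
      (Or.inl (hxpos x hx))).const_mul (a - 1)).const_mul a).const_mul τ) ?_
    rw [hN₂, show a - 2 - 1 = a - 3 by ring]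
  have cN₂ : ContinuousOn N₂ (Set.Icc (1 / 2 : ℝ) 4) := by
    have : ContinuousOn (fun x : ℝ => x ^ (a - 3)) (Set.Icc (1 / 2 : ℝ) 4) :=
      fun x hx => (Real.continuousAt_rpow_const _ _ (Or.inl (hxpos x hx))).continuousWithinAt
    fun_prop
  have cN₁ : ContinuousOn N₁ (Set.Icc (1 / 2 : ℝ) 4) :=
    fun x hx => (dN₁ x hx).continuousAt.continuousWithinAt
  -- elementary bounds for powers of `x`
  have hpow1 : ∀ x ∈ Set.Icc (1 / 2 : ℝ) 4, 1 / 2 ≤ x ^ (a - 1) := by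
    intro x hx
    calc (1 / 2 : ℝ) = (1 / 2 : ℝ) ^ (1 : ℝ) := by simp
      _ ≤ (1 / 2 : ℝ) ^ (a - 1) :=
          Real.rpow_le_rpow_of_exponent_ge (by norm_num) (by norm_num) (by linarith)
      _ ≤ x ^ (a - 1) := Real.rpow_le_rpow (by norm_num) hx.1 (by linarith)
  have hpow2 : ∀ x ∈ Set.Icc (1 / 2 : ℝ) 4, 1 / 4 ≤ x ^ (a - 2) ∧ x ^ (a - 2) ≤ 2 := by
    intro x hx
    have hx0 : 0 < x := lt_of_lt_of_le (by norm_num) hx.1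
    constructor
    · calc (1 / 4 : ℝ) = (4 : ℝ) ^ (-1 : ℝ) := by rw [Real.rpow_neg_one]; norm_num
        _ ≤ (4 : ℝ) ^ (a - 2) := Real.rpow_le_rpow_of_exponent_le (by norm_num) (by linarith)
        _ ≤ x ^ (a - 2) := Real.rpow_le_rpow_of_nonpos hx0 hx.2 (by linarith)
    · calc x ^ (a - 2) ≤ (1 / 2 : ℝ) ^ (a - 2) :=
            Real.rpow_le_rpow_of_nonpos (by norm_num) hx.1 (by linarith)
        _ ≤ (1 / 2 : ℝ) ^ (-1 : ℝ) :=
            Real.rpow_le_rpow_of_exponent_ge (by norm_num) (by norm_num) (by linarith)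
        _ = 2 := by rw [Real.rpow_neg_one]; norm_num
  have hpow3 : ∀ x ∈ Set.Icc (1 / 2 : ℝ) 4, 0 ≤ x ^ (a - 3) ∧ x ^ (a - 3) ≤ 4 := by
    intro x hx
    have hx0 : 0 < x := lt_of_lt_of_le (by norm_num) hx.1
    refine ⟨by positivity, ?_⟩
    calc x ^ (a - 3) ≤ (1 / 2 : ℝ) ^ (a - 3) :=
          Real.rpow_le_rpow_of_nonpos (by norm_num) hx.1 (by linarith)
      _ ≤ (1 / 2 : ℝ) ^ (-2 : ℝ) :=
          Real.rpow_le_rpow_of_exponent_ge (by norm_num) (by norm_num) (by linarith)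
      _ = 4 := by rw [Real.rpow_neg (by norm_num), Real.rpow_two]; norm_num
  have hRγ : 1 ≤ R ^ γ := Real.one_le_rpow hR (by linarith)
  have h1τ : 0 < 1 + |τ| := by positivity
  set W : ℝ := (1 + |τ|) ^ (γ + 1 / 2) with hW
  have hWpos : 0 < W := by positivity
  rw [Real.rpow_neg h1τ.le, ← hW, ← div_eq_mul_inv, le_div_iff₀ hWpos]
  have hBR : 0 ≤ B * R ^ γ := by positivity
  have hC₂0 : 0 ≤ C₂ := by positivity
  rcases le_or_gt |τ| 1 with h | h
  · have hn : ‖∫ x in (1 / 2 : ℝ)..4, P x * cexp (I * (φ x : ℂ))‖ ≤ B * |4 - 1 / 2| := by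
      refine intervalIntegral.norm_integral_le_of_norm_le_const fun x hx => ?_
      rw [Set.uIoc_of_le (by norm_num)] at hx
      rw [norm_mul, mul_comm I, Complex.norm_exp_ofReal_mul_I, mul_one]
      exact hPB x (Set.Ioc_subset_Icc_self hx)
    have hW4 : W ≤ 4 := by
      calc W ≤ 2 ^ (γ + 1 / 2) := Real.rpow_le_rpow h1τ.le (by linarith) (by linarith)
        _ ≤ 2 ^ (2 : ℝ) := Real.rpow_le_rpow_of_exponent_le (by norm_num) (by linarith)
        _ = 4 := by rw [Real.rpow_two]; norm_num
    rw [show |(4 : ℝ) - 1 / 2| = 7 / 2 by norm_num] at hn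
    calc _ ≤ B * (7 / 2) * 4 := by gcongr
      _ ≤ 14 * (B * R ^ γ) := by nlinarith
      _ ≤ (14 + 10 * C₁ + 4 * C₂) * (B * R ^ γ) := by gcongr; linarith
      _ = _ := by ring
  have hτ0 : τ ≠ 0 := by rintro rfl; norm_num at h
  have h2τ : 1 + |τ| ≤ 2 * |τ| := by linarith
  rcases le_or_gt |τ| (4 * R) with h' | h'
  · have hs : SignType.sign τ * τ = |τ| := sign_mul_self τ
    have hn := norm_integral_mul_cexp_le_of_deriv_two_ge (α := 1 / 2) (β := 4) (by norm_num)
      (φ := φ) (N := N) (N₁ := N₁) (ψ := P) (ψ₁ := P₁) (B := B) (c := c) (μ := |τ|)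
      (ε := (SignType.sign τ : ℝ))
      (by rcases lt_or_gt_of_ne hτ0 with h | h <;> simp [h]) hcpos (by linarith) dφ dN cN₁
      (fun x hx => by
        have := (hpow2 x hx).1
        have e : (SignType.sign τ : ℝ) * N₁ x = (a * (a - 1)) * x ^ (a - 2) * |τ| := by
          rw [← hs, hN₁]; ring
        rw [e]
        have : 0 ≤ a * (a - 1) := by nlinarith
        gcongr
        rw [hc]
        nlinarith)
      hP1 hP₁c hPB (fun x hx => (hP4 x hx).2.1) e0 e4
    rw [← hC₁] at hn
    have hsq : 0 < √|τ| := Real.sqrt_pos.2 (by linarith)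
    have hW' : W ≤ 10 * R ^ γ * √|τ| := by
      calc W = (1 + |τ|) ^ γ * (1 + |τ|) ^ (1 / 2 : ℝ) := by rw [hW, Real.rpow_add h1τ]
        _ ≤ (5 * R) ^ γ * (2 * |τ|) ^ (1 / 2 : ℝ) := by
            gcongr
            linarith
        _ = (5 ^ γ * 2 ^ (1 / 2 : ℝ)) * R ^ γ * √|τ| := by
            rw [Real.mul_rpow (by norm_num) (by linarith), Real.mul_rpow (by norm_num)
              (abs_nonneg _), Real.sqrt_eq_rpow]
            ring
        _ ≤ (5 * 2) * R ^ γ * √|τ| := by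
            gcongr
            · calc (5 : ℝ) ^ γ ≤ 5 ^ (1 : ℝ) :=
                  Real.rpow_le_rpow_of_exponent_le (by norm_num) hγ1
                _ = 5 := by simp
            · calc (2 : ℝ) ^ (1 / 2 : ℝ) ≤ 2 ^ (1 : ℝ) :=
                  Real.rpow_le_rpow_of_exponent_le (by norm_num) (by norm_num)
                _ = 2 := by simp
        _ = _ := by norm_num
    calc _ ≤ (B * C₁ / √|τ|) * (10 * R ^ γ * √|τ|) := by gcongr
      _ = (10 * C₁) * (B * R ^ γ) := by field_simp
      _ ≤ (14 + 10 * C₁ + 4 * C₂) * (B * R ^ γ) := by gcongr; linarith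
      _ = _ := by ring
  · have hn := norm_integral_mul_cexp_le_of_deriv_ge (α := 1 / 2) (β := 4) (by norm_num)
      (φ := φ) (N := N) (N₁ := N₁) (N₂ := N₂) (ψ := P) (ψ₁ := P₁) (ψ₂ := P₂) (B := B) (L := 32)
      (m := |τ| / 4) (by linarith) (by norm_num) dφ dN dN₁ cN₂
      (fun x hx => by
        have h1 := hpow1 x hx
        have h2 : |τ| / 2 ≤ |τ * (a * x ^ (a - 1))| := by
          rw [abs_mul, abs_of_nonneg (show 0 ≤ a * x ^ (a - 1) by nlinarith)]
          have : 1 / 2 ≤ a * x ^ (a - 1) := by nlinarith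
          nlinarith [abs_nonneg τ]
        have h3 := abs_sub_abs_le_abs_sub (τ * (a * x ^ (a - 1))) (-σ)
        rw [sub_neg_eq_add, abs_neg] at h3
        rw [hN]
        simp only
        linarith)
      (fun x hx => by
        have h1 := hpow2 x hx
        have h2 : 0 ≤ a * ((a - 1) * x ^ (a - 2)) := by
          have : 0 ≤ x ^ (a - 2) := by linarith
          have : 0 ≤ a - 1 := by linarith
          positivity
        have h3 : a * ((a - 1) * x ^ (a - 2)) ≤ 2 * (1 * 2) := by
          have : 0 ≤ a - 1 := by linarith
          have : 0 ≤ x ^ (a - 2) := by linarith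
          exact mul_le_mul ha2.le (mul_le_mul (by linarith) h1.2 this (by norm_num))
            (by positivity) (by norm_num)
        rw [hN₁]
        simp only
        rw [abs_mul, abs_of_nonneg h2]
        nlinarith [abs_nonneg τ])
      (fun x hx => by
        have h1 := hpow3 x hx
        have h2 : |a * ((a - 1) * ((a - 2) * x ^ (a - 3)))| ≤ 2 * (1 * (1 * 4)) := by
          rw [abs_mul, abs_mul, abs_mul, abs_of_nonneg h1.1, abs_of_pos (by linarith : 0 < a),
            abs_of_pos (by linarith : 0 < a - 1), abs_of_neg (by linarith : a - 2 < 0)]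
          have : 0 ≤ a - 1 := by linarith
          have : 0 ≤ -(a - 2) := by linarith
          have := h1.1
          exact mul_le_mul ha2.le (mul_le_mul (by linarith) (mul_le_mul (by linarith) h1.2 this
            (by norm_num)) (by positivity) (by norm_num)) (by positivity) (by norm_num)
        rw [hN₂]
        simp only
        rw [abs_mul]
        nlinarith [abs_nonneg τ])
      hP1 hP2 hP3 hPB (fun x hx => (hP4 x hx).2.1) (fun x hx => (hP4 x hx).2.2) e0 e4 e0' e4'
    have hW' : W ≤ 4 * |τ| ^ 2 := by
      calc W ≤ (1 + |τ|) ^ (2 : ℝ) :=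
            Real.rpow_le_rpow_of_exponent_le (by linarith) (by linarith)
        _ ≤ (2 * |τ|) ^ (2 : ℝ) := by gcongr
        _ = _ := by rw [Real.rpow_two]; ring
    have hτp : 0 < |τ| := by linarith
    calc _ ≤ (B * (1 + 4 * 32 + 3 * 32 ^ 2) / (|τ| / 4) ^ 2 * (4 - 1 / 2)) * (4 * |τ| ^ 2) := by
          gcongr
      _ = 4 * C₂ * B := by rw [hC₂]; field_simp; ring
      _ ≤ (4 * C₂) * (B * R ^ γ) := by gcongr; nlinarith
      _ ≤ (14 + 10 * C₁ + 4 * C₂) * (B * R ^ γ) := by gcongr; linarith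
      _ = _ := by ring

theorem exists_cutoff : ∃ (η : ℝ → ℂ) (B : ℝ), BoundedC2 η B ∧ Continuous η ∧
    η =ᶠ[nhds (1 / 2)] 0 ∧ η =ᶠ[nhds 4] 0 ∧ ∀ x ∈ Set.Icc (1 : ℝ) 2, η x = 1 := by
  let f : ContDiffBump (3 / 2 : ℝ) := ⟨1 / 2, 3 / 4, by norm_num, by norm_num⟩
  have hf : ContDiff ℝ 2 (fun x => ((f x : ℝ) : ℂ)) :=
    Complex.ofRealCLM.contDiff.comp (f.contDiff (n := 2))
  have h1 : ContDiff ℝ 1 (deriv (fun x => ((f x : ℝ) : ℂ))) :=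
    (contDiff_succ_iff_deriv (n := 1)).1 (by exact_mod_cast hf) |>.2.2
  have h2 : Continuous (deriv (deriv (fun x => ((f x : ℝ) : ℂ)))) := h1.continuous_deriv le_rfl
  obtain ⟨B₀, hB₀⟩ := (isCompact_Icc (a := (1 / 2 : ℝ)) (b := 4)).exists_bound_of_continuousOn
    hf.continuous.continuousOn
  obtain ⟨B₁, hB₁⟩ := (isCompact_Icc (a := (1 / 2 : ℝ)) (b := 4)).exists_bound_of_continuousOn
    h1.continuous.continuousOn
  obtain ⟨B₂, hB₂⟩ := (isCompact_Icc (a := (1 / 2 : ℝ)) (b := 4)).exists_bound_of_continuousOn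
    h2.continuousOn
  have hz : ∀ y : ℝ, 1 ≤ dist y (3 / 2) → (fun x => ((f x : ℝ) : ℂ)) =ᶠ[nhds y] 0 := by
    intro y hy
    have : ∀ᶠ x in nhds y, 3 / 4 < dist x (3 / 2 : ℝ) :=
      (continuous_id.dist continuous_const).continuousAt.eventually_const_lt
        (by simpa using (by linarith : 3 / 4 < dist y (3 / 2 : ℝ)))
    filter_upwards [this] with x hx
    simp [f.zero_of_le_dist hx.le]
  refine ⟨fun x => ((f x : ℝ) : ℂ), max B₀ (max B₁ B₂), ⟨_, _, fun x _ =>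
    (hf.differentiable (by norm_num) x).hasDerivAt,
    fun x _ => (h1.differentiable (by norm_num) x).hasDerivAt, h2.continuousOn,
    fun x hx => ⟨(hB₀ x hx).trans (le_max_left _ _), (hB₁ x hx).trans ?_, (hB₂ x hx).trans ?_⟩⟩,
    hf.continuous, hz _ ?_, hz _ ?_, fun x hx => ?_⟩
  · simp
  · simp
  · norm_num [Real.dist_eq, abs_of_neg]
  · norm_num [Real.dist_eq, abs_of_pos]
  · change ((f x : ℝ) : ℂ) = 1
    rw [f.one_of_mem_closedBall]
    · simp
    · rw [Metric.mem_closedBall, Real.dist_eq, abs_le]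
      constructor <;> norm_num [f] <;> linarith [hx.1, hx.2]

/-- Maximal estimate along a measurable choice of amplitudes and linear phases. -/
theorem exists_linearized_bound {a γ : ℝ} (ha : 1 < a) (ha2 : a < 2) (hγ : 1 / 2 < γ)
    (hγ1 : γ ≤ 1) :
    ∃ C : ℝ≥0∞, C ≠ ⊤ ∧ ∀ (R B : ℝ) (σ : ℕ → ℝ) (P : ℕ → ℝ → ℂ), 1 ≤ R →
      (∀ i j, |σ i - σ j| ≤ R) → (∀ i, BoundedC2 (P i) B) →
      ∀ h : ℝ → ℂ, IntegrableOn h (Set.Icc 1 2) → ∀ n : ℝ → ℕ, Measurable n → ∀ T : ℝ,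
      ∫⁻ t in Set.Icc (-T) T, ‖∫ x in Set.Icc (1 : ℝ) 2,
          cexp (I * ((-(t * x ^ a) + σ (n t) * x : ℝ) : ℂ)) * (P (n t) x * h x)‖ₑ ^ 2
        ≤ C * ENNReal.ofReal (B ^ 2 * R ^ γ) * ∫⁻ x in Set.Icc (1 : ℝ) 2, ‖h x‖ₑ ^ 2 := by
  obtain ⟨η, Bη, hη, hηc, hη0, hη4, hη1⟩ := exists_cutoff
  obtain ⟨C, hC, hker⟩ := exists_kernel_bound ha ha2 hγ.le hγ1
  set D : ℝ≥0∞ := ∫⁻ t : ℝ, ENNReal.ofReal ((1 + ‖t‖) ^ (-(γ + 1 / 2))) with hD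
  have hDfin : D < ⊤ := finite_integral_one_add_norm (by
    simp only [Module.finrank_self, Nat.cast_one]; linarith)
  refine ⟨ENNReal.ofReal (C * (4 * (4 * Bη * (4 * Bη)))) * D,
    ENNReal.mul_ne_top ENNReal.ofReal_ne_top hDfin.ne, ?_⟩
  intro R B σ P hR hσ hP h hh n hn T
  have hB : 0 ≤ B := (hP 0).nonneg
  have hBη : 0 ≤ Bη := hη.nonneg
  set S : Set ℝ := Set.Icc (1 / 2 : ℝ) 4 with hS
  have hSm : MeasurableSet S := measurableSet_Icc
  have h12 : Set.Icc (1 : ℝ) 2 ⊆ S := Set.Icc_subset_Icc (by norm_num) (by norm_num)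
  set Q : ℕ → ℝ → ℂ := fun i => S.indicator (fun x => η x * P i x) with hQ
  have hPQ : ∀ i, BoundedC2 (fun x => η x * P i x) (4 * (Bη * B)) := fun i => hη.mul (hP i)
  have hQm : ∀ i, Measurable (Q i) := fun i => by
    have := (hPQ i).continuousOn.measurable_piecewise (g := 0) continuousOn_const hSm
    rwa [Set.piecewise_eq_indicator] at this
  have hQb : ∀ i x, ‖Q i x‖ ≤ 4 * (Bη * B) := by
    intro i x
    by_cases hx : x ∈ S
    · rw [hQ]; simp only [Set.indicator_of_mem hx]
      exact (hPQ i).norm_le hx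
    · rw [hQ]; simp only [Set.indicator_of_notMem hx, norm_zero]
      positivity
  set e : ℝ → ℝ → ℂ := fun t x => cexp (I * ((-(t * x ^ a) + σ (n t) * x : ℝ) : ℂ)) * Q (n t) x
    with he
  have hem : Measurable (Function.uncurry e) := by
    have h1 : Measurable (fun p : ℝ × ℝ => σ (n p.1)) :=
      (measurable_from_nat (f := σ)).comp (hn.comp measurable_fst)
    have h2 : Measurable (fun p : ℝ × ℝ => Q (n p.1) p.2) := by
      have h3 : Measurable (fun p : ℕ × ℝ => Q p.1 p.2) :=
        measurable_from_prod_countable_right hQm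
      exact h3.comp ((hn.comp measurable_fst).prodMk measurable_snd)
    have h4 : Measurable (fun p : ℝ × ℝ => cexp (I * ((-(p.1 * p.2 ^ a) + σ (n p.1) * p.2 : ℝ) : ℂ))) := by
      refine Complex.measurable_exp.comp (measurable_const.mul (Complex.measurable_ofReal.comp ?_))
      exact ((measurable_fst.mul (measurable_snd.pow_const a)).neg).add (h1.mul measurable_snd)
    exact h4.mul h2
  have hexp : ∀ y : ℝ, ‖cexp (I * (y : ℂ))‖ = 1 := fun y => by
    rw [mul_comm]; exact Complex.norm_exp_ofReal_mul_I _
  have heb : ∀ t x, ‖e t x‖ ≤ 4 * (Bη * B) := fun t x => by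
    rw [he]; simp only; rw [norm_mul, hexp, one_mul]; exact hQb _ _
  set k : ℝ → ℝ → ℝ≥0∞ := fun t t' => ENNReal.ofReal (C * (4 * (4 * (Bη * B) * (4 * (Bη * B)))) * R ^ γ)
    * ENNReal.ofReal ((1 + ‖t' - t‖) ^ (-(γ + 1 / 2))) with hk
  have hkm : Measurable (Function.uncurry k) := by
    refine measurable_const.mul (Measurable.ennreal_ofReal ?_)
    exact (measurable_const.add (measurable_snd.sub measurable_fst).norm).pow_const _
  have hkint : ∀ t, ∫⁻ t', k t t' ∂(volume.restrict (Set.Icc (-T) T))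
      ≤ ENNReal.ofReal (C * (4 * (4 * (Bη * B) * (4 * (Bη * B)))) * R ^ γ) * D := by
    intro t
    refine (lintegral_mono' Measure.restrict_le_self le_rfl).trans ?_
    rw [lintegral_const_mul']
    · rw [lintegral_sub_right_eq_self (fun t => ENNReal.ofReal ((1 + ‖t‖) ^ (-(γ + 1 / 2)))) t]
    · exact ENNReal.ofReal_ne_top
  have hks : ∀ t t', k t t' = k t' t := fun t t' => by
    rw [hk]; simp only [norm_sub_rev]
  have main := lintegral_enorm_sq_le_of_dual_kernel_bound
    (μ := volume.restrict (Set.Icc (-T) T)) (ν := volume.restrict S) hem heb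
    (f := (Set.Icc (1 : ℝ) 2).indicator h) (k := k)
    ((integrable_indicator_iff measurableSet_Icc).2 (by
      rw [IntegrableOn, Measure.restrict_restrict measurableSet_Icc,
        Set.inter_eq_self_of_subset_left h12]
      exact hh)) hkm hkint
    (fun t' => by simpa only [hks] using hkint t') ?_
  · have e1 : ∀ t, ∫ y, e t y * (Set.Icc (1 : ℝ) 2).indicator h y ∂(volume.restrict S)
        = ∫ x in Set.Icc (1 : ℝ) 2,
          cexp (I * ((-(t * x ^ a) + σ (n t) * x : ℝ) : ℂ)) * (P (n t) x * h x) := by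
      intro t
      have : (fun y => e t y * (Set.Icc (1 : ℝ) 2).indicator h y)
          = (Set.Icc (1 : ℝ) 2).indicator (fun x =>
            cexp (I * ((-(t * x ^ a) + σ (n t) * x : ℝ) : ℂ)) * (P (n t) x * h x)) := by
        ext x
        by_cases hx : x ∈ Set.Icc (1 : ℝ) 2
        · simp only [Set.indicator_of_mem hx, he, hQ, Set.indicator_of_mem (h12 hx), hη1 x hx]
          ring
        · simp only [Set.indicator_of_notMem hx, mul_zero]
      rw [this, integral_indicator measurableSet_Icc,
        Measure.restrict_restrict measurableSet_Icc, Set.inter_eq_self_of_subset_left h12]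
    have e2 : ∫⁻ y, ‖(Set.Icc (1 : ℝ) 2).indicator h y‖ₑ ^ 2 ∂(volume.restrict S)
        = ∫⁻ x in Set.Icc (1 : ℝ) 2, ‖h x‖ₑ ^ 2 := by
      have : (fun y => ‖(Set.Icc (1 : ℝ) 2).indicator h y‖ₑ ^ 2)
          = (Set.Icc (1 : ℝ) 2).indicator (fun x => ‖h x‖ₑ ^ 2) := by
        ext x
        by_cases hx : x ∈ Set.Icc (1 : ℝ) 2
        · simp only [Set.indicator_of_mem hx]
        · simp [Set.indicator_of_notMem hx]
      rw [this, lintegral_indicator measurableSet_Icc,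
        Measure.restrict_restrict measurableSet_Icc, Set.inter_eq_self_of_subset_left h12]
    simp only [e1, e2] at main
    refine main.trans (le_of_eq ?_)
    rw [show C * (4 * (4 * (Bη * B) * (4 * (Bη * B)))) * R ^ γ
      = (C * (4 * (4 * Bη * (4 * Bη)))) * (B ^ 2 * R ^ γ) by ring,
      ENNReal.ofReal_mul (by positivity)]
    ring
  · intro t t'
    have hb := hker R (σ (n t) - σ (n t')) (t' - t) _ _ hR (hσ _ _)
      ((hPQ (n t)).mul (hPQ (n t')).conj)
      (by filter_upwards [hη0] with x hx; simp [hx])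
      (by filter_upwards [hη4] with x hx; simp [hx])
    have e3 : ∫ y, e t y * conj (e t' y) ∂(volume.restrict S)
        = ∫ x in (1 / 2 : ℝ)..4, (η x * P (n t) x) * conj (η x * P (n t') x)
          * cexp (I * (((t' - t) * x ^ a + (σ (n t) - σ (n t')) * x : ℝ) : ℂ)) := by
      rw [intervalIntegral.integral_of_le (by norm_num), ← integral_Icc_eq_integral_Ioc]
      refine setIntegral_congr_fun hSm fun x hx => ?_
      simp only [he, hQ, Set.indicator_of_mem hx, map_mul, ← Complex.exp_conj, Complex.conj_I,
        Complex.conj_ofReal]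
      rw [show ∀ u v w z : ℂ, u * v * (w * z) = v * z * (u * w) by intros; ring,
        ← Complex.exp_add]
      congr 2
      push_cast
      ring
    rw [e3, hk]
    simp only
    rw [← ENNReal.ofReal_mul (by positivity), ← ofReal_norm]
    exact ENNReal.ofReal_le_ofReal hb

/-- Maximal estimate for a sequence of amplitudes and linear phases. -/
theorem exists_maximal_bound {a γ : ℝ} (ha : 1 < a) (ha2 : a < 2) (hγ : 1 / 2 < γ)
    (hγ1 : γ ≤ 1) :
    ∃ C : ℝ≥0∞, C ≠ ⊤ ∧ ∀ (R B : ℝ) (σ : ℕ → ℝ) (P : ℕ → ℝ → ℂ), 1 ≤ R →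
      (∀ i j, |σ i - σ j| ≤ R) → (∀ i, BoundedC2 (P i) B) →
      ∀ h : ℝ → ℂ, IntegrableOn h (Set.Icc 1 2) →
      ∫⁻ t, ⨆ i, ‖∫ x in Set.Icc (1 : ℝ) 2,
          cexp (I * ((-(t * x ^ a) + σ i * x : ℝ) : ℂ)) * (P i x * h x)‖ₑ ^ 2
        ≤ C * ENNReal.ofReal (B ^ 2 * R ^ γ) * ∫⁻ x in Set.Icc (1 : ℝ) 2, ‖h x‖ₑ ^ 2 := by
  obtain ⟨C, hC, hlin⟩ := exists_linearized_bound ha ha2 hγ hγ1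
  refine ⟨2 * C, ENNReal.mul_ne_top (by simp) hC, ?_⟩
  intro R B σ P hR hσ hP h hh
  set g : ℕ → ℝ → ℝ≥0∞ := fun i t => ‖∫ x in Set.Icc (1 : ℝ) 2,
          cexp (I * ((-(t * x ^ a) + σ i * x : ℝ) : ℂ)) * (P i x * h x)‖ₑ ^ 2 with hg
  have hB : 0 ≤ B := (hP 0).nonneg
  have hexp : ∀ y : ℝ, ‖cexp (I * (y : ℂ))‖ = 1 := fun y => by
    rw [mul_comm]; exact Complex.norm_exp_ofReal_mul_I _
  have h12 : Set.Icc (1 : ℝ) 2 ⊆ Set.Icc (1 / 2) 4 :=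
    Set.Icc_subset_Icc (by norm_num) (by norm_num)
  have hPh : ∀ i, IntegrableOn (fun x => P i x * h x) (Set.Icc 1 2) := fun i =>
    Integrable.bdd_mul hh
      (((hP i).continuousOn.mono h12).aestronglyMeasurable measurableSet_Icc) (c := B)
      ((ae_restrict_iff' measurableSet_Icc).2 (ae_of_all _ fun x hx => (hP i).norm_le (h12 hx)))
  have hgm : ∀ i, Measurable (g i) := by
    intro i
    refine Continuous.measurable ?_
    refine ENNReal.continuous_pow 2 |>.comp (continuous_enorm.comp ?_)
    refine continuous_of_dominated (bound := fun x => ‖P i x * h x‖) ?_ ?_ (hPh i).norm ?_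
    · intro t
      refine AEStronglyMeasurable.mul (Measurable.aestronglyMeasurable ?_)
        (hPh i).aestronglyMeasurable
      fun_prop
    · exact fun t => ae_of_all _ fun x => by rw [norm_mul, hexp, one_mul]
    · exact ae_of_all _ fun x => by fun_prop
  have hgfin : ∀ t, ⨆ i, g i t < ⊤ := by
    intro t
    refine lt_of_le_of_lt (iSup_le fun i => ?_)
      (show (∫⁻ x in Set.Icc (1 : ℝ) 2, ENNReal.ofReal B * ‖h x‖ₑ) ^ 2 < ⊤ from ?_)
    · refine pow_le_pow_left₀ zero_le ((enorm_integral_le_lintegral_enorm _).trans ?_) 2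
      refine setLIntegral_mono_ae' measurableSet_Icc (ae_of_all _ fun x hx => ?_)
      rw [enorm_mul, enorm_mul, ← ofReal_norm, hexp, ENNReal.ofReal_one, one_mul]
      gcongr
      rw [← ofReal_norm]
      exact ENNReal.ofReal_le_ofReal ((hP i).norm_le (h12 hx))
    · rw [lintegral_const_mul' _ _ ENNReal.ofReal_ne_top]
      exact ENNReal.pow_lt_top (ENNReal.mul_lt_top ENNReal.ofReal_lt_top hh.2)
  have hex : ∀ t, ∃ i, ⨆ j, g j t ≤ 2 * g i t := by
    intro t
    by_contra! hcon
    have h0 : ⨆ j, g j t ≠ 0 := by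
      intro h0
      have := hcon 0
      rw [h0] at this
      exact not_lt_zero this
    have h1 : (⨆ j, g j t) / 2 < ⨆ j, g j t := ENNReal.half_lt_self h0 (hgfin t).ne
    obtain ⟨i, hi⟩ := lt_iSup_iff.1 h1
    have := hcon i
    rw [ENNReal.div_lt_iff (by simp) (by simp), mul_comm] at hi
    exact lt_asymm hi this
  classical
  have hnm : Measurable fun t => Nat.find (hex t) := measurable_find hex fun i =>
    measurableSet_le (Measurable.iSup hgm) ((hgm i).const_mul 2)
  have hT : ∀ T : ℝ, ∫⁻ t in Set.Icc (-T) T, ⨆ i, g i t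
      ≤ 2 * C * ENNReal.ofReal (B ^ 2 * R ^ γ) * ∫⁻ x in Set.Icc (1 : ℝ) 2, ‖h x‖ₑ ^ 2 := by
    intro T
    calc ∫⁻ t in Set.Icc (-T) T, ⨆ i, g i t
        ≤ ∫⁻ t in Set.Icc (-T) T, 2 * g (Nat.find (hex t)) t :=
          lintegral_mono fun t => Nat.find_spec (hex t)
      _ = 2 * ∫⁻ t in Set.Icc (-T) T, g (Nat.find (hex t)) t :=
          lintegral_const_mul' _ _ (by simp)
      _ ≤ 2 * (C * ENNReal.ofReal (B ^ 2 * R ^ γ) * ∫⁻ x in Set.Icc (1 : ℝ) 2, ‖h x‖ₑ ^ 2) := by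
          gcongr
          exact hlin R B σ P hR hσ hP h hh _ hnm T
      _ = _ := by ring
  have hcov : AECover volume Filter.atTop (fun T : ℝ => Set.Icc (-T) T) :=
    aecover_Icc Filter.tendsto_neg_atTop_atBot Filter.tendsto_id
  exact le_of_tendsto' (hcov.lintegral_tendsto_of_countably_generated
    (Measurable.iSup hgm).aemeasurable) hT

open scoped Pointwise in
theorem measurePreserving_toSphere {d : ℕ} (U : Ed d ≃ₗᵢ[ℝ] Ed d) :
    MeasurePreserving (fun ω : Metric.sphere (0 : Ed d) 1 =>
      (⟨U ω, by simp⟩ : Metric.sphere (0 : Ed d) 1))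
      (volume : Measure (Ed d)).toSphere (volume : Measure (Ed d)).toSphere := by
  have hc : Continuous (fun ω : Metric.sphere (0 : Ed d) 1 =>
      (⟨U ω, by simp⟩ : Metric.sphere (0 : Ed d) 1)) :=
    (U.continuous.comp continuous_subtype_val).subtype_mk _
  refine ⟨hc.measurable, Measure.ext fun s hs => ?_⟩
  rw [Measure.map_apply hc.measurable hs, Measure.toSphere_apply' _ (hc.measurable hs),
    Measure.toSphere_apply' _ hs]
  congr 1
  have : Set.Ioo (0 : ℝ) 1 • (Subtype.val '' ((fun ω : Metric.sphere (0 : Ed d) 1 =>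
      (⟨U ω, by simp⟩ : Metric.sphere (0 : Ed d) 1)) ⁻¹' s))
      = U ⁻¹' (Set.Ioo (0 : ℝ) 1 • (Subtype.val '' s)) := by
    ext x
    simp only [Set.mem_preimage, Set.mem_smul, Set.mem_image]
    constructor
    · rintro ⟨r, hr, y, ⟨ω, hω, rfl⟩, rfl⟩
      exact ⟨r, hr, U ω, ⟨_, hω, rfl⟩, by simp⟩
    · rintro ⟨r, hr, y, ⟨ω, hω, rfl⟩, h⟩
      refine ⟨r, hr, U.symm ω, ⟨⟨U.symm ω, by simp⟩, by simpa using hω, rfl⟩, ?_⟩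
      rw [← map_smul, h, LinearIsometryEquiv.symm_apply_apply]
  rw [this, U.measurePreserving.measure_preimage_emb U.toHomeomorph.measurableEmbedding]

theorem integral_toSphere_comp {d : ℕ} (U : Ed d ≃ₗᵢ[ℝ] Ed d) {F : Type*} [NormedAddCommGroup F]
    [NormedSpace ℝ F] {f : Ed d → F} (hf : Continuous f) :
    ∫ ω : Metric.sphere (0 : Ed d) 1, f (U ω) ∂(volume : Measure (Ed d)).toSphere
      = ∫ ω : Metric.sphere (0 : Ed d) 1, f ω ∂(volume : Measure (Ed d)).toSphere := by
  have h := measurePreserving_toSphere U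
  have hf' : Continuous (fun ω : Metric.sphere (0 : Ed d) 1 => f ω) :=
    hf.comp continuous_subtype_val
  conv_rhs => rw [← h.map_eq]
  rw [integral_map h.measurable.aemeasurable]
  exact hf'.aestronglyMeasurable_of_compactSpace

/-- Integral of `cos ⟪x, ·⟫` over the unit sphere. -/
def sphCos {d : ℕ} (x : Ed d) : ℝ :=
  ∫ ω : Metric.sphere (0 : Ed d) 1, Real.cos ⟪x, (ω : Ed d)⟫ ∂(volume : Measure (Ed d)).toSphere

theorem continuous_integrable_toSphere {d : ℕ} {F : Type*} [NormedAddCommGroup F]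
    {f : Metric.sphere (0 : Ed d) 1 → F} (hf : Continuous f) :
    Integrable f (volume : Measure (Ed d)).toSphere :=
  hf.integrable_of_hasCompactSupport (HasCompactSupport.of_compactSpace f)

theorem sphCos_eq_of_norm_eq {d : ℕ} {x y : Ed d} (h : ‖x‖ = ‖y‖) : sphCos x = sphCos y := by
  set U : Ed d ≃ₗᵢ[ℝ] Ed d := Submodule.reflection (ℝ ∙ (x - y))ᗮ with hU
  have hUx : U x = y := Submodule.reflection_sub h
  rw [sphCos, sphCos, ← hUx, ← integral_toSphere_comp U (f := fun ω => Real.cos ⟪U x, ω⟫)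
    (by fun_prop)]
  simp only [LinearIsometryEquiv.inner_map_map]

theorem integral_cexp_inner_toSphere {d : ℕ} (x : Ed d) :
    ∫ ω : Metric.sphere (0 : Ed d) 1, cexp (I * ((⟪x, (ω : Ed d)⟫ : ℝ) : ℂ))
      ∂(volume : Measure (Ed d)).toSphere = (sphCos x : ℂ) := by
  have hs : ∫ ω : Metric.sphere (0 : Ed d) 1, Real.sin ⟪x, (ω : Ed d)⟫
      ∂(volume : Measure (Ed d)).toSphere = 0 := by
    have := integral_toSphere_comp (LinearIsometryEquiv.neg ℝ (E := Ed d))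
      (f := fun ω => Real.sin ⟪x, ω⟫) (by fun_prop)
    simp only [LinearIsometryEquiv.coe_neg, inner_neg_right, Real.sin_neg, integral_neg] at this
    linarith
  have h1 : ∀ y : ℝ, cexp (I * (y : ℂ)) = ((Real.cos y : ℝ) : ℂ) + ((Real.sin y : ℝ) : ℂ) * I := by
    intro y
    rw [mul_comm, Complex.exp_mul_I, Complex.ofReal_cos, Complex.ofReal_sin]
  simp only [h1]
  rw [integral_add, integral_mul_const, integral_complex_ofReal, integral_complex_ofReal, hs, sphCos]
  · simp
  · exact continuous_integrable_toSphere (by fun_prop)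
  · exact continuous_integrable_toSphere (by fun_prop)

/-- Differentiation under the integral sign over the sphere. -/
theorem hasDerivAt_integral_toSphere {d : ℕ} {f f' : ℝ → Ed d → ℝ}
    (hf : Continuous (Function.uncurry f)) (hf' : Continuous (Function.uncurry f'))
    (h : ∀ x ω, HasDerivAt (fun x => f x ω) (f' x ω) x) (x₀ : ℝ) :
    HasDerivAt (fun x => ∫ ω : Metric.sphere (0 : Ed d) 1, f x ω
      ∂(volume : Measure (Ed d)).toSphere)
      (∫ ω : Metric.sphere (0 : Ed d) 1, f' x₀ ω ∂(volume : Measure (Ed d)).toSphere) x₀ := by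
  have hK : IsCompact (Set.Icc (x₀ - 1) (x₀ + 1) ×ˢ Metric.sphere (0 : Ed d) 1) :=
    isCompact_Icc.prod (isCompact_sphere _ _)
  obtain ⟨B, hB⟩ := hK.exists_bound_of_continuousOn hf'.continuousOn
  have hm : ∀ {g : ℝ → Ed d → ℝ}, Continuous (Function.uncurry g) → ∀ x,
      Continuous (fun ω : Metric.sphere (0 : Ed d) 1 => g x ω) := fun hg x =>
    hg.comp (continuous_const.prodMk continuous_subtype_val)
  refine (hasDerivAt_integral_of_dominated_loc_of_deriv_le
    (s := Set.Icc (x₀ - 1) (x₀ + 1)) (bound := fun _ => B)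
    (F := fun x (ω : Metric.sphere (0 : Ed d) 1) => f x ω)
    (F' := fun x (ω : Metric.sphere (0 : Ed d) 1) => f' x ω)
    (Icc_mem_nhds (by linarith) (by linarith))
    (Filter.Eventually.of_forall fun x => (hm hf x).aestronglyMeasurable_of_compactSpace)
    (continuous_integrable_toSphere (hm hf x₀)) (hm hf' x₀).aestronglyMeasurable_of_compactSpace
    (ae_of_all _ fun ω x hx => hB (x, ω) ⟨hx, ω.2⟩) (integrable_const _)
    (ae_of_all _ fun ω x _ => h x ω)).2

/-- Profile of `sphCos`, along the `i`-th coordinate axis. -/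
def sphJ {d : ℕ} (i : Fin d) (z : ℝ) : ℝ :=
  ∫ ω : Metric.sphere (0 : Ed d) 1, Real.cos (z * (ω : Ed d) i) ∂(volume : Measure (Ed d)).toSphere

/-- First derivative of `sphJ`. -/
def sphJ₁ {d : ℕ} (i : Fin d) (z : ℝ) : ℝ :=
  ∫ ω : Metric.sphere (0 : Ed d) 1, -((ω : Ed d) i * Real.sin (z * (ω : Ed d) i))
    ∂(volume : Measure (Ed d)).toSphere

/-- Second derivative of `sphJ`. -/
def sphJ₂ {d : ℕ} (i : Fin d) (z : ℝ) : ℝ :=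
  ∫ ω : Metric.sphere (0 : Ed d) 1, -((ω : Ed d) i ^ 2 * Real.cos (z * (ω : Ed d) i))
    ∂(volume : Measure (Ed d)).toSphere

theorem hasDerivAt_sphJ {d : ℕ} (i : Fin d) (z : ℝ) : HasDerivAt (sphJ i) (sphJ₁ i z) z := by
  refine hasDerivAt_integral_toSphere (f := fun z ω => Real.cos (z * ω i))
    (f' := fun z ω => -(ω i * Real.sin (z * ω i))) (by fun_prop) (by fun_prop) (fun x ω => ?_) z
  refine HasDerivAt.congr_deriv ((hasDerivAt_id x).mul_const (ω i)).cos ?_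
  simp; ring

theorem hasDerivAt_sphJ₁ {d : ℕ} (i : Fin d) (z : ℝ) : HasDerivAt (sphJ₁ i) (sphJ₂ i z) z := by
  refine hasDerivAt_integral_toSphere (f := fun z ω => -(ω i * Real.sin (z * ω i)))
    (f' := fun z ω => -(ω i ^ 2 * Real.cos (z * ω i))) (by fun_prop) (by fun_prop)
    (fun x ω => ?_) z
  refine HasDerivAt.congr_deriv ((((hasDerivAt_id x).mul_const (ω i)).sin.const_mul (ω i)).neg) ?_
  simp; ring

theorem continuous_sphJ₂ {d : ℕ} (i : Fin d) : Continuous (sphJ₂ i) := by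
  have h : ∀ z, HasDerivAt (sphJ₂ i) (∫ ω : Metric.sphere (0 : Ed d) 1,
      ((ω : Ed d) i ^ 3 * Real.sin (z * (ω : Ed d) i)) ∂(volume : Measure (Ed d)).toSphere) z := by
    intro z
    refine hasDerivAt_integral_toSphere (f := fun z ω => -(ω i ^ 2 * Real.cos (z * ω i)))
      (f' := fun z ω => (ω i ^ 3 * Real.sin (z * ω i))) (by fun_prop) (by fun_prop)
      (fun x ω => ?_) z
    refine HasDerivAt.congr_deriv
      ((((hasDerivAt_id x).mul_const (ω i)).cos.const_mul (ω i ^ 2)).neg) ?_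
    simp; ring
  exact continuous_iff_continuousAt.2 fun z => (h z).continuousAt

theorem sphCos_eq_sphJ {d : ℕ} (i : Fin d) (x : Ed d) : sphCos x = sphJ i ‖x‖ := by
  rw [sphCos_eq_of_norm_eq (y := EuclideanSpace.single i ‖x‖) (by simp), sphCos, sphJ]
  simp [EuclideanSpace.inner_single_left, mul_comm]

theorem abs_apply_le_one {d : ℕ} (i : Fin d) (ω : Metric.sphere (0 : Ed d) 1) :
    |(ω : Ed d) i| ≤ 1 := by
  have := PiLp.norm_apply_le (p := 2) (ω : Ed d) i
  simpa using this

theorem abs_sphJ_le {d : ℕ} (i : Fin d) (z : ℝ) :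
    |sphJ i z| ≤ (volume : Measure (Ed d)).toSphere.real Set.univ ∧
    |sphJ₁ i z| ≤ (volume : Measure (Ed d)).toSphere.real Set.univ ∧
    |sphJ₂ i z| ≤ (volume : Measure (Ed d)).toSphere.real Set.univ := by
  have key : ∀ f : Metric.sphere (0 : Ed d) 1 → ℝ, (∀ ω, |f ω| ≤ 1) →
      |∫ ω, f ω ∂(volume : Measure (Ed d)).toSphere|
        ≤ (volume : Measure (Ed d)).toSphere.real Set.univ := by
    intro f hf
    have := norm_integral_le_of_norm_le_const (μ := (volume : Measure (Ed d)).toSphere)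
      (f := f) (C := 1) (ae_of_all _ hf)
    rwa [one_mul, Real.norm_eq_abs] at this
  refine ⟨key _ fun ω => Real.abs_cos_le_one _, key _ fun ω => ?_, key _ fun ω => ?_⟩
  · rw [abs_neg, abs_mul]
    exact mul_le_one₀ (abs_apply_le_one i ω) (abs_nonneg _) (Real.abs_sin_le_one _)
  · rw [abs_neg, abs_mul, abs_pow]
    exact mul_le_one₀ (pow_le_one₀ (abs_nonneg _) (abs_apply_le_one i ω)) (abs_nonneg _)
      (Real.abs_cos_le_one _)

theorem sq_mul_integral_sq_mul_cos {d : ℕ} {i j : Fin d} (hij : i ≠ j) (z : ℝ) :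
    z ^ 2 * ∫ ω : Metric.sphere (0 : Ed d) 1, (ω : Ed d) j ^ 2 * Real.cos (z * (ω : Ed d) i)
      ∂(volume : Measure (Ed d)).toSphere = -(z * sphJ₁ i z) := by
  set p : ℝ → Ed d → ℝ := fun θ ω => z * (Real.cos θ * ω i + Real.sin θ * ω j) with hp
  set p₁ : ℝ → Ed d → ℝ := fun θ ω => z * (-Real.sin θ * ω i + Real.cos θ * ω j) with hp₁
  have hpd : ∀ θ ω, HasDerivAt (fun θ => p θ ω) (p₁ θ ω) θ := fun θ ω =>
    (((Real.hasDerivAt_cos θ).mul_const (ω i)).add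
      ((Real.hasDerivAt_sin θ).mul_const (ω j))).const_mul z
  have hp₁d : ∀ θ ω, HasDerivAt (fun θ => p₁ θ ω) (-p θ ω) θ := fun θ ω => by
    refine HasDerivAt.congr_deriv ((((Real.hasDerivAt_sin θ).neg.mul_const (ω i)).add
      ((Real.hasDerivAt_cos θ).mul_const (ω j))).const_mul z) ?_
    simp only [hp]; ring
  have hpc : Continuous (Function.uncurry p) := by rw [hp]; fun_prop
  have hp₁c : Continuous (Function.uncurry p₁) := by rw [hp₁]; fun_prop
  have hconst : ∀ θ, ∫ ω : Metric.sphere (0 : Ed d) 1, Real.cos (p θ ω)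
      ∂(volume : Measure (Ed d)).toSphere = sphJ i z := by
    intro θ
    have hn : ‖EuclideanSpace.single i (z * Real.cos θ) + EuclideanSpace.single j (z * Real.sin θ)‖
        = ‖(EuclideanSpace.single i z : Ed d)‖ := by
      rw [← sq_eq_sq₀ (norm_nonneg _) (norm_nonneg _), norm_add_sq_real]
      simp only [PiLp.norm_single, Real.norm_eq_abs, sq_abs,
        EuclideanSpace.inner_single_left, conj_trivial, PiLp.single_apply, hij, if_false]
      nlinarith [Real.sin_sq_add_cos_sq θ]
    have := sphCos_eq_of_norm_eq hn
    rw [sphCos, sphCos] at this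
    simp only [inner_add_left, EuclideanSpace.inner_single_left, conj_trivial] at this
    rw [sphJ, ← this]
    congr 1
    ext ω
    rw [hp]
    congr 1
    ring
  have hd1 : ∀ θ, ∫ ω : Metric.sphere (0 : Ed d) 1, -(Real.sin (p θ ω) * p₁ θ ω)
      ∂(volume : Measure (Ed d)).toSphere = 0 := by
    intro θ
    have h1 := hasDerivAt_integral_toSphere (f := fun θ ω => Real.cos (p θ ω))
      (f' := fun θ ω => -(Real.sin (p θ ω) * p₁ θ ω)) (Real.continuous_cos.comp hpc)
      ((Real.continuous_sin.comp hpc).mul hp₁c).neg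
      (fun θ ω => HasDerivAt.congr_deriv (hpd θ ω).cos (by ring)) θ
    simp only [hconst] at h1
    exact h1.unique (hasDerivAt_const θ _)
  have h2 := hasDerivAt_integral_toSphere (f := fun θ ω => -(Real.sin (p θ ω) * p₁ θ ω))
    (f' := fun θ ω => -(Real.cos (p θ ω) * p₁ θ ω * p₁ θ ω + Real.sin (p θ ω) * (-p θ ω)))
    ((Real.continuous_sin.comp hpc).mul hp₁c).neg
    ((((Real.continuous_cos.comp hpc).mul hp₁c).mul hp₁c).add
      ((Real.continuous_sin.comp hpc).mul hpc.neg)).neg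
    (fun θ ω => ((hpd θ ω).sin.mul (hp₁d θ ω)).neg) 0
  simp only [hd1] at h2
  have h3 := h2.unique (hasDerivAt_const 0 _)
  simp only [hp, hp₁, Real.cos_zero, Real.sin_zero, one_mul, zero_mul, add_zero, neg_zero,
    zero_add] at h3
  have h4 : ∫ ω : Metric.sphere (0 : Ed d) 1,
      (z ^ 2 * ((ω : Ed d) j ^ 2 * Real.cos (z * (ω : Ed d) i))
        + z * -((ω : Ed d) i * Real.sin (z * (ω : Ed d) i)))
      ∂(volume : Measure (Ed d)).toSphere = 0 := by
    rw [← neg_eq_zero, ← integral_neg, ← h3]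
    congr 1
    ext ω
    ring
  rw [integral_add, integral_const_mul, integral_const_mul] at h4
  · rw [sphJ₁]; linarith
  · exact continuous_integrable_toSphere (by fun_prop)
  · exact continuous_integrable_toSphere (by fun_prop)

/-- Bessel-type equation for `sphJ`. -/
theorem sphJ_ode {d : ℕ} (i : Fin d) {z : ℝ} (hz : z ≠ 0) :
    sphJ₂ i z = -sphJ i z - (d - 1) * sphJ₁ i z / z := by
  have h1 : z ^ 2 * (sphJ i z + sphJ₂ i z) = -((d - 1) * (z * sphJ₁ i z)) := by
    have e : sphJ i z + sphJ₂ i z = ∑ j ∈ Finset.univ.erase i,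
        ∫ ω : Metric.sphere (0 : Ed d) 1, (ω : Ed d) j ^ 2 * Real.cos (z * (ω : Ed d) i)
      ∂(volume : Measure (Ed d)).toSphere := by
      rw [← integral_finsetSum _ fun j _ => continuous_integrable_toSphere (by fun_prop), sphJ,
        sphJ₂, ← integral_add]
      · congr 1
        ext ω
        have hω : ∑ j, (ω : Ed d) j ^ 2 = 1 := by
          rw [← EuclideanSpace.real_norm_sq_eq]; simp
        rw [← Finset.sum_mul]
        rw [← Finset.add_sum_erase _ _ (Finset.mem_univ i)] at hω
        rw [show ∑ j ∈ Finset.univ.erase i, (ω : Ed d) j ^ 2 = 1 - (ω : Ed d) i ^ 2 by linarith]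
        ring
      · exact continuous_integrable_toSphere (by fun_prop)
      · exact continuous_integrable_toSphere (by fun_prop)
    rw [e, Finset.mul_sum, Finset.sum_congr rfl fun j hj =>
      sq_mul_integral_sq_mul_cos (Finset.ne_of_mem_erase hj).symm z, Finset.sum_const,
      Finset.card_erase_of_mem (Finset.mem_univ i), Finset.card_univ, Fintype.card_fin,
      nsmul_eq_mul, Nat.cast_sub (Nat.succ_le_of_lt i.pos)]
    push_cast
    ring
  field_simp
  have h2 : z * (z * (sphJ i z + sphJ₂ i z) + (d - 1) * sphJ₁ i z) = 0 := by linarith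
  have h3 := (mul_eq_zero.1 h2).resolve_left hz
  linarith

/-- Energy bound for the second derivative equation `D²w = -(1 - c / z²) w` on `[1/2, ∞)`. -/
theorem exists_bound_of_ode {w w₁ : ℝ → ℝ} {c : ℝ}
    (hw : ∀ z, 0 < z → HasDerivAt w (w₁ z) z)
    (hw₁ : ∀ z, 0 < z → HasDerivAt w₁ (-w z + c * w z / z ^ 2) z) :
    ∃ M, 0 ≤ M ∧ ∀ z, 1 / 2 ≤ z → |w z| ≤ M ∧ |w₁ z| ≤ M := by
  set E : ℝ → ℝ := fun z => w z ^ 2 + w₁ z ^ 2 with hE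
  set G : ℝ → ℝ := fun z => E z * Real.exp (|c| / z) with hG
  have hEd : ∀ z, 0 < z → HasDerivAt E (2 * c * (w z * w₁ z) / z ^ 2) z := by
    intro z hz
    refine HasDerivAt.congr_deriv (((hw z hz).pow 2).add ((hw₁ z hz).pow 2)) ?_
    field_simp
    ring
  have hexpd : ∀ z, 0 < z → HasDerivAt (fun z => Real.exp (|c| / z))
      (Real.exp (|c| / z) * (-|c| / z ^ 2)) z := by
    intro z hz
    refine HasDerivAt.congr_deriv (((hasDerivAt_const z |c|).div (hasDerivAt_id z) hz.ne').exp) ?_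
    simp
  have hGd : ∀ z, 0 < z → HasDerivAt G ((2 * c * (w z * w₁ z) / z ^ 2) * Real.exp (|c| / z)
      + E z * (Real.exp (|c| / z) * (-|c| / z ^ 2))) z := fun z hz => (hEd z hz).mul (hexpd z hz)
  have hanti : AntitoneOn G (Set.Ici (1 / 2)) := by
    refine antitoneOn_of_hasDerivWithinAt_nonpos (convex_Ici _) (fun z hz =>
      (hGd z (lt_of_lt_of_le (by norm_num) hz)).continuousAt.continuousWithinAt)
      (fun z hz => (hGd z ?_).hasDerivWithinAt) fun z hz => ?_
    · rw [interior_Ici] at hz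
      exact lt_trans (by norm_num) hz
    · rw [interior_Ici] at hz
      have hz0 : 0 < z := lt_trans (by norm_num) hz
      have h1 : 2 * c * (w z * w₁ z) ≤ |c| * E z := by
        have h2 : 2 * c * (w z * w₁ z) ≤ |c| * (2 * |w z| * |w₁ z|) := by
          refine (le_abs_self _).trans (le_of_eq ?_)
          rw [abs_mul, abs_mul, abs_mul, abs_two]
          ring
        refine h2.trans (mul_le_mul_of_nonneg_left ?_ (abs_nonneg c))
        rw [hE]
        nlinarith [sq_nonneg (|w z| - |w₁ z|), sq_abs (w z), sq_abs (w₁ z)]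
      have h3 : (2 * c * (w z * w₁ z) / z ^ 2) * Real.exp (|c| / z)
          + E z * (Real.exp (|c| / z) * (-|c| / z ^ 2))
          = (2 * c * (w z * w₁ z) - |c| * E z) * (Real.exp (|c| / z) / z ^ 2) := by
        field_simp
        ring
      rw [h3]
      exact mul_nonpos_of_nonpos_of_nonneg (by linarith) (by positivity)
  refine ⟨√(G (1 / 2)), Real.sqrt_nonneg _, fun z hz => ?_⟩
  have hz0 : 0 < z := lt_of_lt_of_le (by norm_num) hz
  have h1 : E z ≤ G (1 / 2) := by
    refine le_trans ?_ (hanti (Set.mem_Ici.2 le_rfl) hz hz)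
    have : 1 ≤ Real.exp (|c| / z) := Real.one_le_exp (by positivity)
    have hE0 : 0 ≤ E z := by positivity
    rw [hG]
    nlinarith
  constructor
  · refine Real.abs_le_sqrt (le_trans ?_ h1)
    rw [hE]; nlinarith [sq_nonneg (w₁ z)]
  · refine Real.abs_le_sqrt (le_trans ?_ h1)
    rw [hE]; nlinarith [sq_nonneg (w z)]

/-- WKB decomposition of solutions of `D²w = -(1 - c / z²) w`. -/
theorem exists_wkb_of_ode {w w₁ : ℝ → ℝ} {c : ℝ}
    (hw : ∀ z, 0 < z → HasDerivAt w (w₁ z) z)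
    (hw₁ : ∀ z, 0 < z → HasDerivAt w₁ (-w z + c * w z / z ^ 2) z) :
    ∃ (M : ℝ) (A : ℝ → ℂ), 0 ≤ M ∧ (∀ z, 1 / 2 ≤ z → |w z| ≤ M) ∧
      (∀ z : ℝ, (w z : ℂ) = cexp (I * (z : ℂ)) * A z + cexp (-(I * (z : ℂ))) * conj (A z)) ∧
      ∀ ρ, 1 ≤ ρ → BoundedC2 (fun x => A (ρ * x)) M := by
  obtain ⟨M, hM, hb⟩ := exists_bound_of_ode hw hw₁
  set A : ℝ → ℂ := fun z => cexp (-(I * (z : ℂ))) * (((w z : ℂ) - I * (w₁ z : ℂ)) / 2) with hA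
  set A₁ : ℝ → ℂ := fun z => cexp (-(I * (z : ℂ))) * (-(I * c / 2) * (w z : ℂ) / (z : ℂ) ^ 2)
    with hA₁
  set A₂ : ℝ → ℂ := fun z => cexp (-(I * (z : ℂ))) * (-(I * c / 2) * ((w₁ z : ℂ) / (z : ℂ) ^ 2
    - 2 * (w z : ℂ) / (z : ℂ) ^ 3 - I * (w z : ℂ) / (z : ℂ) ^ 2)) with hA₂
  have hexp : ∀ z : ℝ, HasDerivAt (fun z : ℝ => cexp (-(I * (z : ℂ))))
      (cexp (-(I * (z : ℂ))) * (-I)) z := by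
    intro z
    refine HasDerivAt.congr_deriv (((Complex.ofRealCLM.hasDerivAt (x := z)).const_mul I).neg.cexp) ?_
    simp
  have hnexp : ∀ z : ℝ, ‖cexp (-(I * (z : ℂ)))‖ = 1 := by
    intro z
    rw [show -(I * (z : ℂ)) = ((-z : ℝ) : ℂ) * I by push_cast; ring]
    exact Complex.norm_exp_ofReal_mul_I _
  have hcz : ∀ z : ℝ, 0 < z → (z : ℂ) ≠ 0 := fun z hz => by exact_mod_cast hz.ne'
  have hdA : ∀ z, 0 < z → HasDerivAt A (A₁ z) z := by
    intro z hz
    have := hcz z hz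
    refine HasDerivAt.congr_deriv ((hexp z).mul
      (((hw z hz).ofReal_comp.sub ((hw₁ z hz).ofReal_comp.const_mul I)).div_const 2)) ?_
    simp only [hA₁]
    push_cast
    field_simp
    linear_combination ((w₁ z : ℂ) * (z : ℂ) ^ 2) * Complex.I_sq
  have hdA₁ : ∀ z, 0 < z → HasDerivAt A₁ (A₂ z) z := by
    intro z hz
    have := hcz z hz
    refine HasDerivAt.congr_deriv ((hexp z).mul (((hw z hz).ofReal_comp.const_mul
      (-(I * c / 2))).div ((Complex.ofRealCLM.hasDerivAt (x := z)).pow 2) (pow_ne_zero 2 this))) ?_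
    simp only [hA₂, Complex.ofRealCLM_apply]
    push_cast
    field_simp
    ring
  have hn2 : ∀ z : ℝ, 1 / 2 ≤ z → ‖A z‖ ≤ M ∧ ‖A₁ z‖ ≤ |c| * M / z ^ 2 ∧
      ‖A₂ z‖ ≤ 3 * |c| * M / z ^ 2 := by
    intro z hz
    have hz0 : 0 < z := lt_of_lt_of_le (by norm_num) hz
    obtain ⟨b0, b1⟩ := hb z hz
    have hnI : ‖-(I * (c : ℂ) / 2)‖ = |c| / 2 := by simp
    refine ⟨?_, ?_, ?_⟩
    · rw [hA]; simp only
      rw [norm_mul, hnexp, one_mul, norm_div, Complex.norm_ofNat, div_le_iff₀ (by norm_num)]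
      refine (norm_sub_le _ _).trans ?_
      rw [norm_mul, Complex.norm_I, one_mul, Complex.norm_real, Complex.norm_real,
        Real.norm_eq_abs, Real.norm_eq_abs]
      linarith
    · rw [hA₁]; simp only
      rw [norm_mul, hnexp, one_mul, norm_div, norm_mul, hnI, norm_pow, Complex.norm_real,
        Complex.norm_real, Real.norm_of_nonneg hz0.le, Real.norm_eq_abs]
      gcongr
      linarith [abs_nonneg c]
    · rw [hA₂]; simp only
      rw [norm_mul, hnexp, one_mul, norm_mul, hnI]
      have hb1 : ‖(w₁ z : ℂ) / (z : ℂ) ^ 2‖ ≤ M / z ^ 2 := by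
        rw [norm_div, norm_pow, Complex.norm_real, Complex.norm_real, Real.norm_of_nonneg hz0.le,
          Real.norm_eq_abs]
        gcongr
      have hb2 : ‖I * (w z : ℂ) / (z : ℂ) ^ 2‖ ≤ M / z ^ 2 := by
        rw [norm_div, norm_mul, Complex.norm_I, one_mul, norm_pow, Complex.norm_real,
          Complex.norm_real, Real.norm_of_nonneg hz0.le, Real.norm_eq_abs]
        gcongr
      have hb3 : ‖2 * (w z : ℂ) / (z : ℂ) ^ 3‖ ≤ 4 * (M / z ^ 2) := by
        rw [norm_div, norm_mul, norm_pow, Complex.norm_real, Complex.norm_ofNat,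
          Complex.norm_real, Real.norm_of_nonneg hz0.le, Real.norm_eq_abs]
        calc 2 * |w z| / z ^ 3 ≤ 2 * M / z ^ 3 := by gcongr
          _ = (2 / z) * (M / z ^ 2) := by field_simp
          _ ≤ 4 * (M / z ^ 2) := by
              gcongr
              rw [div_le_iff₀ hz0]; linarith
      calc _ ≤ |c| / 2 * (M / z ^ 2 + 4 * (M / z ^ 2) + M / z ^ 2) := by
            gcongr
            exact (norm_sub_le _ _).trans (add_le_add ((norm_sub_le _ _).trans
              (add_le_add hb1 hb3)) hb2)
        _ = _ := by ring
  refine ⟨max M (12 * |c| * M), A, le_max_of_le_left hM,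
    fun z hz => (hb z hz).1.trans (le_max_left _ _), fun z => ?_, fun ρ hρ => ?_⟩
  · have e1 : cexp (I * (z : ℂ)) * cexp (-(I * (z : ℂ))) = 1 := by
      rw [← Complex.exp_add]; simp
    have e2 : conj (cexp (-(I * (z : ℂ)))) = cexp (I * (z : ℂ)) := by
      rw [← Complex.exp_conj]; simp
    rw [hA]
    simp only [map_mul, map_div₀, map_sub, e2, Complex.conj_ofReal, Complex.conj_I, map_ofNat]
    linear_combination (-(w z : ℂ)) * e1
  · have hpos : ∀ x ∈ Set.Icc (1 / 2 : ℝ) 4, 1 / 2 ≤ ρ * x ∧ 0 < ρ * x ∧ ρ ≤ 2 * (ρ * x) := by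
      rintro x ⟨hx, -⟩
      refine ⟨by nlinarith, by nlinarith, by nlinarith⟩
    have hin : ∀ x : ℝ, HasDerivAt (fun x => ρ * x) ρ x := fun x => by
      simpa using (hasDerivAt_id x).const_mul ρ
    refine ⟨fun x => (ρ : ℂ) * A₁ (ρ * x), fun x => (ρ : ℂ) * ((ρ : ℂ) * A₂ (ρ * x)),
      fun x hx => ?_, fun x hx => ?_, ?_, fun x hx => ?_⟩
    · exact HasDerivAt.congr_deriv ((hdA _ (hpos x hx).2.1).scomp x (hin x)) (by simp)
    · have := ((hdA₁ _ (hpos x hx).2.1).scomp x (hin x)).const_mul (ρ : ℂ)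
      simpa using this
    · intro x hx
      obtain ⟨-, hp, -⟩ := hpos x hx
      have hz := hcz _ hp
      have hwc : ContinuousAt (fun x => ((w (ρ * x) : ℝ) : ℂ)) x :=
        Complex.continuous_ofReal.continuousAt.comp
          ((hw _ hp).continuousAt.comp (f := fun x => ρ * x) (hin x).continuousAt)
      have hw₁c : ContinuousAt (fun x => ((w₁ (ρ * x) : ℝ) : ℂ)) x :=
        Complex.continuous_ofReal.continuousAt.comp
          ((hw₁ _ hp).continuousAt.comp (f := fun x => ρ * x) (hin x).continuousAt)
      have hzc : ContinuousAt (fun x : ℝ => ((ρ * x : ℝ) : ℂ)) x := by fun_prop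
      refine ContinuousAt.continuousWithinAt ?_
      refine continuousAt_const.mul (continuousAt_const.mul ?_)
      rw [hA₂]
      refine ContinuousAt.mul ?_ (continuousAt_const.mul (((hw₁c.div (hzc.pow 2)
        (pow_ne_zero 2 hz)).sub ((continuousAt_const.mul hwc).div (hzc.pow 3)
        (pow_ne_zero 3 hz))).sub ((continuousAt_const.mul hwc).div (hzc.pow 2) (pow_ne_zero 2 hz))))
      fun_prop
    · obtain ⟨h1, h2, h3⟩ := hpos x hx
      obtain ⟨a0, a1, a2⟩ := hn2 _ h1
      have hρ0 : 0 < ρ := by linarith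
      have hq : ρ ^ 2 / (ρ * x) ^ 2 ≤ 4 := by
        rw [div_le_iff₀ (by positivity)]
        nlinarith
      have hcM : 0 ≤ |c| * M := by positivity
      refine ⟨a0.trans (le_max_left _ _), le_max_of_le_right ?_, le_max_of_le_right ?_⟩
      · rw [norm_mul, Complex.norm_real, Real.norm_of_nonneg hρ0.le]
        calc ρ * ‖A₁ (ρ * x)‖ ≤ ρ ^ 2 * (|c| * M / (ρ * x) ^ 2) := by
              gcongr
              nlinarith
          _ = (|c| * M) * (ρ ^ 2 / (ρ * x) ^ 2) := by ring
          _ ≤ (|c| * M) * 4 := by gcongr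
          _ ≤ 12 * |c| * M := by nlinarith
      · rw [norm_mul, norm_mul, Complex.norm_real, Real.norm_of_nonneg hρ0.le]
        calc ρ * (ρ * ‖A₂ (ρ * x)‖) ≤ ρ * (ρ * (3 * |c| * M / (ρ * x) ^ 2)) := by gcongr
          _ = (3 * (|c| * M)) * (ρ ^ 2 / (ρ * x) ^ 2) := by ring
          _ ≤ (3 * (|c| * M)) * 4 := by gcongr
          _ = 12 * |c| * M := by ring

/-- Behaviour of `sphJ` for small and large arguments. -/
theorem exists_sphJ_asymptotics {d : ℕ} (i : Fin d) :
    ∃ (M : ℝ) (A : ℝ → ℂ), 0 ≤ M ∧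
      (∀ z : ℝ, ((z ^ (((d : ℝ) - 1) / 2) * sphJ i z : ℝ) : ℂ)
        = cexp (I * (z : ℂ)) * A z + cexp (-(I * (z : ℂ))) * conj (A z)) ∧
      (∀ ρ, 1 ≤ ρ → BoundedC2 (fun x => A (ρ * x)) M) ∧
      (∀ z, 0 ≤ z → |z ^ (((d : ℝ) - 1) / 2) * sphJ i z| ≤ M) ∧ (∀ z, |sphJ i z| ≤ M) ∧
      (∀ ρ, 0 ≤ ρ → ρ ≤ 2 → BoundedC2 (fun x => ((sphJ i (ρ * x) : ℝ) : ℂ)) M) := by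
  set ν : ℝ := ((d : ℝ) - 1) / 2 with hν
  have hd : (1 : ℝ) ≤ d := by exact_mod_cast i.pos
  have hν0 : 0 ≤ ν := by rw [hν]; linarith
  have hw : ∀ z, 0 < z → HasDerivAt (fun z => z ^ ν * sphJ i z)
      (ν * z ^ (ν - 1) * sphJ i z + z ^ ν * sphJ₁ i z) z := fun z hz =>
    (Real.hasDerivAt_rpow_const (Or.inl hz.ne')).mul (hasDerivAt_sphJ i z)
  have hw₁ : ∀ z, 0 < z → HasDerivAt (fun z => ν * z ^ (ν - 1) * sphJ i z + z ^ ν * sphJ₁ i z)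
      (-(z ^ ν * sphJ i z) + (ν * (ν - 1)) * (z ^ ν * sphJ i z) / z ^ 2) z := by
    intro z hz
    refine HasDerivAt.congr_deriv ((((Real.hasDerivAt_rpow_const (Or.inl hz.ne')).const_mul ν).mul
      (hasDerivAt_sphJ i z)).add ((Real.hasDerivAt_rpow_const (Or.inl hz.ne')).mul
        (hasDerivAt_sphJ₁ i z))) ?_
    rw [sphJ_ode i hz.ne', show ν - 1 - 1 = ν - 2 by ring, Real.rpow_sub_one hz.ne',
      Real.rpow_sub hz, Real.rpow_two, show (d : ℝ) - 1 = 2 * ν by rw [hν]; ring]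
    field_simp
    ring
  obtain ⟨M, A, hM, hb, hdec, hC2⟩ := exists_wkb_of_ode hw hw₁
  set S := (volume : Measure (Ed d)).toSphere.real Set.univ with hS
  have hS0 : 0 ≤ S := measureReal_nonneg
  have hmono : ∀ {P : ℝ → ℂ} {B B' : ℝ}, B ≤ B' → BoundedC2 P B → BoundedC2 P B' := by
    rintro P B B' hBB ⟨P₁, P₂, h1, h2, h3, h4⟩
    exact ⟨P₁, P₂, h1, h2, h3, fun x hx => ⟨(h4 x hx).1.trans hBB, (h4 x hx).2.1.trans hBB,
      (h4 x hx).2.2.trans hBB⟩⟩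
  have hM' : M ≤ max M (4 * S) := le_max_left _ _
  have hS' : S ≤ max M (4 * S) := le_trans (by linarith) (le_max_right _ _)
  refine ⟨max M (4 * S), A, hM.trans hM', hdec, fun ρ hρ => hmono hM' (hC2 ρ hρ), fun z hz => ?_,
    fun z => (abs_sphJ_le i z).1.trans hS', fun ρ hρ0 hρ2 => hmono (le_max_right M (4 * S)) ?_⟩
  · rcases le_or_gt (1 / 2) z with h | h
    · exact (hb z h).trans hM'
    · rw [abs_mul, abs_of_nonneg (by positivity)]
      calc z ^ ν * |sphJ i z| ≤ 1 * S := by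
            gcongr
            · exact Real.rpow_le_one hz (by linarith) hν0
            · exact (abs_sphJ_le i z).1
        _ ≤ _ := by rw [one_mul]; exact hS'
  · have hin : ∀ x : ℝ, HasDerivAt (fun x => ρ * x) ρ x := fun x => by
      simpa using (hasDerivAt_id x).const_mul ρ
    refine ⟨fun x => ((ρ * sphJ₁ i (ρ * x) : ℝ) : ℂ),
      fun x => ((ρ * (ρ * sphJ₂ i (ρ * x)) : ℝ) : ℂ), fun x hx => ?_, fun x hx => ?_, ?_,
      fun x hx => ?_⟩
    · have := ((hasDerivAt_sphJ i (ρ * x)).comp x (hin x)).ofReal_comp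
      refine HasDerivAt.congr_deriv this (by rw [mul_comm])
    · have := (((hasDerivAt_sphJ₁ i (ρ * x)).comp x (hin x)).const_mul ρ).ofReal_comp
      refine HasDerivAt.congr_deriv this (by rw [mul_comm (sphJ₂ i _)])
    · have := continuous_sphJ₂ i
      fun_prop
    · obtain ⟨j0, j1, j2⟩ := abs_sphJ_le i (ρ * x)
      simp only [Complex.norm_real, Real.norm_eq_abs, abs_mul, abs_of_nonneg hρ0]
      refine ⟨by linarith, ?_, ?_⟩
      · calc ρ * |sphJ₁ i (ρ * x)| ≤ 2 * S := by gcongr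
          _ ≤ 4 * S := by linarith
      · calc ρ * (ρ * |sphJ₂ i (ρ * x)|) ≤ 2 * (2 * S) := by gcongr
          _ = 4 * S := by ring

theorem norm_cexp_I_mul (y : ℝ) : ‖cexp (I * (y : ℂ))‖ = 1 := by
  rw [mul_comm]; exact Complex.norm_exp_ofReal_mul_I _

/-- Radial profile of the evolution of data with frequencies in `[1, 2]`. -/
def unitWave {d : ℕ} (i : Fin d) (a : ℝ) (h : ℝ → ℂ) (t ρ : ℝ) : ℂ :=
  ∫ x in Set.Icc (1 : ℝ) 2, cexp (I * ((-(t * x ^ a) : ℝ) : ℂ)) * (sphJ i (ρ * x) * h x)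

theorem continuous_sphJ {d : ℕ} (i : Fin d) : Continuous (sphJ i) :=
  continuous_iff_continuousAt.2 fun z => (hasDerivAt_sphJ i z).continuousAt

theorem continuous_unitWave {d : ℕ} (i : Fin d) (a : ℝ) {h : ℝ → ℂ}
    (hh : IntegrableOn h (Set.Icc 1 2)) : Continuous (Function.uncurry (unitWave i a h)) := by
  obtain ⟨M, A, hM, -, -, -, hJ, -⟩ := exists_sphJ_asymptotics i
  have hJc := continuous_sphJ i
  refine continuous_of_dominated (bound := fun x => M * ‖h x‖) ?_ ?_ (hh.norm.const_mul M) ?_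
  · rintro ⟨t, ρ⟩
    refine AEStronglyMeasurable.mul (Measurable.aestronglyMeasurable (by fun_prop))
      (AEStronglyMeasurable.mul (Measurable.aestronglyMeasurable (by fun_prop))
        hh.aestronglyMeasurable)
  · rintro ⟨t, ρ⟩
    refine ae_of_all _ fun x => ?_
    rw [norm_mul, norm_cexp_I_mul, one_mul, norm_mul, Complex.norm_real]
    gcongr
    exact hJ _
  · exact ae_of_all _ fun x => by fun_prop

/-- Estimates for the evolution of data with frequencies in `[1, 2]`. -/
theorem exists_unit_bounds {d : ℕ} (i : Fin d) {a γ : ℝ} (ha : 1 < a) (ha2 : a < 2)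
    (hγ : 1 / 2 < γ) (hγ1 : γ ≤ 1) :
    ∃ C : ℝ≥0∞, C ≠ ⊤ ∧ ∀ h : ℝ → ℂ, IntegrableOn h (Set.Icc 1 2) →
      (∀ ρ : ℝ, 0 < ρ → ∫⁻ t, ‖unitWave i a h t ρ‖ₑ ^ 2
        ≤ C * ENNReal.ofReal (ρ ^ (-((d : ℝ) - 1))) * ∫⁻ x in Set.Icc (1 : ℝ) 2, ‖h x‖ₑ ^ 2) ∧
      (∀ ρ : ℕ → ℝ, (∀ n, 0 ≤ ρ n ∧ ρ n ≤ 2) → ∫⁻ t, ⨆ n, ‖unitWave i a h t (ρ n)‖ₑ ^ 2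
        ≤ C * ∫⁻ x in Set.Icc (1 : ℝ) 2, ‖h x‖ₑ ^ 2) ∧
      (∀ b : ℝ, 1 ≤ b → ∀ ρ : ℕ → ℝ, (∀ n, b ≤ ρ n ∧ ρ n ≤ 2 * b) →
        ∫⁻ t, ⨆ n, ‖unitWave i a h t (ρ n)‖ₑ ^ 2
        ≤ C * ENNReal.ofReal (b ^ (γ - ((d : ℝ) - 1))) *
          ∫⁻ x in Set.Icc (1 : ℝ) 2, ‖h x‖ₑ ^ 2) := by
  obtain ⟨M, A, hM, hdec, hA, hJν, hJ, hJ2⟩ := exists_sphJ_asymptotics i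
  obtain ⟨C, hC, hmax⟩ := exists_maximal_bound ha ha2 hγ hγ1
  set ν : ℝ := ((d : ℝ) - 1) / 2 with hν
  have hd : (1 : ℝ) ≤ d := by exact_mod_cast i.pos
  have hν0 : 0 ≤ ν := by rw [hν]; linarith
  have hJc := continuous_sphJ i
  refine ⟨C * ENNReal.ofReal (M ^ 2) * 4, ENNReal.mul_ne_top (ENNReal.mul_ne_top hC
    ENNReal.ofReal_ne_top) (by simp), fun h hh => ⟨fun ρ hρ => ?_, fun ρ hρ => ?_,
    fun b hb ρ hρ => ?_⟩⟩
  · have hf : IntegrableOn (fun x => (sphJ i (ρ * x) : ℂ) * h x) (Set.Icc 1 2) :=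
      Integrable.bdd_mul hh (Measurable.aestronglyMeasurable (by fun_prop)) (c := M)
        (ae_of_all _ fun x => by rw [Complex.norm_real]; exact hJ _)
    have key := hmax 1 1 (fun _ => 0) (fun _ _ => 1) le_rfl (by simp)
      (fun _ => ⟨fun _ => 0, fun _ => 0, fun x _ => hasDerivAt_const x _,
        fun x _ => hasDerivAt_const x _, continuousOn_const, by simp⟩) _ hf
    simp only [one_mul, zero_mul, add_zero, ciSup_const, one_pow, Real.one_rpow, mul_one,
      ENNReal.ofReal_one] at key
    refine key.trans ?_
    rw [mul_assoc (C * _ * 4), mul_assoc C, mul_assoc C]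
    gcongr
    have hle : ∀ x ∈ Set.Icc (1 : ℝ) 2, ‖(sphJ i (ρ * x) : ℂ) * h x‖ₑ ^ 2
        ≤ ENNReal.ofReal (M ^ 2 * ρ ^ (-((d : ℝ) - 1))) * ‖h x‖ₑ ^ 2 := by
      intro x hx
      rw [enorm_mul, mul_pow]
      gcongr
      rw [← ofReal_norm, ← ENNReal.ofReal_pow (norm_nonneg _), Complex.norm_real]
      refine ENNReal.ofReal_le_ofReal ?_
      have hx0 : 0 < x := by linarith [hx.1]
      have h1 := hJν (ρ * x) (by positivity)
      rw [abs_mul, abs_of_nonneg (by positivity)] at h1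
      have h2 : ρ ^ ν ≤ (ρ * x) ^ ν := Real.rpow_le_rpow hρ.le (by nlinarith [hx.1]) hν0
      have h3 : ρ ^ ν * |sphJ i (ρ * x)| ≤ M := le_trans (by gcongr) h1
      have h4 : ρ ^ (-((d : ℝ) - 1)) = ((ρ ^ ν) ^ 2)⁻¹ := by
        rw [← Real.rpow_natCast, ← Real.rpow_mul hρ.le, ← Real.rpow_neg hρ.le, hν]
        congr 1
        push_cast
        ring
      have hρν : 0 < ρ ^ ν := by positivity
      rw [h4, ← div_eq_mul_inv, le_div_iff₀ (by positivity), ← mul_pow, Real.norm_eq_abs,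
        mul_comm]
      gcongr
    refine (setLIntegral_mono' measurableSet_Icc hle).trans ?_
    rw [lintegral_const_mul' _ _ ENNReal.ofReal_ne_top, ENNReal.ofReal_mul (by positivity)]
    calc _ = ENNReal.ofReal (M ^ 2) * 1 * (ENNReal.ofReal (ρ ^ (-((d : ℝ) - 1)))
          * ∫⁻ x in Set.Icc (1 : ℝ) 2, ‖h x‖ₑ ^ 2) := by ring
      _ ≤ ENNReal.ofReal (M ^ 2) * 4 * (ENNReal.ofReal (ρ ^ (-((d : ℝ) - 1)))
          * ∫⁻ x in Set.Icc (1 : ℝ) 2, ‖h x‖ₑ ^ 2) := by gcongr; norm_num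
      _ = _ := by ring
  · have key := hmax 1 M (fun _ => 0) (fun n x => (sphJ i (ρ n * x) : ℂ)) le_rfl (by simp)
      (fun n => hJ2 _ (hρ n).1 (hρ n).2) h hh
    simp only [zero_mul, add_zero, Real.one_rpow, mul_one] at key
    refine key.trans ?_
    calc _ = C * ENNReal.ofReal (M ^ 2) * 1 * ∫⁻ x in Set.Icc (1 : ℝ) 2, ‖h x‖ₑ ^ 2 := by ring
      _ ≤ _ := by gcongr; norm_num
  · set g : ℝ → ℂ := fun x => ((x ^ (-ν) : ℝ) : ℂ) * h x with hg
    have hx1 : ∀ x ∈ Set.Icc (1 : ℝ) 2, ‖((x ^ (-ν) : ℝ) : ℂ)‖ ≤ 1 := by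
      intro x hx
      rw [Complex.norm_real, Real.norm_of_nonneg (Real.rpow_nonneg (by linarith [hx.1]) _)]
      exact Real.rpow_le_one_of_one_le_of_nonpos hx.1 (by linarith)
    have hgi : IntegrableOn g (Set.Icc 1 2) :=
      Integrable.bdd_mul hh (Measurable.aestronglyMeasurable (by fun_prop)) (c := 1)
        ((ae_restrict_iff' measurableSet_Icc).2 (ae_of_all _ hx1))
    have hgn : ∫⁻ x in Set.Icc (1 : ℝ) 2, ‖g x‖ₑ ^ 2 ≤ ∫⁻ x in Set.Icc (1 : ℝ) 2, ‖h x‖ₑ ^ 2 := by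
      refine setLIntegral_mono' measurableSet_Icc fun x hx => ?_
      gcongr
      rw [hg]
      simp only
      rw [enorm_mul]
      refine mul_le_of_le_one_left zero_le ?_
      rw [← ofReal_norm, ← ENNReal.ofReal_one]
      exact ENNReal.ofReal_le_ofReal (hx1 x hx)
    have hρ1 : ∀ n, 1 ≤ ρ n := fun n => hb.trans (hρ n).1
    have hσ : ∀ n m, |ρ n - ρ m| ≤ b := fun n m => by
      rw [abs_le]
      constructor <;> linarith [(hρ n).1, (hρ n).2, (hρ m).1, (hρ m).2]
    have key₁ := hmax b M ρ (fun n x => A (ρ n * x)) hb hσ (fun n => hA _ (hρ1 n)) g hgi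
    have key₂ := hmax b M (fun n => -ρ n) (fun n x => conj (A (ρ n * x))) hb
      (fun n m => by rw [show -ρ n - -ρ m = ρ m - ρ n by ring]; exact hσ m n)
      (fun n => (hA _ (hρ1 n)).conj) g hgi
    set V₁ : ℕ → ℝ → ℂ := fun n t => ∫ x in Set.Icc (1 : ℝ) 2,
      cexp (I * ((-(t * x ^ a) + ρ n * x : ℝ) : ℂ)) * (A (ρ n * x) * g x) with hV₁
    set V₂ : ℕ → ℝ → ℂ := fun n t => ∫ x in Set.Icc (1 : ℝ) 2,
      cexp (I * ((-(t * x ^ a) + -ρ n * x : ℝ) : ℂ)) * (conj (A (ρ n * x)) * g x) with hV₂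
    have h12 : Set.Icc (1 : ℝ) 2 ⊆ Set.Icc (1 / 2) 4 :=
      Set.Icc_subset_Icc (by norm_num) (by norm_num)
    have hPg : ∀ {P : ℝ → ℂ}, BoundedC2 P M → ∀ (φ : ℝ → ℝ), Measurable φ →
        IntegrableOn (fun x => cexp (I * (φ x : ℂ)) * (P x * g x)) (Set.Icc 1 2) := by
      intro P hP φ hφ
      refine Integrable.bdd_mul (Integrable.bdd_mul hgi
        ((hP.continuousOn.mono h12).aestronglyMeasurable measurableSet_Icc) (c := M)
        ((ae_restrict_iff' measurableSet_Icc).2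
          (ae_of_all _ fun x hx => hP.norm_le (h12 hx)))) (Measurable.aestronglyMeasurable
          (by fun_prop)) (c := 1) (ae_of_all _ fun x => (norm_cexp_I_mul _).le)
    have hW : ∀ n t, unitWave i a h t (ρ n) = ((ρ n ^ (-ν) : ℝ) : ℂ) * (V₁ n t + V₂ n t) := by
      intro n t
      rw [hV₁, hV₂]
      simp only
      rw [← integral_add (hPg (hA _ (hρ1 n)) _ (by fun_prop))
        (hPg (hA _ (hρ1 n)).conj _ (by fun_prop)), ← integral_const_mul, unitWave]
      refine setIntegral_congr_fun measurableSet_Icc fun x hx => ?_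
      have hx0 : 0 < x := by linarith [hx.1]
      have hn0 : 0 < ρ n := by linarith [hρ1 n]
      have e1 : sphJ i (ρ n * x) = ρ n ^ (-ν) * (x ^ (-ν) * ((ρ n * x) ^ ν * sphJ i (ρ n * x))) := by
        rw [Real.mul_rpow hn0.le hx0.le, Real.rpow_neg hn0.le, Real.rpow_neg hx0.le]
        field_simp
      rw [e1, Complex.ofReal_mul, Complex.ofReal_mul (x ^ (-ν)), hdec (ρ n * x), hg]
      rw [show -(I * ((ρ n * x : ℝ) : ℂ)) = I * ((-ρ n * x : ℝ) : ℂ) by push_cast; ring,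
        Complex.ofReal_add, Complex.ofReal_add, mul_add I, mul_add I, Complex.exp_add,
        Complex.exp_add]
      ring
    have hsup : ∀ t, ⨆ n, ‖unitWave i a h t (ρ n)‖ₑ ^ 2
        ≤ ENNReal.ofReal (b ^ (-((d : ℝ) - 1))) * 2 *
          ((⨆ n, ‖V₁ n t‖ₑ ^ 2) + ⨆ n, ‖V₂ n t‖ₑ ^ 2) := by
      intro t
      refine iSup_le fun n => ?_
      rw [hW, enorm_mul, mul_pow, mul_assoc]
      have hn0 : 0 < ρ n := by linarith [hρ1 n]
      gcongr ?_ * ?_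
      · rw [← ofReal_norm, ← ENNReal.ofReal_pow (norm_nonneg _), Complex.norm_real,
          Real.norm_of_nonneg (by positivity)]
        refine ENNReal.ofReal_le_ofReal ?_
        rw [← Real.rpow_natCast, ← Real.rpow_mul hn0.le,
          show -ν * ((2 : ℕ) : ℝ) = -((d : ℝ) - 1) by rw [hν]; push_cast; ring]
        exact Real.rpow_le_rpow_of_nonpos (by linarith) (hρ n).1 (by linarith)
      · calc ‖V₁ n t + V₂ n t‖ₑ ^ 2 ≤ (‖V₁ n t‖ₑ + ‖V₂ n t‖ₑ) ^ 2 := by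
              gcongr; exact enorm_add_le _ _
          _ ≤ 2 * (‖V₁ n t‖ₑ ^ 2 + ‖V₂ n t‖ₑ ^ 2) := by
              have := ENNReal.rpow_add_le_mul_rpow_add_rpow ‖V₁ n t‖ₑ ‖V₂ n t‖ₑ (p := 2)
                (by norm_num)
              norm_num at this
              simpa using this
          _ ≤ _ := by
              gcongr
              · exact le_iSup (fun n => ‖V₁ n t‖ₑ ^ 2) n
              · exact le_iSup (fun n => ‖V₂ n t‖ₑ ^ 2) n
    have hVm : AEMeasurable (fun t => ⨆ n, ‖V₁ n t‖ₑ ^ 2) := by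
      refine (Measurable.iSup fun n => Continuous.measurable ?_).aemeasurable
      refine ENNReal.continuous_pow 2 |>.comp (continuous_enorm.comp ?_)
      refine continuous_of_dominated (bound := fun x =>
        ‖cexp (I * ((0 : ℝ) : ℂ)) * (A (ρ n * x) * g x)‖)
        (fun t => (hPg (hA _ (hρ1 n)) _ (by fun_prop)).aestronglyMeasurable)
        (fun t => ae_of_all _ fun x => ?_)
        (hPg (hA _ (hρ1 n)) _ measurable_const).norm (ae_of_all _ fun x => by fun_prop)
      simp only [norm_mul, norm_cexp_I_mul]
      exact le_rfl
    calc ∫⁻ t, ⨆ n, ‖unitWave i a h t (ρ n)‖ₑ ^ 2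
        ≤ ∫⁻ t, ENNReal.ofReal (b ^ (-((d : ℝ) - 1))) * 2 *
          ((⨆ n, ‖V₁ n t‖ₑ ^ 2) + ⨆ n, ‖V₂ n t‖ₑ ^ 2) := lintegral_mono hsup
      _ = ENNReal.ofReal (b ^ (-((d : ℝ) - 1))) * 2 *
          ((∫⁻ t, ⨆ n, ‖V₁ n t‖ₑ ^ 2) + ∫⁻ t, ⨆ n, ‖V₂ n t‖ₑ ^ 2) := by
          rw [lintegral_const_mul' _ _ (ENNReal.mul_ne_top ENNReal.ofReal_ne_top (by simp)),
            lintegral_add_left' hVm]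
      _ ≤ ENNReal.ofReal (b ^ (-((d : ℝ) - 1))) * 2 *
          (C * ENNReal.ofReal (M ^ 2 * b ^ γ) * (∫⁻ x in Set.Icc (1 : ℝ) 2, ‖h x‖ₑ ^ 2) +
          C * ENNReal.ofReal (M ^ 2 * b ^ γ) * ∫⁻ x in Set.Icc (1 : ℝ) 2, ‖h x‖ₑ ^ 2) := by
          gcongr
          · exact key₁.trans (by gcongr)
          · exact key₂.trans (by gcongr)
      _ = _ := by
          rw [show γ - ((d : ℝ) - 1) = γ + -((d : ℝ) - 1) by ring,
            Real.rpow_add (by linarith), ENNReal.ofReal_mul (by positivity),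
            ENNReal.ofReal_mul (by positivity)]
          ring

theorem lintegral_comp_mul_left_pos {c : ℝ} (hc : 0 < c) {f : ℝ → ℝ≥0∞} (hf : Measurable f) :
    ∫⁻ t, f (c * t) = ENNReal.ofReal c⁻¹ * ∫⁻ t, f t := by
  rw [← lintegral_map (f := f) (g := fun t => c * t) hf (by fun_prop),
    Real.map_volume_mul_left hc.ne', lintegral_smul_measure, abs_of_pos (by positivity), smul_eq_mul]

/-- Interpolation between a pointwise bound and a square function bound. -/
theorem lintegral_rpow_lintegral_le {X : Type*} [MeasurableSpace X] {μ : Measure X} [SFinite μ]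
    {W : ℝ → X → ℝ≥0∞} (hW : Measurable (Function.uncurry W)) {A : Set X} (hA : MeasurableSet A)
    {S : ℝ → ℝ≥0∞} (hS : Measurable S) (hSb : ∀ t, ∀ x ∈ A, W t x ^ 2 ≤ S t) {K : ℝ≥0∞}
    (hK : ∀ x ∈ A, ∫⁻ t, W t x ^ 2 ≤ K) {θ : ℝ} (hθ0 : 0 < θ) (hθ1 : θ < 1) :
    ∫⁻ t, (∫⁻ x in A, W t x ^ (2 / θ) ∂μ) ^ θ ≤ (∫⁻ t, S t) ^ (1 - θ) * (μ A * K) ^ θ := by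
  have hm : Measurable (Function.uncurry fun t x => W t x ^ 2) := hW.pow_const 2
  have hθi : 0 ≤ θ⁻¹ - 1 := sub_nonneg.2 ((one_le_inv₀ hθ0).2 hθ1.le)
  have h1 : ∀ t, (∫⁻ x in A, W t x ^ (2 / θ) ∂μ) ^ θ
      ≤ S t ^ (1 - θ) * (∫⁻ x in A, W t x ^ 2 ∂μ) ^ θ := by
    intro t
    have hmt : Measurable fun x => W t x ^ 2 := hm.comp (measurable_prodMk_left (x := t))
    have h2 : ∫⁻ x in A, W t x ^ (2 / θ) ∂μ ≤ S t ^ (θ⁻¹ - 1) * ∫⁻ x in A, W t x ^ 2 ∂μ := by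
      rw [← lintegral_const_mul _ hmt]
      refine setLIntegral_mono' hA fun x hx => ?_
      calc W t x ^ (2 / θ) = (W t x ^ 2) ^ (θ⁻¹ - 1 + 1) := by
            rw [← ENNReal.rpow_natCast, ← ENNReal.rpow_mul]
            congr 1
            push_cast
            ring
        _ = (W t x ^ 2) ^ (θ⁻¹ - 1) * (W t x ^ 2) ^ (1 : ℝ) :=
            ENNReal.rpow_add_of_nonneg _ _ hθi zero_le_one
        _ ≤ _ := by
            rw [ENNReal.rpow_one]
            gcongr
            exact hSb t x hx
    calc _ ≤ (S t ^ (θ⁻¹ - 1) * ∫⁻ x in A, W t x ^ 2 ∂μ) ^ θ := by gcongr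
      _ = _ := by
        rw [ENNReal.mul_rpow_of_nonneg _ _ hθ0.le, ← ENNReal.rpow_mul]
        congr 2
        field_simp
  have hI : Measurable fun t => ∫⁻ x in A, W t x ^ 2 ∂μ := hm.lintegral_prod_right'
  refine (lintegral_mono h1).trans ((ENNReal.lintegral_mul_norm_pow_le hS.aemeasurable
    hI.aemeasurable (by linarith) hθ0.le (by ring)).trans ?_)
  gcongr
  rw [lintegral_lintegral_swap hm.aemeasurable]
  calc _ ≤ ∫⁻ x in A, K ∂μ := setLIntegral_mono' hA fun x hx => hK x hx
    _ = _ := by rw [setLIntegral_const, mul_comm]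

theorem exists_dyadic_unit_bounds {d : ℕ} (i : Fin d) {a γ : ℝ} (ha : 1 < a) (ha2 : a < 2)
    (hγ : 1 / 2 < γ) (hγ1 : γ ≤ 1) :
    ∃ C : ℝ≥0∞, C ≠ ⊤ ∧ ∀ h : ℝ → ℂ, IntegrableOn h (Set.Icc 1 2) → ∀ m : ℤ,
      (∃ S : ℝ → ℝ≥0∞, Measurable S ∧
        (∀ t, ∀ ρ ∈ Set.Icc ((2 : ℝ) ^ (m : ℝ)) (2 * (2 : ℝ) ^ (m : ℝ)),
          ‖unitWave i a h t ρ‖ₑ ^ 2 ≤ S t) ∧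
        ∫⁻ t, S t ≤ C * ENNReal.ofReal
          (if m ≤ 0 then 1 else (2 : ℝ) ^ ((m : ℝ) * (γ - ((d : ℝ) - 1)))) *
          ∫⁻ x in Set.Icc (1 : ℝ) 2, ‖h x‖ₑ ^ 2) ∧
      (∀ ρ ∈ Set.Icc ((2 : ℝ) ^ (m : ℝ)) (2 * (2 : ℝ) ^ (m : ℝ)),
        ∫⁻ t, ‖unitWave i a h t ρ‖ₑ ^ 2 ≤ C * ENNReal.ofReal
          (if m ≤ 0 then 1 else (2 : ℝ) ^ ((m : ℝ) * (-((d : ℝ) - 1)))) *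
          ∫⁻ x in Set.Icc (1 : ℝ) 2, ‖h x‖ₑ ^ 2) := by
  obtain ⟨C, hC, hb⟩ := exists_unit_bounds i ha ha2 hγ hγ1
  have hd : (1 : ℝ) ≤ d := by exact_mod_cast i.pos
  refine ⟨C, hC, fun h hh m => ?_⟩
  obtain ⟨h1, h2, h3⟩ := hb h hh
  set b : ℝ := (2 : ℝ) ^ (m : ℝ) with hbdef
  have hb0 : 0 < b := by positivity
  have hle : m ≤ 0 → b ≤ 1 := fun hm =>
    Real.rpow_le_one_of_one_le_of_nonpos (by norm_num) (by exact_mod_cast hm)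
  have hge : ¬ m ≤ 0 → 1 ≤ b := fun hm =>
    Real.one_le_rpow (by norm_num) (by exact_mod_cast (not_le.1 hm).le)
  have hcont := continuous_unitWave i a hh
  constructor
  · have : Nonempty (Set.Icc b (2 * b)) := ⟨⟨b, le_rfl, by linarith⟩⟩
    set ρ : ℕ → ℝ := fun n => (TopologicalSpace.denseSeq (Set.Icc b (2 * b)) n : ℝ) with hρdef
    have hρ : ∀ n, b ≤ ρ n ∧ ρ n ≤ 2 * b :=
      fun n => (TopologicalSpace.denseSeq (Set.Icc b (2 * b)) n).2
    have hct : ∀ z, Continuous fun t => ‖unitWave i a h t z‖ₑ ^ 2 := fun z =>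
      (ENNReal.continuous_pow 2).comp (continuous_enorm.comp
        (hcont.comp (Continuous.prodMk continuous_id continuous_const)))
    refine ⟨fun t => ⨆ n, ‖unitWave i a h t (ρ n)‖ₑ ^ 2,
      Measurable.iSup fun n => (hct _).measurable, fun t z hz => ?_, ?_⟩
    · have hcl : IsClosed {w : Set.Icc b (2 * b) | ‖unitWave i a h t w‖ₑ ^ 2
          ≤ ⨆ n, ‖unitWave i a h t (ρ n)‖ₑ ^ 2} := by
        refine isClosed_le ((ENNReal.continuous_pow 2).comp (continuous_enorm.comp
          (hcont.comp (Continuous.prodMk continuous_const continuous_subtype_val))))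
          continuous_const
      exact (TopologicalSpace.denseRange_denseSeq (Set.Icc b (2 * b))).induction_on
        (p := fun w => ‖unitWave i a h t w‖ₑ ^ 2 ≤ ⨆ n, ‖unitWave i a h t (ρ n)‖ₑ ^ 2) ⟨z, hz⟩ hcl
        fun n => le_iSup (fun n => ‖unitWave i a h t (ρ n)‖ₑ ^ 2) n
    · split_ifs with hm
      · have := h2 ρ fun n => ⟨hb0.le.trans (hρ n).1, (hρ n).2.trans (by linarith [hle hm])⟩
        simpa using this
      · rw [Real.rpow_mul (by norm_num)]
        exact h3 b (hge hm) ρ hρ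
  · intro z hz
    split_ifs with hm
    · have := h2 (fun _ => z) fun n => ⟨hb0.le.trans hz.1, hz.2.trans (by linarith [hle hm])⟩
      simpa using this
    · refine (h1 z (hb0.trans_le hz.1)).trans ?_
      rw [Real.rpow_mul (by norm_num), ← hbdef]
      refine mul_le_mul' (mul_le_mul' le_rfl (ENNReal.ofReal_le_ofReal ?_)) le_rfl
      exact Real.rpow_le_rpow_of_nonpos hb0 hz.1 (by linarith)

/-- The dyadic annulus of inner radius `2 ^ j`. -/
def annulus (d : ℕ) (j : ℤ) : Set (Ed d) :=
  {x | (2 : ℝ) ^ (j : ℝ) ≤ ‖x‖ ∧ ‖x‖ < (2 : ℝ) ^ ((j : ℝ) + 1)}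

theorem measurableSet_annulus (d : ℕ) (j : ℤ) : MeasurableSet (annulus d j) :=
  (measurableSet_le measurable_const measurable_norm).inter
    (measurableSet_lt measurable_norm measurable_const)

theorem volume_annulus_le (d : ℕ) (j : ℤ) :
    volume (annulus d j) ≤ ENNReal.ofReal ((2 : ℝ) ^ (((j : ℝ) + 1) * d)) *
      volume (Metric.ball (0 : Ed d) 1) := by
  have h1 : annulus d j ⊆ Metric.closedBall 0 ((2 : ℝ) ^ ((j : ℝ) + 1)) := fun x hx => by
    rw [mem_closedBall_zero_iff]; exact hx.2.le
  refine (measure_mono h1).trans ?_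
  rw [Measure.addHaar_closedBall _ _ (by positivity), finrank_euclideanSpace_fin,
    ← Real.rpow_natCast, ← Real.rpow_mul (by norm_num)]

theorem annulus_weight_le {d : ℕ} {a γ : ℝ} (ha : 1 < a) (had : a < d) (j k : ℤ) :
    (((2 : ℝ) ^ (k : ℝ)) ^ a)⁻¹ *
      (if j + k ≤ 0 then 1 else
        (2 : ℝ) ^ (((j + k : ℤ) : ℝ) * (γ - ((d : ℝ) - 1)))) ^ (1 - (1 - a / d)) *
      (if j + k ≤ 0 then 1 else (2 : ℝ) ^ (((j + k : ℤ) : ℝ) * (-((d : ℝ) - 1)))) ^ (1 - a / d) *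
      ((2 : ℝ) ^ (((j : ℝ) + 1) * d)) ^ (1 - a / d)
    ≤ (2 : ℝ) ^ (d * (1 - a / d)) * ((2 : ℝ) ^ (-(d * k : ℝ)) *
      (2 : ℝ) ^ (-(min (d - a) (a - 1 - γ * (a / d)) * |((j + k : ℤ) : ℝ)|))) := by
  have hd : (0 : ℝ) < d := by linarith
  set θ : ℝ := 1 - a / d with hθ
  set δ : ℝ := min (d - a) (a - 1 - γ * (a / d)) with hδ
  have hdθ : d * θ = d - a := by rw [hθ]; field_simp
  have hp : ∀ x y : ℝ, ((2 : ℝ) ^ x) ^ y = (2 : ℝ) ^ (x * y) := fun x y =>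
    (Real.rpow_mul (by norm_num) _ _).symm
  have hadd : ∀ x y : ℝ, (2 : ℝ) ^ x * (2 : ℝ) ^ y = (2 : ℝ) ^ (x + y) := fun x y =>
    (Real.rpow_add (by norm_num) _ _).symm
  have hm : ((j + k : ℤ) : ℝ) = j + k := by push_cast; ring
  have hδ1 : δ ≤ d - a := min_le_left _ _
  have hδ2 : δ ≤ a - 1 - γ * (a / d) := min_le_right _ _
  split_ifs with hjk
  · have h0 : ((j + k : ℤ) : ℝ) ≤ 0 := by exact_mod_cast hjk
    rw [Real.one_rpow, Real.one_rpow, hp, hp, ← Real.rpow_neg (by norm_num), mul_one, mul_one,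
      hadd, hadd, hadd]
    refine Real.rpow_le_rpow_of_exponent_le (by norm_num) ?_
    rw [abs_of_nonpos h0, mul_assoc, hdθ]
    rw [hm] at h0 ⊢
    nlinarith
  · have h0 : 0 ≤ ((j + k : ℤ) : ℝ) := by exact_mod_cast (not_le.1 hjk).le
    rw [hp, hp, hp, hp, ← Real.rpow_neg (by norm_num), hadd, hadd, hadd, hadd, hadd]
    refine Real.rpow_le_rpow_of_exponent_le (by norm_num) ?_
    rw [abs_of_nonneg h0, mul_assoc _ (d : ℝ), hdθ]
    rw [hm] at h0 ⊢
    have e1 : (j + k : ℝ) * (γ - (d - 1)) * (1 - θ) + (j + k) * (-(d - 1)) * θ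
        = (j + k) * (γ * (a / d) - (d - 1)) := by rw [hθ]; ring
    have e2 : (j + k : ℝ) * δ ≤ (j + k) * (a - 1 - γ * (a / d)) := by gcongr
    linarith

/-- Spacetime estimate of a unit frequency wave, rescaled to frequency `2 ^ k`, on the annulus of
radius `2 ^ j`. -/
theorem exists_annulus_bound {d : ℕ} (i : Fin d) {a γ : ℝ} (ha : 1 < a) (ha2 : a < 2)
    (had : a < d) (hγ : 1 / 2 < γ) (hγ1 : γ ≤ 1) (hγa : γ < d - d / a) :
    ∃ (C : ℝ≥0∞) (δ : ℝ), C ≠ ⊤ ∧ 0 < δ ∧ ∀ h : ℝ → ℂ, IntegrableOn h (Set.Icc 1 2) →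
      ∀ j k : ℤ, ∫⁻ t, (∫⁻ x in annulus d j,
        ‖unitWave i a h (((2 : ℝ) ^ (k : ℝ)) ^ a * t) ((2 : ℝ) ^ (k : ℝ) * ‖x‖)‖ₑ ^
          (2 / (1 - a / d))) ^ (1 - a / d)
      ≤ C * ENNReal.ofReal ((2 : ℝ) ^ (-(d * k : ℝ)) * (2 : ℝ) ^ (-(δ * |((j + k : ℤ) : ℝ)|))) *
        ∫⁻ x in Set.Icc (1 : ℝ) 2, ‖h x‖ₑ ^ 2 := by
  obtain ⟨C, hC, hb⟩ := exists_dyadic_unit_bounds i ha ha2 hγ hγ1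
  have hd : (0 : ℝ) < d := by linarith
  set θ : ℝ := 1 - a / d with hθ
  have hθ0 : 0 < θ := by rw [hθ, sub_pos, div_lt_one hd]; exact had
  have hθ1 : θ < 1 := by rw [hθ]; linarith [div_pos (by linarith : 0 < a) hd]
  have hδ2 : 0 < a - 1 - γ * (a / d) := by
    have h1 : γ * (a / d) < (d - d / a) * (a / d) := by gcongr
    have h2 : (d - d / a) * (a / d) = a - 1 := by field_simp
    linarith
  set B : ℝ≥0∞ := volume (Metric.ball (0 : Ed d) 1) with hB
  have hBt : B ≠ ⊤ := measure_ball_lt_top.ne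
  refine ⟨C * ENNReal.ofReal ((2 : ℝ) ^ (d * θ)) * B ^ θ, min (d - a) (a - 1 - γ * (a / d)),
    ENNReal.mul_ne_top (ENNReal.mul_ne_top hC ENNReal.ofReal_ne_top)
      (ENNReal.rpow_ne_top_of_nonneg hθ0.le hBt), lt_min (by linarith) hδ2, fun h hh j k => ?_⟩
  set δ : ℝ := min (d - a) (a - 1 - γ * (a / d)) with hδ
  set N : ℝ≥0∞ := ∫⁻ x in Set.Icc (1 : ℝ) 2, ‖h x‖ₑ ^ 2 with hN
  obtain ⟨⟨S, hSm, hSb, hSi⟩, hK⟩ := hb h hh (j + k)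
  set M₁ : ℝ := if j + k ≤ 0 then 1 else (2 : ℝ) ^ (((j + k : ℤ) : ℝ) * (γ - ((d : ℝ) - 1)))
    with hM₁
  set M₂ : ℝ := if j + k ≤ 0 then 1 else (2 : ℝ) ^ (((j + k : ℤ) : ℝ) * (-((d : ℝ) - 1))) with hM₂
  set Λ : ℝ := (2 : ℝ) ^ (k : ℝ) with hΛ
  have hΛ0 : 0 < Λ := by positivity
  have hM₁0 : 0 ≤ M₁ := by rw [hM₁]; split_ifs <;> positivity
  have hM₂0 : 0 ≤ M₂ := by rw [hM₂]; split_ifs <;> positivity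
  have hmem : ∀ x ∈ annulus d j, Λ * ‖x‖ ∈ Set.Icc ((2 : ℝ) ^ (((j + k : ℤ) : ℝ)))
      (2 * (2 : ℝ) ^ (((j + k : ℤ) : ℝ))) := by
    intro x hx
    have e1 : (2 : ℝ) ^ (((j + k : ℤ) : ℝ)) = Λ * (2 : ℝ) ^ (j : ℝ) := by
      push_cast; rw [Real.rpow_add (by norm_num), mul_comm]
    have e2 : 2 * (2 : ℝ) ^ (((j + k : ℤ) : ℝ)) = Λ * (2 : ℝ) ^ ((j : ℝ) + 1) := by
      rw [e1, Real.rpow_add (by norm_num), Real.rpow_one]; ring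
    rw [e2, e1]
    exact ⟨by gcongr; exact hx.1, by gcongr; exact hx.2.le⟩
  have hW : Measurable (Function.uncurry fun t (x : Ed d) =>
      ‖unitWave i a h (Λ ^ a * t) (Λ * ‖x‖)‖ₑ) := by
    have hc : Continuous fun p : ℝ × Ed d => unitWave i a h (Λ ^ a * p.1) (Λ * ‖p.2‖) :=
      (continuous_unitWave i a hh).comp (Continuous.prodMk
        (continuous_const.mul continuous_fst) (continuous_const.mul continuous_snd.norm))
    exact hc.enorm.measurable
  have hct : ∀ z, Measurable fun t => ‖unitWave i a h t z‖ₑ ^ 2 := fun z =>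
      ((ENNReal.continuous_pow 2).comp (continuous_enorm.comp
        ((continuous_unitWave i a hh).comp
          (Continuous.prodMk continuous_id continuous_const)))).measurable
  have hΛa : 0 < Λ ^ a := by positivity
  refine (lintegral_rpow_lintegral_le (μ := (volume : Measure (Ed d))) hW
    (measurableSet_annulus d j) (S := fun t => S (Λ ^ a * t)) (hSm.comp (by fun_prop))
    (fun t x hx => hSb _ _ (hmem x hx))
    (K := ENNReal.ofReal (Λ ^ a)⁻¹ * (C * ENNReal.ofReal M₂ * N)) (fun x hx => ?_)
    hθ0 hθ1).trans ?_
  · rw [lintegral_comp_mul_left_pos hΛa (hct _)]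
    gcongr
    exact hK _ (hmem x hx)
  · rw [lintegral_comp_mul_left_pos hΛa hSm]
    have hsplit : ∀ X : ℝ≥0∞, X ^ (1 - θ) * X ^ θ = X := fun X => by
      rw [← ENNReal.rpow_add_of_nonneg _ _ (by linarith) hθ0.le, sub_add_cancel, ENNReal.rpow_one]
    have hreal := annulus_weight_le (d := d) ha had j k (γ := γ)
    rw [← hM₁, ← hM₂, ← hΛ, ← hθ, ← hδ] at hreal
    calc (ENNReal.ofReal (Λ ^ a)⁻¹ * ∫⁻ t, S t) ^ (1 - θ) *
          (volume (annulus d j) * (ENNReal.ofReal (Λ ^ a)⁻¹ * (C * ENNReal.ofReal M₂ * N))) ^ θ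
        ≤ (ENNReal.ofReal (Λ ^ a)⁻¹ * (C * ENNReal.ofReal M₁ * N)) ^ (1 - θ) *
          ((ENNReal.ofReal ((2 : ℝ) ^ (((j : ℝ) + 1) * d)) * B) *
            (ENNReal.ofReal (Λ ^ a)⁻¹ * (C * ENNReal.ofReal M₂ * N))) ^ θ := by
          gcongr
          exact volume_annulus_le d j
      _ = (ENNReal.ofReal (Λ ^ a)⁻¹ ^ (1 - θ) * ENNReal.ofReal (Λ ^ a)⁻¹ ^ θ) *
          (C ^ (1 - θ) * C ^ θ) * (N ^ (1 - θ) * N ^ θ) * B ^ θ *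
          (ENNReal.ofReal M₁ ^ (1 - θ) * ENNReal.ofReal M₂ ^ θ *
            ENNReal.ofReal ((2 : ℝ) ^ (((j : ℝ) + 1) * d)) ^ θ) := by
          have h1θ : 0 ≤ 1 - θ := by linarith
          simp only [ENNReal.mul_rpow_of_nonneg _ _ hθ0.le, ENNReal.mul_rpow_of_nonneg _ _ h1θ]
          ring
      _ = C * N * B ^ θ * ENNReal.ofReal ((Λ ^ a)⁻¹ * M₁ ^ (1 - θ) * M₂ ^ θ *
            ((2 : ℝ) ^ (((j : ℝ) + 1) * d)) ^ θ) := by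
          rw [hsplit, hsplit, hsplit, ENNReal.ofReal_rpow_of_nonneg hM₁0 (by linarith),
            ENNReal.ofReal_rpow_of_nonneg hM₂0 hθ0.le,
            ENNReal.ofReal_rpow_of_nonneg (by positivity) hθ0.le,
            ENNReal.ofReal_mul (by positivity), ENNReal.ofReal_mul (by positivity),
            ENNReal.ofReal_mul (by positivity)]
          ring
      _ ≤ C * N * B ^ θ * ENNReal.ofReal ((2 : ℝ) ^ (d * θ) *
          ((2 : ℝ) ^ (-(d * k : ℝ)) * (2 : ℝ) ^ (-(δ * |((j + k : ℤ) : ℝ)|)))) := by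
          gcongr
      _ = _ := by
          rw [ENNReal.ofReal_mul (by positivity)]
          ring

theorem tsum_rpow_le {ι : Type*} (f : ι → ℝ≥0∞) {θ : ℝ} (hθ0 : 0 < θ) (hθ1 : θ ≤ 1) :
    (∑' i, f i) ^ θ ≤ ∑' i, f i ^ θ := by
  have h1 : Filter.Tendsto (fun s : Finset ι => (∑ i ∈ s, f i) ^ θ) Filter.atTop
      (nhds ((∑' i, f i) ^ θ)) :=
    (ENNReal.continuous_rpow_const.tendsto _).comp ENNReal.summable.hasSum
  refine le_of_tendsto' h1 fun s => ?_
  refine le_trans ?_ (ENNReal.sum_le_tsum s)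
  classical
  induction s using Finset.induction_on with
  | empty => simp [hθ0]
  | insert i s hi ih =>
    rw [Finset.sum_insert hi, Finset.sum_insert hi]
    exact (ENNReal.rpow_add_le_add_rpow _ _ hθ0.le hθ1).trans (by gcongr)

theorem sq_tsum_mul_le {ι : Type*} [Countable ι] (f g : ι → ℝ≥0∞) :
    (∑' i, f i * g i) ^ 2 ≤ (∑' i, f i ^ 2) * ∑' i, g i ^ 2 := by
  let _ : MeasurableSpace ι := ⊤
  have hc := ENNReal.lintegral_mul_le_Lp_mul_Lq (Measure.count : Measure ι)
    (Real.HolderConjugate.two_two) (f := f) (g := g) (measurable_from_top.aemeasurable)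
    (measurable_from_top.aemeasurable)
  simp only [lintegral_count, Pi.mul_apply] at hc
  calc _ ≤ ((∑' i, f i ^ (2 : ℝ)) ^ (1 / 2 : ℝ) * (∑' i, g i ^ (2 : ℝ)) ^ (1 / 2 : ℝ)) ^ 2 := by
        gcongr
    _ = _ := by
        rw [mul_pow, ← ENNReal.rpow_natCast, ← ENNReal.rpow_natCast, ← ENNReal.rpow_mul,
          ← ENNReal.rpow_mul]
        norm_num

theorem lintegral_tsum_rpow_le {X : Type*} [MeasurableSpace X] {μ : Measure X} {p : ℝ}
    (hp : 1 ≤ p) {f : ℤ → X → ℝ≥0∞} (hf : ∀ k, Measurable (f k)) :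
    (∫⁻ x, (∑' k, f k x) ^ p ∂μ) ^ (1 / p) ≤ ∑' k, (∫⁻ x, f k x ^ p ∂μ) ^ (1 / p) := by
  have hp0 : 0 < p := by linarith
  suffices H : ∀ g : ℕ → X → ℝ≥0∞, (∀ k, Measurable (g k)) →
      (∫⁻ x, (∑' k, g k x) ^ p ∂μ) ^ (1 / p) ≤ ∑' k, (∫⁻ x, g k x ^ p ∂μ) ^ (1 / p) by
    have e := (Denumerable.eqv ℤ).symm
    have := H (fun n => f (e n)) fun n => hf _
    rw [e.tsum_eq (fun k => (∫⁻ x, f k x ^ p ∂μ) ^ (1 / p))] at this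
    have hx : ∀ x, ∑' n, f (e n) x = ∑' k, f k x := fun x => e.tsum_eq fun k => f k x
    simpa only [hx] using this
  intro g hg
  have hfin : ∀ n, (∫⁻ x, (∑ k ∈ Finset.range n, g k x) ^ p ∂μ) ^ (1 / p)
      ≤ ∑ k ∈ Finset.range n, (∫⁻ x, g k x ^ p ∂μ) ^ (1 / p) := by
    intro n
    induction n with
    | zero => simp [hp0]
    | succ n ih =>
      simp only [Finset.sum_range_succ]
      refine (ENNReal.lintegral_Lp_add_le (f := fun x => ∑ k ∈ Finset.range n, g k x) (g := g n)
        (Finset.measurable_sum _ fun k _ => hg k).aemeasurable (hg n).aemeasurable hp).trans ?_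
      gcongr
  have hsup : ∀ x, (∑' k, g k x) ^ p = ⨆ n, (∑ k ∈ Finset.range n, g k x) ^ p := by
    intro x
    rw [ENNReal.tsum_eq_iSup_nat]
    exact (ENNReal.orderIsoRpow p hp0).map_iSup _
  simp only [hsup]
  rw [lintegral_iSup (fun n => (Finset.measurable_sum _ fun k _ => hg k).pow_const _)]
  · refine le_trans (le_of_eq ((ENNReal.orderIsoRpow (1 / p) (by positivity)).map_iSup _)) ?_
    exact iSup_le fun n => (hfin n).trans (ENNReal.sum_le_tsum _)
  · intro n m hnm x
    dsimp only
    gcongr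

theorem tsum_two_rpow_ne_top {c : ℝ} (hc : 0 < c) :
    ∑' m : ℤ, ENNReal.ofReal ((2 : ℝ) ^ (-(c * |(m : ℝ)|))) ≠ ⊤ := by
  have hr : (2 : ℝ) ^ (-c) < 1 := Real.rpow_lt_one_of_one_lt_of_neg (by norm_num) (by linarith)
  have hg := summable_geometric_of_lt_one (by positivity) hr
  have hs : Summable fun m : ℤ => (2 : ℝ) ^ (-(c * |(m : ℝ)|)) := by
    refine Summable.of_nat_of_neg ?_ ?_ <;>
    · refine hg.congr fun n => ?_
      simp only [Int.cast_neg, abs_neg, Int.cast_natCast, Nat.abs_cast]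
      rw [← Real.rpow_natCast, ← Real.rpow_mul (by norm_num)]
      congr 1
      ring
  exact hs.tsum_ofReal_ne_top

/-- Summation of almost orthogonal contributions. -/
theorem exists_almost_orthogonal_bound {δ : ℝ} (hδ : 0 < δ) :
    ∃ K : ℝ≥0∞, K ≠ ⊤ ∧ ∀ (N : ℤ → ℤ → ℝ → ℝ≥0∞) (E : ℤ → ℝ≥0∞), (∀ j k, Measurable (N j k)) →
      (∀ j k, ∫⁻ t, N j k t ^ 2 ≤
        ENNReal.ofReal ((2 : ℝ) ^ (-(δ * |((j + k : ℤ) : ℝ)|))) * E k) →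
      ∫⁻ t, ∑' j, (∑' k, N j k t) ^ 2 ≤ K * ∑' k, E k := by
  set v : ℤ → ℝ := fun m => (2 : ℝ) ^ (-(δ / 2 * |(m : ℝ)|)) with hv
  set W : ℝ≥0∞ := ∑' m, ENNReal.ofReal (v m) with hW
  have hWt : W ≠ ⊤ := tsum_two_rpow_ne_top (by linarith)
  set u : ℤ → ℝ≥0∞ := fun m => ENNReal.ofReal ((2 : ℝ) ^ (-(δ / 4 * |(m : ℝ)|))) with hu
  set u' : ℤ → ℝ≥0∞ := fun m => ENNReal.ofReal ((2 : ℝ) ^ (δ / 4 * |(m : ℝ)|)) with hu'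
  have huu : ∀ m, u m * u' m = 1 := fun m => by
    rw [hu, hu']
    simp only
    rw [← ENNReal.ofReal_mul (by positivity), ← Real.rpow_add (by norm_num), neg_add_cancel,
      Real.rpow_zero, ENNReal.ofReal_one]
  have hu2 : ∀ m, u m ^ 2 = ENNReal.ofReal (v m) := fun m => by
    rw [hu, hv]
    simp only
    rw [← ENNReal.ofReal_pow (by positivity), ← Real.rpow_natCast, ← Real.rpow_mul (by norm_num)]
    congr 2
    push_cast
    ring
  have hu3 : ∀ m : ℤ, u' m ^ 2 * ENNReal.ofReal ((2 : ℝ) ^ (-(δ * |(m : ℝ)|)))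
      = ENNReal.ofReal (v m) := fun m => by
    rw [hu', hv]
    simp only
    rw [← ENNReal.ofReal_pow (by positivity), ← ENNReal.ofReal_mul (by positivity),
      ← Real.rpow_natCast, ← Real.rpow_mul (by norm_num), ← Real.rpow_add (by norm_num)]
    congr 2
    push_cast
    ring
  refine ⟨W * W, ENNReal.mul_ne_top hWt hWt, fun N E hN hE => ?_⟩
  have hshift : ∀ j : ℤ, ∑' k : ℤ, ENNReal.ofReal (v (j + k)) = W := fun j =>
    (Equiv.addLeft j).tsum_eq fun m => ENNReal.ofReal (v m)
  have hshift' : ∀ k : ℤ, ∑' j : ℤ, ENNReal.ofReal (v (j + k)) = W := fun k =>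
    (Equiv.addRight k).tsum_eq fun m => ENNReal.ofReal (v m)
  have hpt : ∀ j t, (∑' k, N j k t) ^ 2 ≤ W * ∑' k, u' (j + k) ^ 2 * N j k t ^ 2 := by
    intro j t
    calc (∑' k, N j k t) ^ 2 = (∑' k, u (j + k) * (u' (j + k) * N j k t)) ^ 2 := by
          simp only [← mul_assoc, huu, one_mul]
      _ ≤ _ := sq_tsum_mul_le _ _
      _ = _ := by simp only [hu2, hshift, mul_pow]
  calc ∫⁻ t, ∑' j, (∑' k, N j k t) ^ 2
      ≤ ∫⁻ t, ∑' j, W * ∑' k, u' (j + k) ^ 2 * N j k t ^ 2 :=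
        lintegral_mono fun t => ENNReal.tsum_le_tsum fun j => hpt j t
    _ = ∑' j, W * ∑' k, u' (j + k) ^ 2 * ∫⁻ t, N j k t ^ 2 := by
        rw [lintegral_tsum fun j => (Measurable.const_mul (Measurable.tsum fun k =>
          ((hN j k).pow_const 2).const_mul _) _).aemeasurable]
        refine tsum_congr fun j => ?_
        rw [lintegral_const_mul _ (Measurable.tsum fun k =>
          ((hN j k).pow_const 2).const_mul _), lintegral_tsum fun k =>
          (((hN j k).pow_const 2).const_mul _).aemeasurable]
        congr 1
        exact tsum_congr fun k => lintegral_const_mul _ ((hN j k).pow_const 2)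
    _ ≤ ∑' j, W * ∑' k, ENNReal.ofReal (v (j + k)) * E k := by
        refine ENNReal.tsum_le_tsum fun j => ?_
        refine mul_le_mul' le_rfl (ENNReal.tsum_le_tsum fun k => ?_)
        rw [← hu3, mul_assoc]
        gcongr
        exact hE j k
    _ = _ := by
        rw [ENNReal.tsum_mul_left, ENNReal.tsum_comm, mul_assoc]
        congr 1
        rw [← ENNReal.tsum_mul_left]
        refine tsum_congr fun k => ?_
        rw [ENNReal.tsum_mul_right, hshift']

/-- The dyadic interval `[2 ^ k, 2 ^ (k + 1))`. -/
def dyadic (k : ℤ) : Set ℝ := Set.Ico ((2 : ℝ) ^ (k : ℝ)) ((2 : ℝ) ^ ((k : ℝ) + 1))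

theorem dyadic_eq_zpow (k : ℤ) : dyadic k = Set.Ico ((2 : ℝ) ^ k) ((2 : ℝ) ^ (k + 1)) := by
  rw [dyadic, ← Real.rpow_intCast, ← Real.rpow_intCast]
  push_cast
  rfl

theorem iUnion_dyadic : ⋃ k, dyadic k = Set.Ioi 0 := by
  ext x
  simp only [Set.mem_iUnion, dyadic_eq_zpow, Set.mem_Ioi]
  constructor
  · rintro ⟨k, hk⟩
    exact lt_of_lt_of_le (by positivity) hk.1
  · exact fun hx => exists_mem_Ico_zpow hx (by norm_num)

theorem pairwise_disjoint_dyadic : Pairwise (Function.onFun Disjoint dyadic) := by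
  intro k l hkl
  refine Set.disjoint_left.2 fun x hk hl => ?_
  rw [dyadic_eq_zpow] at hk hl
  have h1 : (k : ℤ) < l + 1 := (zpow_lt_zpow_iff_right₀ (by norm_num : (1 : ℝ) < 2)).1
    (hk.1.trans_lt hl.2)
  have h2 : (l : ℤ) < k + 1 := (zpow_lt_zpow_iff_right₀ (by norm_num : (1 : ℝ) < 2)).1
    (hl.1.trans_lt hk.2)
  omega

theorem measurableSet_dyadic (k : ℤ) : MeasurableSet (dyadic k) := measurableSet_Ico

theorem lintegral_le_tsum_annulus {d : ℕ} (hd : 0 < d) (f : Ed d → ℝ≥0∞) :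
    ∫⁻ x, f x ≤ ∑' j, ∫⁻ x in annulus d j, f x := by
  have : Nonempty (Fin d) := ⟨⟨0, hd⟩⟩
  have h0 : ({0}ᶜ : Set (Ed d)) ⊆ ⋃ j, annulus d j := fun x hx => by
    have hx0 : ‖x‖ ∈ ⋃ k, dyadic k := by rw [iUnion_dyadic]; exact norm_pos_iff.2 hx
    obtain ⟨k, hk⟩ := Set.mem_iUnion.1 hx0
    exact Set.mem_iUnion.2 ⟨k, hk⟩
  calc ∫⁻ x, f x = ∫⁻ x in ({0}ᶜ : Set (Ed d)), f x := by
        rw [Measure.restrict_eq_self_of_ae_mem]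
        exact (measure_eq_zero_iff_ae_notMem).1 (measure_singleton _)
    _ ≤ ∫⁻ x in ⋃ j, annulus d j, f x := lintegral_mono_set h0
    _ ≤ _ := lintegral_iUnion_le _ _

/-- Radial profile of the evolution with radial frequency profile `G`. -/
def radWave {d : ℕ} (i : Fin d) (a : ℝ) (G : ℝ → ℂ) (t ρ : ℝ) : ℂ :=
  ∫ x in Set.Ioi (0 : ℝ), cexp (I * ((-(t * x ^ a) : ℝ) : ℂ)) *
    (sphJ i (ρ * x) * (G x * (x : ℂ) ^ (d - 1)))

/-- The part of the frequency profile `G` at scale `Λ`, rescaled to `[1, 2]`. -/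
def piece (d : ℕ) (G : ℝ → ℂ) (Λ x : ℝ) : ℂ := G (Λ * x) * ((Λ * x : ℝ) : ℂ) ^ (d - 1)

theorem two_rpow_add_one (k : ℤ) : (2 : ℝ) ^ ((k : ℝ) + 1) = (2 : ℝ) ^ (k : ℝ) * 2 := by
  rw [Real.rpow_add (by norm_num), Real.rpow_one]

theorem setIntegral_dyadic_eq (f : ℝ → ℂ) (k : ℤ) :
    ∫ x in dyadic k, f x = ((2 : ℝ) ^ (k : ℝ) : ℝ) *
      ∫ x in Set.Icc (1 : ℝ) 2, f ((2 : ℝ) ^ (k : ℝ) * x) := by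
  have h0 : (0 : ℝ) < (2 : ℝ) ^ (k : ℝ) := by positivity
  rw [integral_Icc_eq_integral_Ioc, ← intervalIntegral.integral_of_le (by norm_num),
    ← Complex.real_smul, intervalIntegral.smul_integral_comp_mul_left, dyadic, two_rpow_add_one,
    mul_one, intervalIntegral.integral_of_le (by linarith)]
  exact setIntegral_congr_set Ico_ae_eq_Ioc

theorem setLIntegral_comp_mul_dyadic {f : ℝ → ℝ≥0∞} (hf : Measurable f) (k : ℤ) :
    ∫⁻ x in Set.Icc (1 : ℝ) 2, f ((2 : ℝ) ^ (k : ℝ) * x) =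
      ENNReal.ofReal ((2 : ℝ) ^ (k : ℝ))⁻¹ * ∫⁻ x in dyadic k, f x := by
  have h0 : (0 : ℝ) < (2 : ℝ) ^ (k : ℝ) := by positivity
  rw [← Measure.restrict_congr_set (Ico_ae_eq_Icc (μ := volume) (a := (1 : ℝ)) (b := 2)),
    ← lintegral_indicator measurableSet_Ico, ← lintegral_indicator (measurableSet_dyadic k),
    ← lintegral_comp_mul_left_pos h0 (hf.indicator (measurableSet_dyadic k))]
  refine lintegral_congr fun x => ?_
  have : x ∈ Set.Ico (1 : ℝ) 2 ↔ (2 : ℝ) ^ (k : ℝ) * x ∈ dyadic k := by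
    rw [dyadic, two_rpow_add_one, Set.mem_Ico, Set.mem_Ico, mul_lt_mul_iff_right₀ h0,
      le_mul_iff_one_le_right h0]
  by_cases hx : x ∈ Set.Ico (1 : ℝ) 2
  · rw [Set.indicator_of_mem hx, Set.indicator_of_mem (this.1 hx)]
  · rw [Set.indicator_of_notMem hx, Set.indicator_of_notMem fun h => hx (this.2 h)]

theorem enorm_radWave_le {d : ℕ} (i : Fin d) (a : ℝ) {G : ℝ → ℂ}
    (hGi : IntegrableOn (fun x => G x * (x : ℂ) ^ (d - 1)) (Set.Ioi 0)) (t ρ : ℝ) :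
    ‖radWave i a G t ρ‖ₑ ≤ ∑' k : ℤ, ENNReal.ofReal ((2 : ℝ) ^ (k : ℝ)) *
      ‖unitWave i a (piece d G ((2 : ℝ) ^ (k : ℝ))) (((2 : ℝ) ^ (k : ℝ)) ^ a * t)
        ((2 : ℝ) ^ (k : ℝ) * ρ)‖ₑ := by
  obtain ⟨M, -, hM, -, -, -, hJ, -⟩ := exists_sphJ_asymptotics i
  have hJc := continuous_sphJ i
  have hintg : IntegrableOn (fun x => cexp (I * ((-(t * x ^ a) : ℝ) : ℂ)) *
    (sphJ i (ρ * x) * (G x * (x : ℂ) ^ (d - 1)))) (⋃ k, dyadic k) := by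
    rw [iUnion_dyadic]
    exact Integrable.bdd_mul (Integrable.bdd_mul hGi
      (Measurable.aestronglyMeasurable (by fun_prop)) (c := M) (ae_of_all _ fun x => by
        rw [Complex.norm_real]; exact hJ _)) (Measurable.aestronglyMeasurable (by fun_prop))
        (c := 1) (ae_of_all _ fun x => (norm_cexp_I_mul _).le)
  have hsum := hasSum_integral_iUnion measurableSet_dyadic pairwise_disjoint_dyadic hintg
  rw [radWave, ← iUnion_dyadic, ← hsum.tsum_eq]
  refine (enorm_tsum_le_tsum_enorm).trans (ENNReal.tsum_le_tsum fun k => ?_)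
  have h0 : (0 : ℝ) < (2 : ℝ) ^ (k : ℝ) := by positivity
  rw [setIntegral_dyadic_eq, enorm_mul, ← ofReal_norm, Complex.norm_real,
    Real.norm_of_nonneg h0.le, unitWave]
  refine le_of_eq ?_
  congr 2
  refine setIntegral_congr_fun measurableSet_Icc fun x hx => ?_
  simp only [piece]
  rw [Real.mul_rpow h0.le (by linarith [hx.1]), show t * (((2 : ℝ) ^ (k : ℝ)) ^ a * x ^ a)
    = ((2 : ℝ) ^ (k : ℝ)) ^ a * t * x ^ a by ring, show ρ * ((2 : ℝ) ^ (k : ℝ) * x)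
    = (2 : ℝ) ^ (k : ℝ) * ρ * x by ring]

theorem setLIntegral_piece_le {d : ℕ} {G : ℝ → ℂ} (hG : Continuous G) (k : ℤ) :
    ∫⁻ x in Set.Icc (1 : ℝ) 2, ‖piece d G ((2 : ℝ) ^ (k : ℝ)) x‖ₑ ^ 2 ≤
      ENNReal.ofReal ((2 : ℝ) ^ (k : ℝ))⁻¹ * (ENNReal.ofReal (((2 : ℝ) ^ (k : ℝ) * 2) ^ (d - 1)) *
        ∫⁻ x in dyadic k, ‖G x‖ₑ ^ 2 * ENNReal.ofReal (x ^ (d - 1))) := by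
  have hm : Measurable fun x : ℝ => ‖G x * (x : ℂ) ^ (d - 1)‖ₑ ^ 2 := by fun_prop
  refine (setLIntegral_comp_mul_dyadic hm k).le.trans ?_
  gcongr
  rw [← lintegral_const_mul' _ _ ENNReal.ofReal_ne_top]
  refine setLIntegral_mono' (measurableSet_dyadic k) fun x hx => ?_
  have hx0 : 0 < x := lt_of_lt_of_le (by positivity) hx.1
  rw [enorm_mul, mul_pow, ← ofReal_norm ((x : ℂ) ^ (d - 1)), norm_pow, Complex.norm_real,
    Real.norm_of_nonneg hx0.le, pow_two (ENNReal.ofReal _)]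
  calc _ = ENNReal.ofReal (x ^ (d - 1)) * (‖G x‖ₑ ^ 2 * ENNReal.ofReal (x ^ (d - 1))) := by ring
    _ ≤ _ := by
      gcongr
      rw [← two_rpow_add_one]
      exact hx.2.le

/-- Endpoint estimate for the radial profile. -/
theorem exists_endpoint_radWave {d : ℕ} (i : Fin d) {a γ : ℝ} (ha : 1 < a) (ha2 : a < 2)
    (had : a < d) (hγ : 1 / 2 < γ) (hγ1 : γ ≤ 1) (hγa : γ < d - d / a) :
    ∃ C : ℝ≥0∞, C ≠ ⊤ ∧ ∀ G : ℝ → ℂ, Continuous G →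
      IntegrableOn (fun x => G x * (x : ℂ) ^ (d - 1)) (Set.Ioi 0) →
      ∫⁻ t, (∫⁻ x : Ed d, ‖radWave i a G t ‖x‖‖ₑ ^ (2 / (1 - a / d))) ^ (1 - a / d)
      ≤ C * ∫⁻ x in Set.Ioi (0 : ℝ), ‖G x‖ₑ ^ 2 * ENNReal.ofReal (x ^ (d - 1)) := by
  obtain ⟨C, δ, hC, hδ, hann⟩ := exists_annulus_bound i ha ha2 had hγ hγ1 hγa
  obtain ⟨K, hK, hsum⟩ := exists_almost_orthogonal_bound hδ
  have hd : (0 : ℝ) < d := by linarith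
  set θ : ℝ := 1 - a / d with hθ
  have hθ0 : 0 < θ := by rw [hθ, sub_pos, div_lt_one hd]; exact had
  have hθ1 : θ < 1 := by rw [hθ]; linarith [div_pos (by linarith : 0 < a) hd]
  have hp1 : 1 ≤ 2 / θ := by rw [le_div_iff₀ hθ0]; linarith
  refine ⟨K * (C * 2 ^ (d - 1)), ENNReal.mul_ne_top hK (ENNReal.mul_ne_top hC (by simp)),
    fun G hG hGi => ?_⟩
  have hpc : ∀ Λ : ℝ, Continuous (piece d G Λ) := fun Λ => by unfold piece; fun_prop
  have hpi : ∀ Λ : ℝ, IntegrableOn (piece d G Λ) (Set.Icc 1 2) := fun Λ =>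
    (hpc Λ).continuousOn.integrableOn_Icc
  set U : ℤ → ℝ → Ed d → ℝ≥0∞ := fun k t x => ENNReal.ofReal ((2 : ℝ) ^ (k : ℝ)) *
      ‖unitWave i a (piece d G ((2 : ℝ) ^ (k : ℝ))) (((2 : ℝ) ^ (k : ℝ)) ^ a * t)
        ((2 : ℝ) ^ (k : ℝ) * ‖x‖)‖ₑ with hU
  have hUm : ∀ k, Measurable (Function.uncurry (U k)) := fun k => by
    have hc : Continuous fun p : ℝ × Ed d => unitWave i a (piece d G ((2 : ℝ) ^ (k : ℝ)))
        (((2 : ℝ) ^ (k : ℝ)) ^ a * p.1) ((2 : ℝ) ^ (k : ℝ) * ‖p.2‖) :=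
      (continuous_unitWave i a (hpi _)).comp (Continuous.prodMk
        (continuous_const.mul continuous_fst) (continuous_const.mul continuous_snd.norm))
    exact hc.enorm.measurable.const_mul _
  set N : ℤ → ℤ → ℝ → ℝ≥0∞ := fun j k t =>
    (∫⁻ x in annulus d j, U k t x ^ (2 / θ)) ^ (1 / (2 / θ)) with hN
  have hNm : ∀ j k, Measurable (N j k) := fun j k =>
    (((hUm k).pow_const _).lintegral_prod_right').pow_const _
  set e : ℤ → ℝ≥0∞ := fun k => ∫⁻ x in dyadic k, ‖G x‖ₑ ^ 2 * ENNReal.ofReal (x ^ (d - 1)) with he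
  have hetsum : ∑' k, e k = ∫⁻ x in Set.Ioi (0 : ℝ), ‖G x‖ₑ ^ 2 * ENNReal.ofReal (x ^ (d - 1)) := by
    rw [← iUnion_dyadic, lintegral_iUnion measurableSet_dyadic pairwise_disjoint_dyadic]
  have hpow : ∀ X : ℝ≥0∞, (X ^ (1 / (2 / θ))) ^ 2 = X ^ θ := fun X => by
    rw [← ENNReal.rpow_natCast, ← ENNReal.rpow_mul]
    congr 1
    push_cast
    field_simp
  have hNE : ∀ j k, ∫⁻ t, N j k t ^ 2 ≤
      ENNReal.ofReal ((2 : ℝ) ^ (-(δ * |((j + k : ℤ) : ℝ)|))) * (C * 2 ^ (d - 1) * e k) := by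
    intro j k
    have h1 : ∀ t, N j k t ^ 2 = ENNReal.ofReal ((2 : ℝ) ^ (k : ℝ)) ^ 2 * (∫⁻ x in annulus d j,
        ‖unitWave i a (piece d G ((2 : ℝ) ^ (k : ℝ))) (((2 : ℝ) ^ (k : ℝ)) ^ a * t)
        ((2 : ℝ) ^ (k : ℝ) * ‖x‖)‖ₑ ^ (2 / θ)) ^ θ := by
      intro t
      rw [hN]
      simp only
      rw [hpow, hU]
      simp only [ENNReal.mul_rpow_of_nonneg _ _ (by linarith : (0 : ℝ) ≤ 2 / θ)]
      rw [lintegral_const_mul' _ _ (ENNReal.rpow_ne_top_of_nonneg (by linarith)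
        ENNReal.ofReal_ne_top), ENNReal.mul_rpow_of_nonneg _ _ hθ0.le, ← ENNReal.rpow_mul,
        div_mul_cancel₀ _ hθ0.ne', ← ENNReal.rpow_natCast]
      norm_num
    simp only [h1]
    rw [lintegral_const_mul' _ _ (by simp)]
    refine (mul_le_mul' le_rfl ((hann _ (hpi _) j k).trans
      (mul_le_mul' le_rfl (setLIntegral_piece_le hG k)))).trans (le_of_eq ?_)
    set w : ℝ := (2 : ℝ) ^ (-(δ * |((j + k : ℤ) : ℝ)|)) with hw
    have hw0 : 0 ≤ w := by positivity
    set Λ : ℝ := (2 : ℝ) ^ (k : ℝ) with hΛ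
    have hΛ0 : 0 < Λ := by positivity
    have h2 : (2 : ℝ≥0∞) = ENNReal.ofReal 2 := by simp
    have h3 : (2 : ℝ) ^ (-(d * k : ℝ)) = (Λ ^ d)⁻¹ := by
      rw [Real.rpow_neg (by norm_num), mul_comm, Real.rpow_mul (by norm_num), Real.rpow_natCast]
    rw [h3]
    have h4 : ENNReal.ofReal Λ ^ 2 * ENNReal.ofReal ((Λ ^ d)⁻¹ * w) * (ENNReal.ofReal Λ⁻¹ *
        ENNReal.ofReal ((Λ * 2) ^ (d - 1))) = ENNReal.ofReal w * 2 ^ (d - 1) := by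
      rw [h2, ← ENNReal.ofReal_pow hΛ0.le, ← ENNReal.ofReal_pow (by norm_num),
        ← ENNReal.ofReal_mul (by positivity), ← ENNReal.ofReal_mul (by positivity),
        ← ENNReal.ofReal_mul (by positivity), ← ENNReal.ofReal_mul (by positivity)]
      congr 1
      have hd1 : Λ ^ d = Λ ^ (d - 1) * Λ := by
        rw [← pow_succ, Nat.sub_add_cancel i.pos]
      rw [hd1, mul_pow]
      field_simp
    calc _ = (ENNReal.ofReal Λ ^ 2 * ENNReal.ofReal ((Λ ^ d)⁻¹ * w) * (ENNReal.ofReal Λ⁻¹ *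
        ENNReal.ofReal ((Λ * 2) ^ (d - 1)))) * (C * e k) := by ring
      _ = _ := by rw [h4]; ring
  have hmain := hsum N _ hNm hNE
  rw [ENNReal.tsum_mul_left, hetsum, ← mul_assoc] at hmain
  refine le_trans (lintegral_mono fun t => ?_) hmain
  calc (∫⁻ x : Ed d, ‖radWave i a G t ‖x‖‖ₑ ^ (2 / θ)) ^ θ
      ≤ (∑' j, ∫⁻ x in annulus d j, ‖radWave i a G t ‖x‖‖ₑ ^ (2 / θ)) ^ θ := by
        gcongr
        exact lintegral_le_tsum_annulus i.pos _
    _ ≤ ∑' j, (∫⁻ x in annulus d j, ‖radWave i a G t ‖x‖‖ₑ ^ (2 / θ)) ^ θ :=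
        tsum_rpow_le _ hθ0 hθ1.le
    _ ≤ ∑' j, (∑' k, N j k t) ^ 2 := by
        refine ENNReal.tsum_le_tsum fun j => ?_
        rw [← hpow]
        gcongr
        have hUt : ∀ k, Measurable (U k t) := fun k => (hUm k).of_uncurry_left
        refine le_trans (ENNReal.rpow_le_rpow (lintegral_mono fun x => ?_) (by positivity))
          (lintegral_tsum_rpow_le hp1 hUt)
        exact ENNReal.rpow_le_rpow (enorm_radWave_le i a hGi t ‖x‖) (by linarith)

/-- Integration in polar coordinates. -/
theorem integral_eq_integral_toSphere {d : ℕ} [Nonempty (Fin d)] {f : Ed d → ℂ}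
    (hf : Integrable f) :
    ∫ x, f x = ∫ y in Set.Ioi (0 : ℝ), (y : ℂ) ^ (d - 1) *
      ∫ ω : Metric.sphere (0 : Ed d) 1, f (y • (ω : Ed d)) ∂(volume : Measure (Ed d)).toSphere := by
  have hmp := (volume : Measure (Ed d)).measurePreserving_homeomorphUnitSphereProd
  set g : Metric.sphere (0 : Ed d) 1 × Set.Ioi (0 : ℝ) → ℂ :=
    fun p => f ((p.2 : ℝ) • (p.1 : Ed d)) with hg
  have hgc : ∀ x : ({(0 : Ed d)}ᶜ : Set (Ed d)), g (homeomorphUnitSphereProd (Ed d) x) = f x := by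
    intro x
    have hx : ‖(x : Ed d)‖ ≠ 0 := norm_ne_zero_iff.2 x.2
    simp [hg, smul_smul, hx]
  have hgi : Integrable g ((volume : Measure (Ed d)).toSphere.prod
      (.volumeIoiPow (Module.finrank ℝ (Ed d) - 1))) := by
    rw [← hmp.integrable_comp_emb (Homeomorph.measurableEmbedding _)]
    have : g ∘ (homeomorphUnitSphereProd (Ed d)) = fun x : ({(0 : Ed d)}ᶜ : Set (Ed d)) => f x := funext hgc
    rw [this]
    have h2 := (integrableOn_iff_comap_subtypeVal (μ := (volume : Measure (Ed d))) (f := f)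
      (s := {(0 : Ed d)}ᶜ) (measurableSet_singleton _).compl).1 hf.integrableOn
    exact h2
  calc ∫ x, f x = ∫ x : ({(0 : Ed d)}ᶜ : Set (Ed d)), f x ∂(volume.comap Subtype.val) := by
        rw [integral_subtype_comap (measurableSet_singleton _).compl fun x => f x,
          restrict_compl_singleton]
    _ = ∫ p, g p ∂((volume : Measure (Ed d)).toSphere.prod
      (.volumeIoiPow (Module.finrank ℝ (Ed d) - 1))) := by
        rw [← hmp.integral_comp (Homeomorph.measurableEmbedding _)]
        simp only [hgc]
    _ = ∫ y : Set.Ioi (0 : ℝ), ∫ ω, g (ω, y) ∂(volume : Measure (Ed d)).toSphere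
          ∂(.volumeIoiPow (Module.finrank ℝ (Ed d) - 1)) := integral_prod_symm _ hgi
    _ = _ := by
        simp only [Measure.volumeIoiPow, ENNReal.ofReal]
        rw [integral_withDensity_eq_integral_smul,
          integral_subtype_comap measurableSet_Ioi fun a : ℝ =>
            Real.toNNReal (a ^ (Module.finrank ℝ (Ed d) - 1)) •
            ∫ ω : Metric.sphere (0 : Ed d) 1, f (a • (ω : Ed d))
              ∂(volume : Measure (Ed d)).toSphere,
          setIntegral_congr_fun measurableSet_Ioi fun x hx => ?_]
        · rw [NNReal.smul_def, Real.coe_toNNReal _ (pow_nonneg hx.out.le _),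
            finrank_euclideanSpace_fin, Complex.real_smul]
          push_cast
          rfl
        · exact (measurable_subtype_coe.pow_const _).real_toNNReal

theorem FT_eq_fourier {d : ℕ} (f : Ed d → ℂ) (ξ : Ed d) :
    FT f ξ = FourierTransform.fourier f ((2 * Real.pi)⁻¹ • ξ) := by
  rw [Real.fourier_eq', FT]
  congr 1
  ext x
  rw [inner_smul_right, smul_eq_mul]
  congr 2
  have : Real.pi ≠ 0 := Real.pi_ne_zero
  push_cast
  field_simp

theorem FT_schwartz_apply {d : ℕ} (u : SchwartzMap (Ed d) ℂ) (ξ : Ed d) :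
    FT u ξ = FourierTransform.fourier u ((2 * Real.pi)⁻¹ • ξ) := by
  rw [FT_eq_fourier, SchwartzMap.fourier_coe]

theorem continuous_FT {d : ℕ} (u : SchwartzMap (Ed d) ℂ) : Continuous (FT u) := by
  rw [funext (FT_schwartz_apply u)]
  exact (SchwartzMap.continuous _).comp (continuous_const_smul _)

theorem integrable_FT {d : ℕ} (u : SchwartzMap (Ed d) ℂ) : Integrable (FT u) := by
  rw [funext (FT_schwartz_apply u)]
  exact (SchwartzMap.integrable (μ := volume) (FourierTransform.fourier u)).comp_smul
    (inv_ne_zero (by positivity))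

theorem lintegral_FT_sq {d : ℕ} (u : SchwartzMap (Ed d) ℂ) :
    ∫⁻ ξ, ‖FT u ξ‖ₑ ^ (2 : ℕ) = ENNReal.ofReal ((2 * Real.pi) ^ d) * ∫⁻ x, ‖u x‖ₑ ^ (2 : ℕ) := by
  have key : ∀ v : SchwartzMap (Ed d) ℂ, ∫⁻ x, ‖v x‖ₑ ^ (2 : ℕ)
      = ENNReal.ofReal (∫ x, ‖v x‖ ^ (2 : ℕ)) := by
    intro v
    rw [ofReal_integral_eq_lintegral_ofReal]
    · congr 1
      ext x
      rw [ENNReal.ofReal_pow (norm_nonneg _), ofReal_norm]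
    · exact (v.memLp 2 volume).integrable_norm_pow (by norm_num)
    · exact ae_of_all _ fun x => by positivity
  rw [key u, ← SchwartzMap.integral_norm_sq_fourier, ← ENNReal.ofReal_mul (by positivity)]
  have h1 : ∫ ξ, ‖FT u ξ‖ ^ (2 : ℕ) = (2 * Real.pi) ^ d *
      ∫ ξ, ‖FourierTransform.fourier u ξ‖ ^ (2 : ℕ) := by
    simp only [FT_schwartz_apply]
    rw [Measure.integral_comp_smul volume
      (fun ξ => ‖FourierTransform.fourier u ξ‖ ^ (2 : ℕ)) (2 * Real.pi)⁻¹]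
    rw [finrank_euclideanSpace_fin, inv_pow, inv_inv, abs_of_pos (by positivity), smul_eq_mul]
  rw [← h1, ofReal_integral_eq_lintegral_ofReal]
  · congr 1
    ext x
    rw [ENNReal.ofReal_pow (norm_nonneg _), ofReal_norm]
  · simp only [FT_schwartz_apply]
    exact (((FourierTransform.fourier u).memLp 2 volume).integrable_norm_pow
      (by norm_num)).comp_smul (inv_ne_zero (by positivity))
  · exact ae_of_all _ fun x => by positivity

theorem norm_cexp_phase (s t : ℝ) {d : ℕ} (ξ : Ed d) :
    ‖cexp (-I * (t : ℂ) * ((‖ξ‖ ^ (2 * s) : ℝ) : ℂ))‖ = 1 := by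
  rw [← norm_cexp_I_mul (-(t * ‖ξ‖ ^ (2 * s)))]
  congr 2
  push_cast
  ring

theorem integrable_phase_mul_FT {d : ℕ} (s t : ℝ) (u : SchwartzMap (Ed d) ℂ) :
    Integrable fun ξ => cexp (-I * (t : ℂ) * ((‖ξ‖ ^ (2 * s) : ℝ) : ℂ)) * FT u ξ := by
  have hm : Measurable fun ξ : Ed d => cexp (-I * (t : ℂ) * ((‖ξ‖ ^ (2 * s) : ℝ) : ℂ)) := by
    fun_prop
  exact (integrable_FT u).bdd_mul hm.aestronglyMeasurable (c := 1)
    (ae_of_all _ fun ξ => (norm_cexp_phase s t ξ).le)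

theorem isRadial_FT {d : ℕ} {f : Ed d → ℂ} (hf : IsRadial f) : IsRadial (FT f) := by
  intro x y h
  set U : Ed d ≃ₗᵢ[ℝ] Ed d := Submodule.reflection (ℝ ∙ (x - y))ᗮ with hU
  have hUx : U x = y := Submodule.reflection_sub h
  rw [FT, FT, ← hUx,
    ← U.measurePreserving.integral_comp U.toHomeomorph.measurableEmbedding
      (fun z => cexp (-I * ((⟪z, U x⟫ : ℝ) : ℂ)) * f z)]
  congr 1
  ext z
  rw [LinearIsometryEquiv.inner_map_map, hf (U z) z (by simp)]

/-- Radial profile of `f` along the `i`-th coordinate axis. -/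
def profile {d : ℕ} (i : Fin d) (f : Ed d → ℂ) (y : ℝ) : ℂ := f (EuclideanSpace.single i y)

theorem eq_profile_of_isRadial {d : ℕ} (i : Fin d) {f : Ed d → ℂ} (hf : IsRadial f) (x : Ed d) :
    f x = profile i f ‖x‖ := hf _ _ (by simp)

theorem continuous_profile {d : ℕ} (i : Fin d) {f : Ed d → ℂ} (hf : Continuous f) :
    Continuous (profile i f) := by
  refine hf.comp ?_
  have : (EuclideanSpace.single i : ℝ → Ed d)
      = fun y => y • EuclideanSpace.single i (1 : ℝ) := by
    ext y j; simp [PiLp.single_apply]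
  rw [this]
  fun_prop

theorem integrableOn_profile {d : ℕ} (i : Fin d) {f : Ed d → ℂ} (hf : IsRadial f)
    (hi : Integrable f) :
    IntegrableOn (fun x : ℝ => profile i f x * (x : ℂ) ^ (d - 1)) (Set.Ioi 0) := by
  have : Nonempty (Fin d) := ⟨i⟩
  have h := (integrable_fun_norm_addHaar (volume : Measure (Ed d)) (f := profile i f)).1
    (by simpa only [← eq_profile_of_isRadial i hf] using hi)
  refine h.congr (ae_of_all _ fun x => ?_)
  simp [mul_comm]

theorem fprop_eq_radWave {d : ℕ} (i : Fin d) (s t : ℝ) {u : SchwartzMap (Ed d) ℂ}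
    (hu : IsRadial u) (x : Ed d) :
    fprop s t u x = (((2 * Real.pi) ^ (-(d : ℝ)) : ℝ) : ℂ) *
      radWave i (2 * s) (profile i (FT u)) t ‖x‖ := by
  have : Nonempty (Fin d) := ⟨i⟩
  have hR := isRadial_FT hu
  rw [fprop, FTinv]
  congr 1
  rw [integral_eq_integral_toSphere]
  · rw [radWave]
    refine setIntegral_congr_fun measurableSet_Ioi fun y hy => ?_
    have hy0 : (0 : ℝ) < y := hy
    have e : ∀ ω : Metric.sphere (0 : Ed d) 1,
        cexp (I * ((⟪x, y • (ω : Ed d)⟫ : ℝ) : ℂ)) *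
          (cexp (-I * (t : ℂ) * ((‖y • (ω : Ed d)‖ ^ (2 * s) : ℝ) : ℂ)) * FT u (y • (ω : Ed d)))
        = cexp (I * ((⟪y • x, (ω : Ed d)⟫ : ℝ) : ℂ)) *
          (cexp (I * ((-(t * y ^ (2 * s)) : ℝ) : ℂ)) * profile i (FT u) y) := by
      intro ω
      have hn : ‖y • (ω : Ed d)‖ = y := by simp [norm_smul, abs_of_pos hy0]
      rw [eq_profile_of_isRadial i hR (y • (ω : Ed d)), hn, real_inner_smul_left, real_inner_smul_right]
      congr 3
      push_cast
      ring
    simp only [e]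
    rw [integral_mul_const, integral_cexp_inner_toSphere, sphCos_eq_sphJ i, norm_smul,
      Real.norm_eq_abs, abs_of_pos hy0, mul_comm y]
    ring
  · have hc : Continuous fun ξ : Ed d => cexp (I * ((⟪x, ξ⟫ : ℝ) : ℂ)) := by fun_prop
    exact (integrable_phase_mul_FT s t u).bdd_mul hc.measurable.aestronglyMeasurable (c := 1)
      (ae_of_all _ fun ξ => (norm_cexp_I_mul _).le)

theorem lintegral_profile_sq {d : ℕ} (i : Fin d) {u : SchwartzMap (Ed d) ℂ} (hu : IsRadial u) :
    ENNReal.ofReal (d * (volume : Measure (Ed d)).real (Metric.ball 0 1)) *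
      ∫⁻ x in Set.Ioi (0 : ℝ), ‖profile i (FT u) x‖ₑ ^ (2 : ℕ) * ENNReal.ofReal (x ^ (d - 1))
      = ∫⁻ ξ, ‖FT u ξ‖ₑ ^ (2 : ℕ) := by
  have : Nonempty (Fin d) := ⟨i⟩
  have hR := isRadial_FT hu
  have hpos : ∀ x : Ed d, 0 ≤ ‖FT u x‖ ^ (2 : ℕ) := fun x => by positivity
  have hintg : Integrable fun ξ => ‖FT u ξ‖ ^ (2 : ℕ) := by
    simp only [FT_schwartz_apply]
    exact (((FourierTransform.fourier u).memLp 2 volume).integrable_norm_pow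
      (by norm_num)).comp_smul (inv_ne_zero (by positivity))
  have e : ∀ ξ, ‖FT u ξ‖ ^ (2 : ℕ) = ‖profile i (FT u) ‖ξ‖‖ ^ (2 : ℕ) := fun ξ => by
    rw [← eq_profile_of_isRadial i hR]
  have hintg' := hintg
  simp only [e] at hintg'
  have hI := (integrable_fun_norm_addHaar (volume : Measure (Ed d))
    (f := fun y => ‖profile i (FT u) y‖ ^ (2 : ℕ))).1 hintg'
  have h := integral_fun_norm_addHaar (volume : Measure (Ed d))
    (fun y => ‖profile i (FT u) y‖ ^ (2 : ℕ))
  simp only [← e] at h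
  have h2 : ∫⁻ ξ, ‖FT u ξ‖ₑ ^ (2 : ℕ) = ENNReal.ofReal (∫ ξ, ‖FT u ξ‖ ^ (2 : ℕ)) := by
    rw [ofReal_integral_eq_lintegral_ofReal hintg (ae_of_all _ hpos)]
    congr 1
    ext x
    rw [ENNReal.ofReal_pow (norm_nonneg _), ofReal_norm]
  rw [finrank_euclideanSpace_fin] at h hI
  rw [h2, h, nsmul_eq_mul, smul_eq_mul, ← mul_assoc,
    ENNReal.ofReal_mul (p := (d : ℝ) * volume.real (Metric.ball (0 : Ed d) 1)) (by positivity),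
    ofReal_integral_eq_lintegral_ofReal hI]
  · congr 1
    refine setLIntegral_congr_fun measurableSet_Ioi fun x hx => ?_
    have hx0 : (0 : ℝ) < x := hx
    rw [smul_eq_mul, ENNReal.ofReal_mul (by positivity),
      ENNReal.ofReal_pow (norm_nonneg _), ofReal_norm, mul_comm]
  · filter_upwards [ae_restrict_mem measurableSet_Ioi] with x hx
    have hx0 : (0 : ℝ) < x := hx
    rw [smul_eq_mul]
    positivity

theorem integral_gaussian_cexp_inner {d : ℕ} {ε : ℝ} (hε : 0 < ε) (y : Ed d) :
    ‖∫ x : Ed d, (Real.exp (-ε * ‖x‖ ^ 2) : ℝ) • cexp (I * ((⟪y, x⟫ : ℝ) : ℂ))‖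
      = (Real.pi / ε) ^ ((d : ℝ) / 2) * Real.exp (-(4 * ε)⁻¹ * ‖y‖ ^ 2) := by
  have h := GaussianFourier.integral_cexp_neg_mul_sq_norm_add (V := Ed d) (b := (ε : ℂ))
    (by simpa using hε) I y
  have e : ∀ x : Ed d, (Real.exp (-ε * ‖x‖ ^ 2) : ℝ) • cexp (I * ((⟪y, x⟫ : ℝ) : ℂ))
      = cexp (-(ε : ℂ) * (‖x‖ : ℂ) ^ 2 + I * ((⟪y, x⟫ : ℝ) : ℂ)) := by
    intro x
    rw [Complex.exp_add, Complex.real_smul]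
    push_cast
    rfl
  simp only [e]
  rw [h, finrank_euclideanSpace_fin]
  have e2 : (Real.pi / (ε : ℂ)) ^ ((d : ℂ) / 2) * cexp (I ^ 2 * (‖y‖ : ℂ) ^ 2 / (4 * (ε : ℂ)))
      = (((Real.pi / ε) ^ ((d : ℝ) / 2) * Real.exp (-(4 * ε)⁻¹ * ‖y‖ ^ 2) : ℝ) : ℂ) := by
    rw [ofReal_mul, ofReal_cpow (by positivity), I_sq]
    push_cast
    congr 2
    field_simp
  rw [e2, norm_real, Real.norm_of_nonneg (by positivity)]

theorem lintegral_gaussian_le {d : ℕ} {b : ℝ} (hb : 0 < b) (y : Ed d) :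
    ∫⁻ x : Ed d, ENNReal.ofReal (Real.exp (-b * ‖y - x‖ ^ 2))
      = ENNReal.ofReal ((Real.pi / b) ^ ((d : ℝ) / 2)) := by
  rw [lintegral_sub_left_eq_self (fun x : Ed d => ENNReal.ofReal (Real.exp (-b * ‖x‖ ^ 2))) y]
  have h := GaussianFourier.integral_rexp_neg_mul_sq_norm (V := Ed d) hb
  rw [finrank_euclideanSpace_fin] at h
  rw [← h, ofReal_integral_eq_lintegral_ofReal]
  · by_contra hc
    rw [integral_undef hc] at h
    have : 0 < (Real.pi / b) ^ ((d : ℝ) / 2) := by positivity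
    linarith
  · exact ae_of_all _ fun x => (Real.exp_pos _).le

theorem continuous_cexp_inner (d : ℕ) :
    Continuous (Function.uncurry fun x ξ : Ed d => cexp (I * ((⟪x, ξ⟫ : ℝ) : ℂ))) := by
  have : Continuous fun p : Ed d × Ed d => (⟪p.1, p.2⟫ : ℝ) := continuous_fst.inner continuous_snd
  exact Complex.continuous_exp.comp (continuous_const.mul (continuous_ofReal.comp this))

theorem aestronglyMeasurable_integral_cexp_inner {d : ℕ} {g : Ed d → ℂ} (hg : Integrable g) :
    AEStronglyMeasurable (fun x : Ed d => ∫ ξ, cexp (I * ((⟪x, ξ⟫ : ℝ) : ℂ)) * g ξ) volume := by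
  have : AEStronglyMeasurable (fun p : Ed d × Ed d => cexp (I * ((⟪p.1, p.2⟫ : ℝ) : ℂ)) * g p.2)
      (volume.prod volume) :=
    (continuous_cexp_inner d).measurable.aestronglyMeasurable.mul
      hg.aestronglyMeasurable.comp_snd
  exact this.integral_prod_right'

/-- Plancherel inequality for the oscillatory integral of an integrable function. -/
theorem lintegral_integral_cexp_inner_sq_le {d : ℕ} {g : Ed d → ℂ} (hg : Integrable g) :
    ∫⁻ x : Ed d, ‖∫ ξ, cexp (I * ((⟪x, ξ⟫ : ℝ) : ℂ)) * g ξ‖ₑ ^ 2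
      ≤ ENNReal.ofReal ((2 * Real.pi) ^ d) * ∫⁻ ξ, ‖g ξ‖ₑ ^ 2 := by
  set F : Ed d → ℂ := fun x => ∫ ξ, cexp (I * ((⟪x, ξ⟫ : ℝ) : ℂ)) * g ξ with hF
  have hec := continuous_cexp_inner d
  have hFm : AEStronglyMeasurable F volume := aestronglyMeasurable_integral_cexp_inner hg
  set w : ℝ → Ed d → ℝ≥0∞ := fun ε x => ENNReal.ofReal (Real.exp (-ε * ‖x‖ ^ 2)) with hw
  have hwm : ∀ ε, Measurable (w ε) := fun ε => by
    simp only [hw]; fun_prop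
  have main : ∀ ε : ℝ, 0 < ε → ∫⁻ x, w ε x * ‖F x‖ₑ ^ 2
      ≤ ENNReal.ofReal ((2 * Real.pi) ^ d) * ∫⁻ ξ, ‖g ξ‖ₑ ^ 2 := by
    intro ε hε
    have hfin : IsFiniteMeasure ((volume : Measure (Ed d)).withDensity (w ε)) := by
      refine isFiniteMeasure_withDensity ?_
      have := lintegral_gaussian_le (d := d) hε 0
      simp only [zero_sub, norm_neg] at this
      rw [hw]
      simp only
      rw [this]
      exact ENNReal.ofReal_ne_top
    have hprod : (Real.pi / ε) ^ ((d : ℝ) / 2) * (Real.pi / (4 * ε)⁻¹) ^ ((d : ℝ) / 2)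
        = (2 * Real.pi) ^ d := by
      rw [← Real.mul_rpow (by positivity) (by positivity),
        show Real.pi / ε * (Real.pi / (4 * ε)⁻¹) = (2 * Real.pi) ^ (2 : ℝ) by
          rw [Real.rpow_two]; field_simp; norm_num,
        ← Real.rpow_mul (by positivity), ← Real.rpow_natCast]
      congr 1
      ring
    set k : Ed d → Ed d → ℝ≥0∞ := fun y y' => ENNReal.ofReal ((Real.pi / ε) ^ ((d : ℝ) / 2)) *
      ENNReal.ofReal (Real.exp (-(4 * ε)⁻¹ * ‖y - y'‖ ^ 2)) with hk
    have hrow : ∀ y, ∫⁻ y', k y y' ≤ ENNReal.ofReal ((2 * Real.pi) ^ d) := by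
      intro y
      simp only [hk]
      rw [lintegral_const_mul' _ _ ENNReal.ofReal_ne_top, lintegral_gaussian_le (by positivity),
        ← ENNReal.ofReal_mul (by positivity), hprod]
    have hcomm : ∀ y y', k y y' = k y' y := fun y y' => by
      simp only [hk]; rw [norm_sub_rev]
    have hkm : Measurable (Function.uncurry k) := by
      have : Continuous fun p : Ed d × Ed d =>
          Real.exp (-(4 * ε)⁻¹ * ‖p.1 - p.2‖ ^ 2) :=
        Real.continuous_exp.comp
          (continuous_const.mul ((continuous_fst.sub continuous_snd).norm.pow 2))
      exact (this.measurable.ennreal_ofReal).const_mul _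
    have h := lintegral_enorm_sq_le_of_kernel_bound
      (μ := (volume : Measure (Ed d)).withDensity (w ε)) (ν := (volume : Measure (Ed d)))
      hec.measurable (M := 1) (fun x ξ => (norm_cexp_I_mul _).le) hg hkm hrow
      (fun y' => by simpa only [hcomm _ y'] using hrow y') (fun y y' => ?_)
    · rwa [lintegral_withDensity_eq_lintegral_mul₀ (hwm ε).aemeasurable
        (hFm.enorm.pow_const 2)] at h
    · rw [integral_withDensity_eq_integral_toReal_smul (hwm ε)
        (ae_of_all _ fun x => ENNReal.ofReal_lt_top)]
      have e : ∀ x : Ed d, (w ε x).toReal •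
          (cexp (I * ((⟪x, y⟫ : ℝ) : ℂ)) * conj (cexp (I * ((⟪x, y'⟫ : ℝ) : ℂ))))
          = (Real.exp (-ε * ‖x‖ ^ 2) : ℝ) • cexp (I * ((⟪y - y', x⟫ : ℝ) : ℂ)) := by
        intro x
        rw [hw]
        simp only
        rw [ENNReal.toReal_ofReal (Real.exp_pos _).le, ← Complex.exp_conj, ← Complex.exp_add,
          inner_sub_left, real_inner_comm y x, real_inner_comm y' x]
        congr 2
        simp only [map_mul, conj_I, conj_ofReal]
        push_cast
        ring
      simp only [e]
      rw [← ofReal_norm, integral_gaussian_cexp_inner hε, ENNReal.ofReal_mul (by positivity)]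
  have hlim : ∀ x, Filter.Tendsto (fun n : ℕ => w (1 / ((n : ℝ) + 1)) x * ‖F x‖ₑ ^ 2)
      Filter.atTop (nhds (‖F x‖ₑ ^ 2)) := by
    intro x
    have h1 : Filter.Tendsto (fun n : ℕ => w (1 / ((n : ℝ) + 1)) x) Filter.atTop (nhds 1) := by
      have h0 := tendsto_one_div_add_atTop_nhds_zero_nat (𝕜 := ℝ)
      have h2 := (Real.continuous_exp.tendsto _).comp ((h0.neg).mul_const (‖x‖ ^ 2))
      have h3 := ENNReal.tendsto_ofReal h2
      simpa [hw, Function.comp_def] using h3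
    have h2 := ENNReal.Tendsto.mul_const (b := ‖F x‖ₑ ^ 2) h1 (Or.inl one_ne_zero)
    simpa using h2
  calc ∫⁻ x, ‖F x‖ₑ ^ 2
      = ∫⁻ x, Filter.liminf (fun n : ℕ => w (1 / ((n : ℝ) + 1)) x * ‖F x‖ₑ ^ 2) Filter.atTop := by
        congr 1
        ext x
        exact (hlim x).liminf_eq.symm
    _ ≤ Filter.liminf (fun n : ℕ => ∫⁻ x, w (1 / ((n : ℝ) + 1)) x * ‖F x‖ₑ ^ 2) Filter.atTop :=
        lintegral_liminf_le' fun n => (hwm _).aemeasurable.mul (hFm.enorm.pow_const 2)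
    _ ≤ _ := by
        refine Filter.liminf_le_of_le ?_ fun b hb => ?_
        · isBoundedDefault
        · obtain ⟨n, hn⟩ := hb.exists
          exact hn.trans (main _ (by positivity))

theorem aestronglyMeasurable_fprop {d : ℕ} (s t : ℝ) (u : SchwartzMap (Ed d) ℂ) :
    AEStronglyMeasurable (fprop s t u) volume :=
  (aestronglyMeasurable_integral_cexp_inner (integrable_phase_mul_FT s t u)).const_mul _

theorem lintegral_fprop_sq_le {d : ℕ} (s t : ℝ) (u : SchwartzMap (Ed d) ℂ) :
    ∫⁻ x, ‖fprop s t u x‖ₑ ^ 2 ≤ ∫⁻ x, ‖u x‖ₑ ^ 2 := by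
  have h := lintegral_integral_cexp_inner_sq_le (integrable_phase_mul_FT s t u)
  have hn : ∀ ξ : Ed d, ‖cexp (-I * (t : ℂ) * ((‖ξ‖ ^ (2 * s) : ℝ) : ℂ)) * FT u ξ‖ₑ
      = ‖FT u ξ‖ₑ := by
    intro ξ
    rw [← ofReal_norm, norm_mul, norm_cexp_phase, one_mul, ofReal_norm]
  simp only [hn] at h
  rw [lintegral_FT_sq] at h
  set c : ℝ := (2 * Real.pi) ^ (-(d : ℝ)) with hc
  have hc0 : 0 < c := by positivity
  have hcd : c * (2 * Real.pi) ^ d = 1 := by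
    rw [hc, ← Real.rpow_natCast, ← Real.rpow_add (by positivity)]
    simp
  have e : ∀ x, ‖fprop s t u x‖ₑ ^ 2 = ENNReal.ofReal c ^ 2 *
      ‖∫ ξ, cexp (I * ((⟪x, ξ⟫ : ℝ) : ℂ)) *
        (cexp (-I * (t : ℂ) * ((‖ξ‖ ^ (2 * s) : ℝ) : ℂ)) * FT u ξ)‖ₑ ^ 2 := by
    intro x
    rw [fprop, FTinv, enorm_mul, mul_pow, ← ofReal_norm ((c : ℝ) : ℂ), norm_real,
      Real.norm_of_nonneg hc0.le]
  simp only [e]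
  rw [lintegral_const_mul' _ _ (ENNReal.pow_ne_top ENNReal.ofReal_ne_top)]
  refine (mul_le_mul' le_rfl h).trans (le_of_eq ?_)
  rw [← mul_assoc, ← mul_assoc, ← ENNReal.ofReal_pow hc0.le, ← ENNReal.ofReal_mul (by positivity),
    ← ENNReal.ofReal_mul (by positivity),
    show c ^ 2 * (2 * Real.pi) ^ d * (2 * Real.pi) ^ d
      = (c * (2 * Real.pi) ^ d) * (c * (2 * Real.pi) ^ d) by ring, hcd]
  simp

/-- The endpoint `q = 2` of the radial Strichartz estimate. -/
theorem exists_endpoint_fprop {d : ℕ} (hd : 2 ≤ d) {s : ℝ} (hs : (d : ℝ) / (2 * d - 1) < s)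
    (hs1 : s < 1) :
    ∃ C : ℝ≥0∞, C ≠ ⊤ ∧ ∀ u : SchwartzMap (Ed d) ℂ, IsRadial u →
      ∫⁻ t : ℝ, (∫⁻ x, ‖fprop s t u x‖ₑ ^ (2 / (1 - 2 * s / d))) ^ (1 - 2 * s / d)
        ≤ C * ∫⁻ x, ‖u x‖ₑ ^ 2 := by
  have hd' : (2 : ℝ) ≤ d := by exact_mod_cast hd
  have hd1 : (0 : ℝ) < 2 * d - 1 := by linarith
  have hs' : (d : ℝ) < s * (2 * d - 1) := (div_lt_iff₀ hd1).1 hs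
  have ha : 1 < 2 * s := by nlinarith
  have hγ : (1 : ℝ) / 2 < d - d / (2 * s) := by
    rw [lt_sub_comm, div_lt_iff₀ (by linarith)]
    nlinarith
  set i : Fin d := ⟨0, by omega⟩
  have : Nonempty (Fin d) := ⟨i⟩
  obtain ⟨C, hC, h⟩ := exists_endpoint_radWave i ha (by linarith) (by linarith : 2 * s < d)
    (γ := min 1 ((1 / 2 + (d - d / (2 * s))) / 2)) (lt_min (by norm_num) (by linarith))
    (min_le_left _ _) ((min_le_right _ _).trans_lt (by linarith))
  set θ : ℝ := 1 - 2 * s / d with hθ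
  have hθ0 : 0 < θ := by
    rw [hθ, sub_pos, div_lt_one (by linarith)]
    linarith
  set c : ℝ := (2 * Real.pi) ^ (-(d : ℝ)) with hc
  have hc0 : 0 < c := by positivity
  set V : ℝ := d * (volume : Measure (Ed d)).real (Metric.ball 0 1) with hV
  have hV0 : 0 < V := by
    have : 0 < (volume : Measure (Ed d)).real (Metric.ball 0 1) :=
      ENNReal.toReal_pos (Metric.measure_ball_pos _ _ one_pos).ne' measure_ball_lt_top.ne
    positivity
  refine ⟨ENNReal.ofReal c ^ (2 : ℝ) * (C * (ENNReal.ofReal V⁻¹ *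
    ENNReal.ofReal ((2 * Real.pi) ^ d))), ?_, fun u hu => ?_⟩
  · exact ENNReal.mul_ne_top (ENNReal.rpow_ne_top_of_nonneg (by norm_num) ENNReal.ofReal_ne_top)
      (ENNReal.mul_ne_top hC (ENNReal.mul_ne_top ENNReal.ofReal_ne_top ENNReal.ofReal_ne_top))
  have hi := h (profile i (FT u)) (continuous_profile i (continuous_FT u))
    (integrableOn_profile i (isRadial_FT hu) (integrable_FT u))
  have e : ∀ t x, ‖fprop s t u x‖ₑ ^ (2 / θ) = ENNReal.ofReal c ^ (2 / θ) *
      ‖radWave i (2 * s) (profile i (FT u)) t ‖x‖‖ₑ ^ (2 / θ) := by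
    intro t x
    rw [fprop_eq_radWave i s t hu, enorm_mul, ENNReal.mul_rpow_of_nonneg _ _ (by positivity),
      ← ofReal_norm ((c : ℝ) : ℂ), norm_real, Real.norm_of_nonneg hc0.le]
  have hcθ : ENNReal.ofReal c ^ (2 / θ) ≠ ⊤ :=
    ENNReal.rpow_ne_top_of_nonneg (by positivity) ENNReal.ofReal_ne_top
  have e2 : ∀ t, (∫⁻ x, ‖fprop s t u x‖ₑ ^ (2 / θ)) ^ θ = ENNReal.ofReal c ^ (2 : ℝ) *
      (∫⁻ x : Ed d, ‖radWave i (2 * s) (profile i (FT u)) t ‖x‖‖ₑ ^ (2 / θ)) ^ θ := by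
    intro t
    simp only [e]
    rw [lintegral_const_mul' _ _ hcθ, ENNReal.mul_rpow_of_nonneg _ _ hθ0.le, ← ENNReal.rpow_mul,
      div_mul_cancel₀ _ hθ0.ne']
  simp only [e2]
  rw [lintegral_const_mul' _ _
    (ENNReal.rpow_ne_top_of_nonneg (by norm_num) ENNReal.ofReal_ne_top), mul_assoc]
  refine mul_le_mul' le_rfl (hi.trans ?_)
  rw [mul_assoc]
  refine mul_le_mul' le_rfl (le_of_eq ?_)
  rw [mul_assoc, ← lintegral_FT_sq, ← lintegral_profile_sq i hu, ← hV, ← mul_assoc,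
    ← ENNReal.ofReal_mul (by positivity), inv_mul_cancel₀ hV0.ne', ENNReal.ofReal_one, one_mul]

/-- Log-convexity of `L^p` norms between `L²` and `L^{2/θ}`. -/
theorem lintegral_rpow_le_of_interpolation {α : Type*} [MeasurableSpace α] {μ : Measure α}
    {f : α → ℝ≥0∞} (hf : AEMeasurable f μ) {θ p ρ : ℝ} (hθ : 0 < θ) (hp : 2 ≤ p)
    (hρ : ρ = (1 - 2 / p) / 2 + θ / p) :
    (∫⁻ x, f x ^ (1 / ρ) ∂μ) ^ (ρ * p)
      ≤ (∫⁻ x, f x ^ 2 ∂μ) ^ (p / 2 - 1) * (∫⁻ x, f x ^ (2 / θ) ∂μ) ^ θ := by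
  have hp0 : 0 < p := by linarith
  have h2p : 2 / p ≤ 1 := (div_le_one hp0).2 hp
  have hθp : 0 < θ / p := by positivity
  have hρ0 : 0 < ρ := by rw [hρ]; linarith
  have h := ENNReal.lintegral_mul_norm_pow_le (μ := μ) (hf.pow_const 2) (hf.pow_const (2 / θ))
    (p := (1 - 2 / p) / 2 / ρ) (q := θ / p / ρ)
    (div_nonneg (by linarith) hρ0.le) (by positivity)
    (by rw [← add_div, ← hρ, div_self hρ0.ne'])
  have e : ∀ x, (f x ^ 2) ^ ((1 - 2 / p) / 2 / ρ) * (f x ^ (2 / θ)) ^ (θ / p / ρ)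
      = f x ^ (1 / ρ) := by
    intro x
    rw [← ENNReal.rpow_ofNat, ← ENNReal.rpow_mul, ← ENNReal.rpow_mul,
      ← ENNReal.rpow_add_of_nonneg]
    · congr 1
      field_simp
      ring
    · exact mul_nonneg (by norm_num) (div_nonneg (by linarith) hρ0.le)
    · positivity
  simp only [e] at h
  refine (ENNReal.rpow_le_rpow h (by positivity)).trans (le_of_eq ?_)
  rw [ENNReal.mul_rpow_of_nonneg _ _ (by positivity), ← ENNReal.rpow_mul, ← ENNReal.rpow_mul]
  congr 2 <;> field_simp

theorem eLpNorm_two_eq {α : Type*} [MeasurableSpace α] {μ : Measure α} (f : α → ℂ) :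
    eLpNorm f 2 μ = (∫⁻ x, ‖f x‖ₑ ^ 2 ∂μ) ^ ((1 : ℝ) / 2) := by
  rw [eLpNorm_eq_lintegral_rpow_enorm_toReal (by norm_num) (by norm_num)]
  simp

end RadialStrichartz

open RadialStrichartz

theorem stmt2 (d : ℕ) (hd : 2 ≤ d) (s : ℝ) (hs : (d : ℝ) / (2 * d - 1) < s) (hs1 : s < 1)
    (q r : ℝ≥0∞) (hq : 2 ≤ q) (hr : 2 ≤ r)
    (hadm : ENNReal.ofReal (2 * s) * q⁻¹ = (d : ℝ≥0∞) * (2⁻¹ - r⁻¹)) :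
    ∃ C : ℝ, 0 < C ∧ ∀ u₀ : SchwartzMap (Ed d) ℂ, IsRadial (⇑u₀) →
      mixedNorm q r (fun t => fprop s t (⇑u₀))
        ≤ ENNReal.ofReal C * eLpNorm (⇑u₀) 2 volume := by
  have hd' : (2 : ℝ) ≤ d := by exact_mod_cast hd
  have hs0 : 0 < s := lt_of_le_of_lt (div_nonneg (by linarith) (by linarith)) hs
  have htr : ∀ x : ℝ≥0∞, ‖x.toReal‖ₑ ≤ x := fun x => by
    rw [Real.enorm_of_nonneg ENNReal.toReal_nonneg]
    exact ENNReal.ofReal_toReal_le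
  have hri : r⁻¹ ≤ 2⁻¹ := ENNReal.inv_le_inv.2 hr
  rcases eq_or_ne q ⊤ with rfl | hqt
  · have hr2 : r = 2 := by
      rw [ENNReal.inv_top, mul_zero, eq_comm, mul_eq_zero] at hadm
      have h := hadm.resolve_left (by simp; omega)
      exact le_antisymm (ENNReal.inv_le_inv.1 (tsub_eq_zero_iff_le.1 h)) hr
    subst hr2
    refine ⟨1, one_pos, fun u hu => ?_⟩
    rw [ENNReal.ofReal_one, one_mul, mixedNorm, eLpNorm_exponent_top]
    refine eLpNormEssSup_le_of_ae_enorm_bound (ae_of_all _ fun t => (htr _).trans ?_)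
    rw [eLpNorm_two_eq, eLpNorm_two_eq]
    exact ENNReal.rpow_le_rpow (lintegral_fprop_sq_le s t u) (by norm_num)
  have hq0 : q ≠ 0 := (zero_lt_two.trans_le hq).ne'
  set p : ℝ := q.toReal with hp
  have hp2 : 2 ≤ p := by
    have := ENNReal.toReal_mono hqt hq
    simpa using this
  have hp0 : 0 < p := by linarith
  set ρ : ℝ := (r⁻¹).toReal with hρ
  have hadm' : 2 * s / p = d * (1 / 2 - ρ) := by
    have h := congrArg ENNReal.toReal hadm
    rw [ENNReal.toReal_mul, ENNReal.toReal_mul, ENNReal.toReal_sub_of_le hri (by simp),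
      ENNReal.toReal_ofReal (by linarith), ENNReal.toReal_inv] at h
    simpa [hp, hρ, div_eq_mul_inv] using h
  set θ : ℝ := 1 - 2 * s / d with hθ
  have hθ0 : 0 < θ := by
    rw [hθ, sub_pos, div_lt_one (by linarith)]
    linarith
  have hρeq : ρ = (1 - 2 / p) / 2 + θ / p := by
    have : ρ = 1 / 2 - 2 * s / p / d := by
      rw [hadm']; field_simp; ring
    rw [this, hθ]
    field_simp
    ring
  have hρ0 : 0 < ρ := by
    have h2p : 2 / p ≤ 1 := (div_le_one hp0).2 hp2
    have : 0 < θ / p := by positivity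
    rw [hρeq]; linarith
  have hr0 : r ≠ 0 := (zero_lt_two.trans_le hr).ne'
  have hrt : r ≠ ⊤ := by
    rintro rfl
    simp [hρ] at hρ0
  have hrρ : r.toReal = 1 / ρ := by rw [hρ, ENNReal.toReal_inv, one_div, inv_inv]
  obtain ⟨C, hC, h⟩ := exists_endpoint_fprop hd hs hs1
  refine ⟨(C ^ (1 / p)).toReal + 1, by positivity, fun u hu => ?_⟩
  set A : ℝ≥0∞ := ∫⁻ x, ‖u x‖ₑ ^ 2 with hA
  have hAt : A ≠ ⊤ := by
    have := (u.memLp 2 volume).2.ne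
    rw [eLpNorm_two_eq] at this
    exact fun hc => this (by rw [← hA, hc]; exact ENNReal.top_rpow_of_pos (by norm_num))
  have hslice : ∀ t, ‖(eLpNorm (fprop s t u) r volume).toReal‖ₑ ^ p
      ≤ A ^ (p / 2 - 1) * (∫⁻ x, ‖fprop s t u x‖ₑ ^ (2 / θ)) ^ θ := by
    intro t
    refine (ENNReal.rpow_le_rpow (htr _) hp0.le).trans ?_
    rw [eLpNorm_eq_lintegral_rpow_enorm_toReal hr0 hrt, hrρ, one_div_one_div,
      ← ENNReal.rpow_mul]
    refine (lintegral_rpow_le_of_interpolation (aestronglyMeasurable_fprop s t u).enorm hθ0 hp2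
      hρeq).trans ?_
    exact mul_le_mul' (ENNReal.rpow_le_rpow (lintegral_fprop_sq_le s t u) (by linarith)) le_rfl
  rw [mixedNorm, eLpNorm_eq_lintegral_rpow_enorm_toReal hq0 hqt, eLpNorm_two_eq, ← hp, ← hA]
  have hC' : C ^ (1 / p) ≤ ENNReal.ofReal ((C ^ (1 / p)).toReal + 1) := by
    rw [ENNReal.ofReal_add ENNReal.toReal_nonneg zero_le_one, ENNReal.ofReal_toReal
      (ENNReal.rpow_ne_top_of_nonneg (by positivity) hC)]
    exact le_self_add
  calc (∫⁻ t, ‖(eLpNorm (fprop s t u) r volume).toReal‖ₑ ^ p) ^ (1 / p)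
      ≤ (A ^ (p / 2 - 1) * (C * A)) ^ (1 / p) := by
        refine ENNReal.rpow_le_rpow ((lintegral_mono hslice).trans ?_) (by positivity)
        rw [lintegral_const_mul' _ _ (ENNReal.rpow_ne_top_of_nonneg (by linarith) hAt)]
        exact mul_le_mul' le_rfl (h u hu)
    _ = C ^ (1 / p) * A ^ ((1 : ℝ) / 2) := by
        have : A ^ (p / 2 - 1) * (C * A) = C * A ^ (p / 2) := by
          rw [mul_left_comm]
          nth_rewrite 2 [← ENNReal.rpow_one A]
          rw [← ENNReal.rpow_add_of_nonneg _ _ (by linarith) zero_le_one, sub_add_cancel]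
        rw [this, ENNReal.mul_rpow_of_nonneg _ _ (by positivity), ← ENNReal.rpow_mul]
        congr 2
        field_simp
    _ ≤ _ := mul_le_mul' hC' le_rfl

end
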